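/- arXiv:1506.00949 — 2 statements merged into one kernel-verified Lean document; each statement's English description precedes it below -/
import Mathlib

section
/- Let Γ = (K, I, J, C, D, g, q) be a finite recursive game with signals in which player 1 is more informed than player 2. Then for every initial distribution π ∈ Δ¹(K×C×D): the limits lim_{n→∞} v_n(π) and lim_{λ→0} v_λ(π) exist, the uniform maxmin v̲_∞(π) exists, and v̲_∞(π) = lim_{n→∞} v_n(π) = lim_{λ→0} v_λ(π). -/
open scoped Classical
open Filter

noncomputable section

namespace SigGame

variable {K I J C D : Type} [Fintype K] [Fintype I] [Fintype J] [Fintype C] [Fintype D]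

/-- A behavior strategy of player 1 in a repeated game with signals: to every private
history (past signals and own past actions, plus the current signal), a mixed action. -/
structure Strat1 (C I : Type) [Fintype I] where
  play : List (C × I) → C → I → ℝ
  nonneg : ∀ h c i, 0 ≤ play h c i
  sum_one : ∀ h c, ∑ i, play h c i = 1

/-- A behavior strategy of player 2. -/
structure Strat2 (D J : Type) [Fintype J] where
  play : List (D × J) → D → J → ℝ
  nonneg : ∀ h d j, 0 ≤ play h d j
  sum_one : ∀ h d, ∑ j, play h d j = 1

/-- The private history of player 1 (signals and own actions) along a full record. -/
def p1hist : List (K × C × D × I × J) → List (C × I) :=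
  List.map (fun z => (z.2.1, z.2.2.2.1))

/-- The private history of player 2 (signals and own actions) along a full record. -/
def p2hist : List (K × C × D × I × J) → List (D × J) :=
  List.map (fun z => (z.2.2.1, z.2.2.2.2))

/-- Auxiliary: the probability of a finite record, given in reverse chronological
order, the last coordinate being the current (state, signal, signal) triple. -/
def recProbAux (q : K → I → J → K × C × D → ℝ) (π : K × C × D → ℝ)
    (σ : Strat1 C I) (τ : Strat2 D J) :
    List (K × C × D × I × J) → (K × C × D) → ℝ
  | [], s => π s
  | z :: rest, s =>
      recProbAux q π σ τ rest (z.1, z.2.1, z.2.2.1) *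
        σ.play (p1hist rest.reverse) z.2.1 z.2.2.2.1 *
        τ.play (p2hist rest.reverse) z.2.2.1 z.2.2.2.2 *
        q z.1 z.2.2.2.1 z.2.2.2.2 s

/-- Probability, under `(π, σ, τ)`, of a finite record of the play (the chronological
list of completed stages, and the current (state, signal, signal) triple). -/
def recProb (q : K → I → J → K × C × D → ℝ) (π : K × C × D → ℝ)
    (σ : Strat1 C I) (τ : Strat2 D J)
    (r : List (K × C × D × I × J)) (s : K × C × D) : ℝ :=
  recProbAux q π σ τ r.reverse s

/-- Expected payoff of stage `t`. -/
def sPayoff (g : K → I → J → ℝ) (q : K → I → J → K × C × D → ℝ) (π : K × C × D → ℝ)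
    (σ : Strat1 C I) (τ : Strat2 D J) (t : ℕ) : ℝ :=
  ∑' rs : List (K × C × D × I × J) × (K × C × D),
    if rs.1.length + 1 = t then
      recProb q π σ τ rs.1 rs.2 *
        ∑ i, ∑ j, σ.play (p1hist rs.1) rs.2.2.1 i *
          τ.play (p2hist rs.1) rs.2.2.2 j * g rs.2.1 i j
    else 0

/-- Expected average payoff `γ_n(π, σ, τ)` of the first `n` stages. -/
def avgPay (g : K → I → J → ℝ) (q : K → I → J → K × C × D → ℝ) (π : K × C × D → ℝ)
    (σ : Strat1 C I) (τ : Strat2 D J) (n : ℕ) : ℝ :=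
  (n : ℝ)⁻¹ * ∑ t ∈ Finset.Icc 1 n, sPayoff g q π σ τ t

/-- Expected `λ`-discounted payoff `γ_λ(π, σ, τ)`. -/
def discPay (g : K → I → J → ℝ) (q : K → I → J → K × C × D → ℝ) (π : K × C × D → ℝ)
    (σ : Strat1 C I) (τ : Strat2 D J) (lam : ℝ) : ℝ :=
  ∑' t : ℕ, lam * (1 - lam) ^ t * sPayoff g q π σ τ (t + 1)

/-- The value `v_n(π)` of the `n`-stage game. -/
def vn (g : K → I → J → ℝ) (q : K → I → J → K × C × D → ℝ) (π : K × C × D → ℝ)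
    (n : ℕ) : ℝ :=
  ⨆ σ : Strat1 C I, ⨅ τ : Strat2 D J, avgPay g q π σ τ n

/-- The value `v_λ(π)` of the `λ`-discounted game. -/
def vlam (g : K → I → J → ℝ) (q : K → I → J → K × C × D → ℝ) (π : K × C × D → ℝ)
    (lam : ℝ) : ℝ :=
  ⨆ σ : Strat1 C I, ⨅ τ : Strat2 D J, discPay g q π σ τ lam

/-- Player 1 can (uniformly) guarantee the amount `w` in `Γ(π)`. -/
def P1Guarantees (g : K → I → J → ℝ) (q : K → I → J → K × C × D → ℝ)
    (π : K × C × D → ℝ) (w : ℝ) : Prop :=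
  ∀ ε > (0 : ℝ), ∃ σ : Strat1 C I, ∃ n₀ : ℕ, 1 ≤ n₀ ∧
    ∀ n ≥ n₀, ∀ τ : Strat2 D J, avgPay g q π σ τ n ≥ w - ε

/-- Player 2 can defend the amount `w` in `Γ(π)`. -/
def P2Defends (g : K → I → J → ℝ) (q : K → I → J → K × C × D → ℝ)
    (π : K × C × D → ℝ) (w : ℝ) : Prop :=
  ∀ ε > (0 : ℝ), ∀ σ : Strat1 C I, ∃ τ : Strat2 D J, ∃ n₀ : ℕ, 1 ≤ n₀ ∧
    ∀ n ≥ n₀, avgPay g q π σ τ n ≤ w + ε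

/-- Player 2 can (uniformly) guarantee the amount `w` in `Γ(π)`. -/
def P2Guarantees (g : K → I → J → ℝ) (q : K → I → J → K × C × D → ℝ)
    (π : K × C × D → ℝ) (w : ℝ) : Prop :=
  ∀ ε > (0 : ℝ), ∃ τ : Strat2 D J, ∃ n₀ : ℕ, 1 ≤ n₀ ∧
    ∀ n ≥ n₀, ∀ σ : Strat1 C I, avgPay g q π σ τ n ≤ w + ε

/-- Player 1 can defend the amount `w` in `Γ(π)`. -/
def P1Defends (g : K → I → J → ℝ) (q : K → I → J → K × C × D → ℝ)
    (π : K × C × D → ℝ) (w : ℝ) : Prop :=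
  ∀ ε > (0 : ℝ), ∀ τ : Strat2 D J, ∃ σ : Strat1 C I, ∃ n₀ : ℕ, 1 ≤ n₀ ∧
    ∀ n ≥ n₀, avgPay g q π σ τ n ≥ w - ε

end SigGame

set_option linter.unusedSectionVars false

namespace SigGame

/-! ### Families of unnormalized beliefs and the one-step operator -/

/-- One-step data of a recursive game: `p k i j k' c d` is the probability that the play goes on
at `k'` with signals `(c, d)`, `m k i j` bounds the probability of absorption and `r k i j` is the
expected absorbing payoff. -/
structure StepData (K I J C D : Type) [Fintype K] [Fintype C] [Fintype D] where
  p : K → I → J → K → C → D → ℝ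
  r : K → I → J → ℝ
  m : K → I → J → ℝ
  p_nonneg : ∀ k i j k' c d, 0 ≤ p k i j k' c d
  abs_r_le : ∀ k i j, |r k i j| ≤ m k i j
  mass_le : ∀ k i j, m k i j + ∑ k', ∑ c, ∑ d, p k i j k' c d ≤ 1

/-- A functional on finite families of vectors indexed by arbitrary finite types. -/
abbrev FamFun (K : Type) := (S : Type) → [Fintype S] → (S → K → ℝ) → ℝ

/-- The `ℓ¹` norm of a finite family. -/
def fnorm {S K : Type} [Fintype S] [Fintype K] (a : S → K → ℝ) : ℝ := ∑ s, ∑ k, |a s k|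

/-- A family of mixed actions. -/
def IsMixed {S I : Type} [Fintype I] (α : S → I → ℝ) : Prop :=
  (∀ s i, 0 ≤ α s i) ∧ ∀ s, ∑ i, α s i = 1

section FNorm

variable {S K : Type} [Fintype S] [Fintype K]

lemma fnorm_nonneg (a : S → K → ℝ) : 0 ≤ fnorm a :=
  Finset.sum_nonneg fun _ _ => Finset.sum_nonneg fun _ _ => abs_nonneg _

lemma fnorm_smul {c : ℝ} (hc : 0 ≤ c) (a : S → K → ℝ) : fnorm (c • a) = c * fnorm a := by
  simp [fnorm, Finset.mul_sum, abs_mul, abs_of_nonneg hc]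

lemma fnorm_of_nonneg {a : S → K → ℝ} (ha : ∀ s k, 0 ≤ a s k) : fnorm a = ∑ s, ∑ k, a s k :=
  Finset.sum_congr rfl fun _ _ => Finset.sum_congr rfl fun _ _ => abs_of_nonneg (ha _ _)

lemma sum_comm_reverse {A B E F : Type} [Fintype A] [Fintype B] [Fintype E] [Fintype F]
    (f : A → B → E → F → ℝ) :
    ∑ w, ∑ x, ∑ y, ∑ z, f w x y z = ∑ z, ∑ y, ∑ x, ∑ w, f w x y z := by
  calc ∑ w, ∑ x, ∑ y, ∑ z, f w x y z = ∑ w, ∑ z, ∑ y, ∑ x, f w x y z := by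
        refine Finset.sum_congr rfl fun w _ => ?_
        rw [Finset.sum_congr rfl fun x _ => Finset.sum_comm, Finset.sum_comm]
        exact Finset.sum_congr rfl fun z _ => Finset.sum_comm
    _ = ∑ z, ∑ y, ∑ x, ∑ w, f w x y z := by
        rw [Finset.sum_comm]
        refine Finset.sum_congr rfl fun z _ => ?_
        rw [Finset.sum_comm]
        exact Finset.sum_congr rfl fun y _ => Finset.sum_comm

end FNorm

namespace StepData

variable {S K I J C D : Type} [Fintype S] [Fintype K] [Fintype I] [Fintype J] [Fintype C]
  [Fintype D] (G : StepData K I J C D)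

/-- The family of beliefs after one stage, when player 1 uses `α`, player 2 plays `j` and
receives the signal `d`. -/
def step (α : S → I → ℝ) (j : J) (d : D) (a : S → K → ℝ) : S × I × C → K → ℝ :=
  fun x k' => α x.1 x.2.1 * ∑ k, a x.1 k * G.p k x.2.1 j k' x.2.2 d

/-- The expected payoff absorbed during one stage. -/
def rew (α : S → I → ℝ) (j : J) (a : S → K → ℝ) : ℝ :=
  ∑ s, ∑ i, ∑ k, α s i * (a s k * G.r k i j)

/-- The mass absorbed during one stage. -/
def abm (α : S → I → ℝ) (j : J) (a : S → K → ℝ) : ℝ :=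
  ∑ s, ∑ i, ∑ k, α s i * (|a s k| * G.m k i j)

lemma step_nonneg {α : S → I → ℝ} (hα : IsMixed α) (j : J) (d : D) {a : S → K → ℝ}
    (ha : ∀ s k, 0 ≤ a s k) (x : S × I × C) (k' : K) : 0 ≤ G.step α j d a x k' :=
  mul_nonneg (hα.1 _ _) (Finset.sum_nonneg fun _ _ => mul_nonneg (ha _ _) (G.p_nonneg _ _ _ _ _ _))

lemma m_nonneg (k : K) (i : I) (j : J) : 0 ≤ G.m k i j :=
  (abs_nonneg _).trans (G.abs_r_le k i j)

lemma abm_nonneg {α : S → I → ℝ} (hα : IsMixed α) (j : J) (a : S → K → ℝ) :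
    0 ≤ G.abm α j a :=
  Finset.sum_nonneg fun _ _ => Finset.sum_nonneg fun _ _ => Finset.sum_nonneg fun _ _ =>
    mul_nonneg (hα.1 _ _) (mul_nonneg (abs_nonneg _) (G.m_nonneg _ _ _))

lemma abs_rew_le {α : S → I → ℝ} (hα : IsMixed α) (j : J) (a : S → K → ℝ) :
    |G.rew α j a| ≤ G.abm α j a := by
  unfold rew abm
  refine (Finset.abs_sum_le_sum_abs _ _).trans (Finset.sum_le_sum fun s _ => ?_)
  refine (Finset.abs_sum_le_sum_abs _ _).trans (Finset.sum_le_sum fun i _ => ?_)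
  refine (Finset.abs_sum_le_sum_abs _ _).trans (Finset.sum_le_sum fun k _ => ?_)
  rw [abs_mul, abs_mul, abs_of_nonneg (hα.1 s i)]
  exact mul_le_mul_of_nonneg_left (mul_le_mul_of_nonneg_left (G.abs_r_le _ _ _) (abs_nonneg _))
    (hα.1 s i)

lemma abm_add_sum_fnorm_le {α : S → I → ℝ} (hα : IsMixed α) (j : J) (a : S → K → ℝ) :
    G.abm α j a + ∑ d, fnorm (G.step α j d a) ≤ fnorm a := by
  have h1 : ∑ d, fnorm (G.step α j d a) ≤
      ∑ s, ∑ i, ∑ k, α s i * (|a s k| * ∑ k', ∑ c, ∑ d, G.p k i j k' c d) := by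
    calc ∑ d, fnorm (G.step α j d a)
        ≤ ∑ d, ∑ s, ∑ i, ∑ c, ∑ k', ∑ k, α s i * (|a s k| * G.p k i j k' c d) := by
          refine Finset.sum_le_sum fun d _ => ?_
          unfold fnorm
          rw [Fintype.sum_prod_type]
          refine Finset.sum_le_sum fun s _ => ?_
          rw [Fintype.sum_prod_type]
          refine Finset.sum_le_sum fun i _ => Finset.sum_le_sum fun c _ =>
            Finset.sum_le_sum fun k' _ => ?_
          simp only [step]
          rw [abs_mul, abs_of_nonneg (hα.1 s i), ← Finset.mul_sum]
          refine mul_le_mul_of_nonneg_left ?_ (hα.1 s i)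
          refine (Finset.abs_sum_le_sum_abs _ _).trans (le_of_eq ?_)
          refine Finset.sum_congr rfl fun k _ => ?_
          rw [abs_mul, abs_of_nonneg (G.p_nonneg _ _ _ _ _ _)]
      _ = _ := by
          rw [Finset.sum_comm]
          refine Finset.sum_congr rfl fun s _ => ?_
          rw [Finset.sum_comm]
          refine Finset.sum_congr rfl fun i _ => ?_
          rw [sum_comm_reverse]
          simp only [Finset.mul_sum]
  calc G.abm α j a + ∑ d, fnorm (G.step α j d a)
      ≤ ∑ s, ∑ i, ∑ k, α s i * |a s k| := by
        refine (add_le_add_right h1 _).trans ?_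
        unfold abm
        simp only [← Finset.sum_add_distrib]
        refine Finset.sum_le_sum fun s _ => Finset.sum_le_sum fun i _ =>
          Finset.sum_le_sum fun k _ => ?_
        rw [← mul_add, ← mul_add]
        exact mul_le_mul_of_nonneg_left
          (mul_le_of_le_one_right (abs_nonneg _) (G.mass_le _ _ _)) (hα.1 s i)
    _ = fnorm a := by
        refine Finset.sum_congr rfl fun s _ => ?_
        simp only [← Finset.mul_sum]
        rw [← Finset.sum_mul, hα.2 s, one_mul]

lemma step_sub (α : S → I → ℝ) (j : J) (d : D) (a b : S → K → ℝ) :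
    G.step α j d (a - b) = G.step α j d a - G.step α j d b := by
  funext x k'
  simp [step, sub_mul, Finset.sum_sub_distrib, mul_sub]

lemma step_smul (α : S → I → ℝ) (j : J) (d : D) (c : ℝ) (a : S → K → ℝ) :
    G.step α j d (c • a) = c • G.step α j d a := by
  funext x k'
  simp only [step, Pi.smul_apply, smul_eq_mul, Finset.mul_sum]
  exact Finset.sum_congr rfl fun k _ => by ring

lemma rew_sub (α : S → I → ℝ) (j : J) (a b : S → K → ℝ) :
    G.rew α j (a - b) = G.rew α j a - G.rew α j b := by
  simp [rew, sub_mul, Finset.sum_sub_distrib, mul_sub]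

lemma rew_smul (α : S → I → ℝ) (j : J) (c : ℝ) (a : S → K → ℝ) :
    G.rew α j (c • a) = c * G.rew α j a := by
  simp only [rew, Pi.smul_apply, smul_eq_mul, Finset.mul_sum]
  exact Finset.sum_congr rfl fun s _ => Finset.sum_congr rfl fun i _ =>
    Finset.sum_congr rfl fun k _ => by ring

/-- The payoff of the one-step game with continuation payoff `u`. -/
def psi (u : FamFun K) (α : S → I → ℝ) (j : J) (a : S → K → ℝ) : ℝ :=
  G.rew α j a + ∑ d, u (S × I × C) (G.step α j d a)

end StepData

/-- Positively homogeneous functionals which are nonexpansive and do not distinguish families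
differing by the splitting of a vector into proportional pieces. -/
structure Nice {K : Type} [Fintype K] (u : FamFun K) : Prop where
  lip : ∀ (S : Type) [Fintype S] (a b : S → K → ℝ), |u S a - u S b| ≤ fnorm (a - b)
  homog : ∀ (S : Type) [Fintype S] (c : ℝ) (a : S → K → ℝ), 0 ≤ c → u S (c • a) = c * u S a
  merge : ∀ (S T : Type) [Fintype S] [Fintype T] (φ : S → T) (m : S → ℝ) (b : T → K → ℝ),
    (∀ s, 0 ≤ m s) → u S (fun s => m s • b (φ s)) =
      u T (fun t => (∑ s, if φ s = t then m s else 0) • b t)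

namespace Nice

variable {S K : Type} [Fintype S] [Fintype K] {u : FamFun K}

lemma abs_le (hu : Nice u) (a : S → K → ℝ) : |u S a| ≤ fnorm a := by
  have h := hu.lip S a 0
  have h0 := hu.homog S 0 0 le_rfl
  simp only [smul_zero, zero_mul] at h0
  simpa [h0] using h

lemma continuous (hu : Nice u) : Continuous (u S) := by
  rw [continuous_iff_continuousAt]
  intro a
  have h : Tendsto (fun b : S → K → ℝ => fnorm (b - a)) (nhds a) (nhds 0) := by
    have hc : Continuous (fun b : S → K → ℝ => fnorm (b - a)) := by
      unfold fnorm; fun_prop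
    have := hc.tendsto a
    simpa [fnorm] using this
  have h2 : Tendsto (fun b => u S b - u S a) (nhds a) (nhds 0) :=
    squeeze_zero_norm (fun b => by simpa using hu.lip S b a) h
  simpa [ContinuousAt] using h2.add_const (u S a)

lemma zero : Nice (fun (S : Type) [Fintype S] (_ : S → K → ℝ) => (0 : ℝ)) where
  lip S _ a b := by simpa using fnorm_nonneg (a - b)
  homog := by simp
  merge := by simp

lemma const_mul (hu : Nice u) {c : ℝ} (hc : 0 ≤ c) (hc1 : c ≤ 1) :
    Nice (fun (S : Type) [Fintype S] a => c * u S a) where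
  lip S _ a b := by
    rw [← mul_sub, abs_mul, abs_of_nonneg hc]
    exact (mul_le_of_le_one_left (abs_nonneg _) hc1).trans (hu.lip S a b)
  homog S _ c' a h := by rw [hu.homog S c' a h]; ring
  merge S T _ _ φ m b h := by rw [hu.merge S T φ m b h]

end Nice

namespace StepData

variable {S K I J C D : Type} [Fintype S] [Fintype K] [Fintype I] [Fintype J] [Fintype C]
  [Fintype D] (G : StepData K I J C D)

lemma abs_psi_le {u : FamFun K} (hu : Nice u) {α : S → I → ℝ} (hα : IsMixed α) (j : J)
    (a : S → K → ℝ) : |G.psi u α j a| ≤ fnorm a :=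
  calc |G.psi u α j a| ≤ |G.rew α j a| + |∑ d, u (S × I × C) (G.step α j d a)| := abs_add_le _ _
    _ ≤ G.abm α j a + ∑ d, fnorm (G.step α j d a) :=
        add_le_add (G.abs_rew_le hα j a) ((Finset.abs_sum_le_sum_abs _ _).trans
          (Finset.sum_le_sum fun _ _ => hu.abs_le _))
    _ ≤ fnorm a := G.abm_add_sum_fnorm_le hα j a

lemma abs_psi_sub_le {u : FamFun K} (hu : Nice u) {α : S → I → ℝ} (hα : IsMixed α) (j : J)
    (a b : S → K → ℝ) : |G.psi u α j a - G.psi u α j b| ≤ fnorm (a - b) := by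
  have e : G.psi u α j a - G.psi u α j b = G.rew α j (a - b) +
      ∑ d, (u (S × I × C) (G.step α j d a) - u (S × I × C) (G.step α j d b)) := by
    rw [rew_sub, Finset.sum_sub_distrib]; unfold psi; ring
  rw [e]
  calc _ ≤ |G.rew α j (a - b)| + |∑ d, (u (S × I × C) (G.step α j d a) -
        u (S × I × C) (G.step α j d b))| := abs_add_le _ _
    _ ≤ G.abm α j (a - b) + ∑ d, fnorm (G.step α j d (a - b)) := by
        refine add_le_add (G.abs_rew_le hα j _) ((Finset.abs_sum_le_sum_abs _ _).trans
          (Finset.sum_le_sum fun d _ => ?_))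
        rw [step_sub]
        exact hu.lip _ _ _
    _ ≤ _ := G.abm_add_sum_fnorm_le hα j _

lemma abs_psi_sub_psi_le {u v : FamFun K} {α : S → I → ℝ} (hα : IsMixed α) {ε : ℝ} (hε : 0 ≤ ε)
    (j : J) (a : S → K → ℝ)
    (h : ∀ d : D, |u (S × I × C) (G.step α j d a) - v (S × I × C) (G.step α j d a)| ≤
      ε * fnorm (G.step α j d a)) :
    |G.psi u α j a - G.psi v α j a| ≤ ε * fnorm a := by
  have e : G.psi u α j a - G.psi v α j a =
      ∑ d, (u (S × I × C) (G.step α j d a) - v (S × I × C) (G.step α j d a)) := by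
    rw [Finset.sum_sub_distrib]; unfold psi; ring
  rw [e]
  calc _ ≤ ∑ d, ε * fnorm (G.step α j d a) :=
        (Finset.abs_sum_le_sum_abs _ _).trans (Finset.sum_le_sum fun d _ => h d)
    _ ≤ ε * fnorm a := by
        rw [← Finset.mul_sum]
        refine mul_le_mul_of_nonneg_left ?_ hε
        linarith [G.abm_add_sum_fnorm_le hα j a, G.abm_nonneg hα j a]

/-- The value of the one-step game with continuation payoff `u`, player 1 moving first. -/
def Phi (u : FamFun K) : FamFun K := fun S _ a =>
  ⨆ α : S → stdSimplex ℝ I, ⨅ j : J, G.psi u (fun s i => (α s).1 i) j a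

lemma isMixed_coe (α : S → stdSimplex ℝ I) : IsMixed (fun s i => (α s).1 i) :=
  ⟨fun s i => (α s).2.1 i, fun s => (α s).2.2⟩

variable [Nonempty I] [Nonempty J]

lemma bddAbove_iInf_psi {u : FamFun K} (hu : Nice u) (a : S → K → ℝ) :
    BddAbove (Set.range fun α : S → stdSimplex ℝ I =>
      ⨅ j : J, G.psi u (fun s i => (α s).1 i) j a) := by
  refine ⟨fnorm a, ?_⟩
  rintro _ ⟨α, rfl⟩
  exact (ciInf_le (Set.finite_range _).bddBelow (Classical.arbitrary J)).trans
    (le_of_abs_le (G.abs_psi_le hu (isMixed_coe α) _ a))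

lemma exists_psi_le_Phi {u : FamFun K} (hu : Nice u) {α : S → I → ℝ} (hα : IsMixed α)
    (a : S → K → ℝ) : ∃ j, G.psi u α j a ≤ G.Phi u S a := by
  obtain ⟨j, hj⟩ := exists_eq_ciInf_of_finite (f := fun j : J => G.psi u α j a)
  refine ⟨j, ?_⟩
  have := le_ciSup (G.bddAbove_iInf_psi hu a) (fun s => ⟨α s, hα.1 s, hα.2 s⟩)
  exact hj.le.trans this

lemma exists_Phi_le_psi {u : FamFun K} (hu : Nice u) (a : S → K → ℝ) :
    ∃ α : S → I → ℝ, IsMixed α ∧ ∀ j, G.Phi u S a ≤ G.psi u α j a := by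
  have hco : ∀ s i, Continuous fun α : S → stdSimplex ℝ I => (α s).1 i := fun s i =>
    (continuous_apply i).comp (continuous_subtype_val.comp (continuous_apply s))
  have hcont : ∀ j : J, Continuous fun α : S → stdSimplex ℝ I =>
      G.psi u (fun s i => (α s).1 i) j a := by
    intro j
    unfold psi
    refine Continuous.add ?_ (continuous_finsetSum _ fun d _ => hu.continuous.comp ?_)
    · exact continuous_finsetSum _ fun s _ => continuous_finsetSum _ fun i _ =>
        continuous_finsetSum _ fun k _ => (hco s i).mul_const _
    · exact continuous_pi fun x => continuous_pi fun k' => (hco x.1 x.2.1).mul_const _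
  have hc : Continuous fun α : S → stdSimplex ℝ I =>
      Finset.univ.inf' Finset.univ_nonempty (fun j => G.psi u (fun s i => (α s).1 i) j a) :=
    Continuous.finset_inf'_apply _ fun j _ => hcont j
  obtain ⟨α, -, hα⟩ := isCompact_univ.exists_isMaxOn Set.univ_nonempty hc.continuousOn
  refine ⟨fun s i => (α s).1 i, isMixed_coe α, fun j => ?_⟩
  refine ciSup_le fun β => ?_
  have h := hα (Set.mem_univ β)
  simp only [Set.mem_ofPred_eq] at h
  calc ⨅ j : J, G.psi u (fun s i => (β s).1 i) j a
      ≤ Finset.univ.inf' Finset.univ_nonempty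
          (fun j => G.psi u (fun s i => (β s).1 i) j a) :=
        Finset.le_inf' _ _ fun j _ => ciInf_le (Set.finite_range _).bddBelow j
    _ ≤ _ := h
    _ ≤ _ := Finset.inf'_le _ (Finset.mem_univ j)

/-- Comparison principle for one-step values. -/
lemma Phi_le_Phi_add {T : Type} [Fintype T] {u v : FamFun K} (hu : Nice u) (hv : Nice v)
    (a : S → K → ℝ) (b : T → K → ℝ) (ε : ℝ)
    (h : ∀ α : S → I → ℝ, IsMixed α → ∃ β : T → I → ℝ, IsMixed β ∧
      ∀ j, G.psi u α j a ≤ G.psi v β j b + ε) : G.Phi u S a ≤ G.Phi v T b + ε := by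
  obtain ⟨α, hα, h1⟩ := G.exists_Phi_le_psi hu a
  obtain ⟨β, hβ, h2⟩ := h α hα
  obtain ⟨j, hj⟩ := G.exists_psi_le_Phi hv hβ b
  linarith [h1 j, h2 j]

lemma abs_Phi_sub_Phi_le {u v : FamFun K} (hu : Nice u) (hv : Nice v) {ε : ℝ} (hε : 0 ≤ ε)
    (a : S → K → ℝ)
    (h : ∀ α : S → I → ℝ, IsMixed α → ∀ j d,
      |u (S × I × C) (G.step α j d a) - v (S × I × C) (G.step α j d a)| ≤
        ε * fnorm (G.step α j d a)) :
    |G.Phi u S a - G.Phi v S a| ≤ ε * fnorm a := by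
  rw [abs_sub_le_iff]
  constructor
  · have := G.Phi_le_Phi_add hu hv a a (ε * fnorm a) fun α hα => ⟨α, hα, fun j => by
      linarith [le_of_abs_le (G.abs_psi_sub_psi_le hα hε j a (h α hα j))]⟩
    linarith
  · have := G.Phi_le_Phi_add hv hu a a (ε * fnorm a) fun α hα => ⟨α, hα, fun j => by
      linarith [neg_le_of_abs_le (G.abs_psi_sub_psi_le hα hε j a (h α hα j))]⟩
    linarith

lemma abs_Phi_le {u : FamFun K} (hu : Nice u) (a : S → K → ℝ) : |G.Phi u S a| ≤ fnorm a := by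
  obtain ⟨α, hα, h1⟩ := G.exists_Phi_le_psi hu a
  obtain ⟨j, hj⟩ := G.exists_psi_le_Phi hu hα a
  have h := G.abs_psi_le hu hα j a
  rwa [le_antisymm (h1 j) hj]

lemma psi_merge {T : Type} [Fintype T] {u : FamFun K} (hu : Nice u) (φ : S → T) (m : S → ℝ)
    (b : T → K → ℝ) (hm : ∀ s, 0 ≤ m s) {α : S → I → ℝ} {β : T → I → ℝ} (hα : IsMixed α)
    (h : ∀ t i, (∑ s, if φ s = t then m s else 0) * β t i =
      ∑ s, if φ s = t then m s * α s i else 0) (j : J) :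
    G.psi u α j (fun s => m s • b (φ s)) =
      G.psi u β j (fun t => (∑ s, if φ s = t then m s else 0) • b t) := by
  unfold psi
  congr 1
  · calc G.rew α j (fun s => m s • b (φ s))
        = ∑ s, ∑ t, if φ s = t then ∑ i, (m s * α s i) * ∑ k, b t k * G.r k i j else 0 := by
          unfold rew
          refine Finset.sum_congr rfl fun s _ => ?_
          rw [Finset.sum_ite_eq]
          simp only [Finset.mem_univ, if_true]
          refine Finset.sum_congr rfl fun i _ => ?_
          rw [Finset.mul_sum]
          refine Finset.sum_congr rfl fun k _ => ?_
          simp only [Pi.smul_apply, smul_eq_mul]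
          ring
      _ = ∑ t, ∑ i, (∑ s, if φ s = t then m s * α s i else 0) * ∑ k, b t k * G.r k i j := by
          rw [Finset.sum_comm]
          refine Finset.sum_congr rfl fun t _ => ?_
          simp only [Finset.sum_mul]
          rw [Finset.sum_comm]
          refine Finset.sum_congr rfl fun s _ => ?_
          by_cases hs : φ s = t <;> simp [hs]
      _ = _ := by
          unfold rew
          refine Finset.sum_congr rfl fun t _ => Finset.sum_congr rfl fun i _ => ?_
          rw [← h, Finset.mul_sum]
          refine Finset.sum_congr rfl fun k _ => ?_
          simp only [Pi.smul_apply, smul_eq_mul]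
          ring
  · refine Finset.sum_congr rfl fun d _ => ?_
    have key := hu.merge (S × I × C) (T × I × C) (fun x => (φ x.1, x.2))
      (fun x => m x.1 * α x.1 x.2.1)
      (fun y k' => ∑ k, b y.1 k * G.p k y.2.1 j k' y.2.2 d)
      (fun x => mul_nonneg (hm _) (hα.1 _ _))
    convert key using 2
    · funext x k'
      simp only [step, Pi.smul_apply, smul_eq_mul, Finset.mul_sum]
      exact Finset.sum_congr rfl fun k _ => by ring
    · funext y k'
      obtain ⟨t, i, c⟩ := y
      have e : (∑ x : S × I × C, @ite ℝ ((φ x.1, x.2) = (t, i, c)) (Classical.propDecidable _)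
          (m x.1 * α x.1 x.2.1) 0) =
          (∑ s, if φ s = t then m s else 0) * β t i := by
        rw [h, Fintype.sum_prod_type]
        refine Finset.sum_congr rfl fun s _ => ?_
        by_cases hs : φ s = t
        · simp [hs]
        · simp [hs]
      simp only [step, Pi.smul_apply, smul_eq_mul]
      rw [e, mul_comm _ (β t i), mul_assoc]
      congr 1
      rw [Finset.mul_sum]
      exact Finset.sum_congr rfl fun k _ => by ring

lemma nice_Phi {u : FamFun K} (hu : Nice u) : Nice (G.Phi u) where
  lip S _ a b := by
    rw [abs_sub_le_iff]
    constructor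
    · have := G.Phi_le_Phi_add hu hu a b (fnorm (a - b)) fun α hα => ⟨α, hα, fun j => by
        linarith [le_of_abs_le (G.abs_psi_sub_le hu hα j a b)]⟩
      linarith
    · have := G.Phi_le_Phi_add hu hu b a (fnorm (a - b)) fun α hα => ⟨α, hα, fun j => by
        linarith [neg_le_of_abs_le (G.abs_psi_sub_le hu hα j a b)]⟩
      linarith
  homog S _ c a hc := by
    unfold Phi
    rw [Real.mul_iSup_of_nonneg hc]
    refine iSup_congr fun α => ?_
    rw [Real.mul_iInf_of_nonneg hc]
    refine iInf_congr fun j => ?_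
    unfold psi
    rw [rew_smul, mul_add, Finset.mul_sum]
    congr 1
    refine Finset.sum_congr rfl fun d _ => ?_
    rw [step_smul, hu.homog _ _ _ hc]
  merge S T _ _ φ m b hm := by
    apply le_antisymm
    · have key := G.Phi_le_Phi_add hu hu (fun s => m s • b (φ s))
        (fun t => (∑ s, if φ s = t then m s else 0) • b t) 0 ?_
      · simpa using key
      intro α hα
      let M : T → ℝ := fun t => ∑ s, if φ s = t then m s else 0
      have hM : ∀ t, 0 ≤ M t := fun t =>
        Finset.sum_nonneg fun s _ => by split_ifs <;> simp [hm]
      let γ : stdSimplex ℝ I := Classical.arbitrary _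
      let β : T → I → ℝ := fun t i =>
        if M t = 0 then γ.1 i else (∑ s, if φ s = t then m s * α s i else 0) / M t
      have hβ : IsMixed β := by
        constructor
        · intro t i
          simp only [β]
          split_ifs
          · exact γ.2.1 i
          · exact div_nonneg (Finset.sum_nonneg fun s _ => by
              split_ifs
              · exact mul_nonneg (hm s) (hα.1 s i)
              · exact le_rfl) (hM t)
        · intro t
          simp only [β]
          split_ifs with h0
          · exact γ.2.2
          · rw [← Finset.sum_div, Finset.sum_comm, div_eq_one_iff_eq h0]
            refine Finset.sum_congr rfl fun s _ => ?_
            by_cases hs : φ s = t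
            · simp [hs, ← Finset.mul_sum, hα.2 s]
            · simp [hs]
      refine ⟨β, hβ, fun j => ?_⟩
      rw [add_zero]
      refine (G.psi_merge hu φ m b hm hα (fun t i => ?_) j).le
      change M t * β t i = _
      by_cases h0 : M t = 0
      · rw [h0, zero_mul]
        symm
        have hz := (Finset.sum_eq_zero_iff_of_nonneg (fun s _ => by
          split_ifs <;> simp [hm])).1 h0
        refine Finset.sum_eq_zero fun s hs => ?_
        have := hz s hs
        split_ifs at this ⊢ <;> simp [*]
      · simp only [β, if_neg h0]
        field_simp
    · have key := G.Phi_le_Phi_add hu hu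
        (fun t => (∑ s, if φ s = t then m s else 0) • b t) (fun s => m s • b (φ s)) 0 ?_
      · simpa using key
      intro β hβ
      have hα : IsMixed (fun s => β (φ s)) := ⟨fun s i => hβ.1 _ i, fun s => hβ.2 _⟩
      refine ⟨fun s => β (φ s), hα, fun j => ?_⟩
      rw [add_zero]
      refine (G.psi_merge hu φ m b hm hα (fun t i => ?_) j).ge
      rw [Finset.sum_mul]
      refine Finset.sum_congr rfl fun s _ => ?_
      by_cases hs : φ s = t <;> simp [hs]

end StepData

end SigGame

namespace SigGame

/-! ### Compactness of the set of nice functionals and the limit value -/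

lemma exists_finite_l1_net (ι : Type) [Fintype ι] {η : ℝ} (hη : 0 < η) :
    ∃ t : Set (ι → ℝ), t ⊆ stdSimplex ℝ ι ∧ t.Finite ∧
      ∀ x ∈ stdSimplex ℝ ι, ∃ y ∈ t, ∑ i, |x i - y i| ≤ η := by
  have hpos : (0 : ℝ) < (Fintype.card ι : ℝ) + 1 := by positivity
  obtain ⟨t, ht, hfin, hcov⟩ := (isCompact_stdSimplex ℝ ι).finite_cover_balls
    (div_pos hη hpos)
  refine ⟨t, ht, hfin, fun x hx => ?_⟩
  obtain ⟨y, hy, hxy⟩ := Set.mem_iUnion₂.1 (hcov hx)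
  refine ⟨y, hy, ?_⟩
  calc ∑ i, |x i - y i| ≤ ∑ _i : ι, η / ((Fintype.card ι : ℝ) + 1) :=
        Finset.sum_le_sum fun i _ => by
          rw [← Real.dist_eq]
          exact (dist_le_pi_dist x y i).trans (Metric.mem_ball.1 hxy).le
    _ = Fintype.card ι * (η / ((Fintype.card ι : ℝ) + 1)) := by simp
    _ ≤ η := by
        rw [mul_div_assoc', div_le_iff₀ hpos]
        nlinarith

/-- Nice functionals are determined, up to `η`, by their values at finitely many families. -/
lemma exists_finite_test (K : Type) [Fintype K] [Nonempty K] {η : ℝ} (hη : 0 < η) :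
    ∃ (T : Type) (_ : Fintype T) (X : Set (T → K → ℝ)), X.Finite ∧
      ∀ (S : Type) [Fintype S] (a : S → K → ℝ), (∀ s k, 0 ≤ a s k) → fnorm a = 1 →
        ∃ x ∈ X, ∀ u : FamFun K, Nice u → |u S a - u T x| ≤ η := by
  obtain ⟨t, ht, htf, hnet⟩ := exists_finite_l1_net K (half_pos hη)
  have : Fintype t := htf.fintype
  obtain ⟨Y, hY, hYf, hYnet⟩ := exists_finite_l1_net t (half_pos hη)
  refine ⟨t, inferInstance, (fun y => fun p : t => y p • p.1) '' Y, hYf.image _, ?_⟩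
  intro S _ a ha ha1
  have hne : Nonempty t := by
    obtain ⟨y, hy, -⟩ := hnet _ (Classical.arbitrary (stdSimplex ℝ K)).2
    exact ⟨⟨y, hy⟩⟩
  let m : S → ℝ := fun s => ∑ k, a s k
  have hm : ∀ s, 0 ≤ m s := fun s => Finset.sum_nonneg fun k _ => ha s k
  have hm1 : ∑ s, m s = 1 := by rw [← ha1, fnorm_of_nonneg ha]
  have hφ : ∀ s, ∃ p : t, ∑ k, |a s k - m s * p.1 k| ≤ η / 2 * m s := by
    intro s
    by_cases h0 : m s = 0
    · have hz := (Finset.sum_eq_zero_iff_of_nonneg (fun k _ => ha s k)).1 h0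
      refine ⟨hne.some, le_of_eq ?_⟩
      rw [h0, mul_zero]
      exact Finset.sum_eq_zero fun k hk => by simp [hz k hk]
    · have hpos : 0 < m s := lt_of_le_of_ne (hm s) (Ne.symm h0)
      obtain ⟨y, hy, hle⟩ := hnet (fun k => a s k / m s)
        ⟨fun k => div_nonneg (ha s k) (hm s), by
          change ∑ k, a s k / m s = 1
          rw [← Finset.sum_div]; exact div_self h0⟩
      refine ⟨⟨y, hy⟩, ?_⟩
      calc ∑ k, |a s k - m s * y k| = m s * ∑ k, |a s k / m s - y k| := by
            rw [Finset.mul_sum]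
            refine Finset.sum_congr rfl fun k _ => ?_
            rw [← abs_of_pos hpos, ← abs_mul, abs_of_pos hpos]
            congr 1
            field_simp
        _ ≤ _ := by nlinarith
  choose φ hφ using hφ
  let z : t → ℝ := fun p => ∑ s, if φ s = p then m s else 0
  have hz : z ∈ stdSimplex ℝ t := by
    refine ⟨fun p => Finset.sum_nonneg fun s _ => by split_ifs <;> simp [hm], ?_⟩
    simp only [z]
    rw [Finset.sum_comm]
    simpa using hm1
  obtain ⟨y, hy, hle⟩ := hYnet z hz
  refine ⟨_, ⟨y, hy, rfl⟩, fun u hu => ?_⟩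
  have h1 : |u S a - u S (fun s => m s • (φ s).1)| ≤ η / 2 := by
    refine (hu.lip S _ _).trans ?_
    calc _ ≤ ∑ s, η / 2 * m s := Finset.sum_le_sum fun s _ => hφ s
      _ = η / 2 := by rw [← Finset.mul_sum, hm1, mul_one]
  have h2 : u S (fun s => m s • (φ s).1) = u t (fun p => z p • p.1) := by
    convert hu.merge S t φ m (fun p => p.1) hm
  have h3 : |u t (fun p => z p • p.1) - u t (fun p => y p • p.1)| ≤ η / 2 := by
    refine (hu.lip t _ _).trans (le_trans (le_of_eq ?_) hle)
    refine Finset.sum_congr rfl fun p _ => ?_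
    have hp := ht p.2
    calc ∑ k, |z p * p.1 k - y p * p.1 k| = ∑ k, |z p - y p| * p.1 k :=
          Finset.sum_congr rfl fun k _ => by
            rw [← sub_mul, abs_mul, abs_of_nonneg (hp.1 k)]
      _ = |z p - y p| := by rw [← Finset.mul_sum, hp.2, mul_one]
  calc |u S a - u t (fun p => y p • p.1)|
      = |(u S a - u S (fun s => m s • (φ s).1)) +
          (u t (fun p => z p • p.1) - u t (fun p => y p • p.1))| := by rw [h2]; congr 1; ring
    _ ≤ η / 2 + η / 2 := (abs_add_le _ _).trans (add_le_add h1 h3)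
    _ = η := by ring

namespace StepData

variable {K I J C D : Type} [Fintype K] [Fintype I] [Fintype J] [Fintype C]
  [Fintype D] (G : StepData K I J C D) [Nonempty I] [Nonempty J]

/-- Iterates of the discounted one-step operator. -/
def discIter (lam : ℝ) : ℕ → FamFun K
  | 0 => fun _ _ _ => 0
  | n + 1 => fun S _ a => (1 - lam) * G.Phi (discIter lam n) S a

lemma nice_discIter {lam : ℝ} (h0 : 0 < lam) (h1 : lam < 1) (n : ℕ) :
    Nice (G.discIter lam n) := by
  induction n with
  | zero => exact Nice.zero
  | succ n ih => exact (G.nice_Phi ih).const_mul (by linarith) (by linarith)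

lemma abs_discIter_succ_sub_le {lam : ℝ} (h0 : 0 < lam) (h1 : lam < 1) (n : ℕ) :
    ∀ (S : Type) [Fintype S] (a : S → K → ℝ),
      |G.discIter lam (n + 1) S a - G.discIter lam n S a| ≤ (1 - lam) ^ n * fnorm a := by
  induction n with
  | zero =>
    intro S _ a
    have h := (G.nice_discIter h0 h1 1).abs_le a
    simpa [discIter] using h
  | succ n ih =>
    intro S _ a
    change |(1 - lam) * G.Phi (G.discIter lam (n + 1)) S a -
      (1 - lam) * G.Phi (G.discIter lam n) S a| ≤ _
    rw [← mul_sub, abs_mul, abs_of_pos (by linarith : 0 < 1 - lam), pow_succ', mul_assoc]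
    refine mul_le_mul_of_nonneg_left ?_ (by linarith)
    exact G.abs_Phi_sub_Phi_le (G.nice_discIter h0 h1 _) (G.nice_discIter h0 h1 _)
      (pow_nonneg (by linarith) n) a fun α _ j d => ih _ _

lemma exists_approx_fixed {lam : ℝ} (h0 : 0 < lam) (h1 : lam < 1) :
    ∃ v : FamFun K, Nice v ∧ ∀ (S : Type) [Fintype S] (a : S → K → ℝ),
      |v S a - (1 - lam) * G.Phi v S a| ≤ lam ^ 2 * fnorm a := by
  obtain ⟨n, hn⟩ := exists_pow_lt_of_lt_one (pow_pos h0 2) (by linarith : 1 - lam < 1)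
  refine ⟨G.discIter lam n, G.nice_discIter h0 h1 n, fun S _ a => ?_⟩
  rw [abs_sub_comm]
  exact (G.abs_discIter_succ_sub_le h0 h1 n S a).trans
    (mul_le_mul_of_nonneg_right hn.le (fnorm_nonneg a))

/-- Existence of a uniform limit point of the discounted values, which is a fixed point of the
undiscounted operator. -/
lemma exists_limit_value [Nonempty K] :
    ∃ f : FamFun K, Nice f ∧
      (∀ (S : Type) [Fintype S] (a : S → K → ℝ), (∀ s k, 0 ≤ a s k) → G.Phi f S a = f S a) ∧
      ∀ η > (0 : ℝ), ∃ lam : ℝ, 0 < lam ∧ lam < 1 ∧ lam ≤ η ∧ ∃ v : FamFun K, Nice v ∧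
        (∀ (S : Type) [Fintype S] (a : S → K → ℝ),
          |v S a - (1 - lam) * G.Phi v S a| ≤ lam ^ 2 * fnorm a) ∧
        ∀ (S : Type) [Fintype S] (a : S → K → ℝ), (∀ s k, 0 ≤ a s k) →
          |v S a - f S a| ≤ η * fnorm a := by
  let lam : ℕ → ℝ := fun n => 1 / ((n : ℝ) + 2)
  have hl0 : ∀ n, 0 < lam n := fun n => by simp only [lam]; positivity
  have hl1 : ∀ n, lam n < 1 := fun n => by
    simp only [lam]
    rw [div_lt_one (by positivity)]
    have : (0 : ℝ) ≤ n := Nat.cast_nonneg n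
    linarith
  have hlim : Tendsto lam atTop (nhds 0) := by
    have h := (tendsto_const_div_atTop_nhds_zero_nat (1 : ℝ)).comp (tendsto_add_atTop_nat 2)
    refine h.congr fun n => ?_
    simp [lam]
  choose v hv happ using fun n => G.exists_approx_fixed (hl0 n) (hl1 n)
  let 𝒰 : Ultrafilter ℕ := hyperfilter ℕ
  have h𝒰 : (𝒰 : Filter ℕ) ≤ atTop := by
    rw [← Nat.cofinite_eq_atTop]; exact hyperfilter_le_cofinite
  have hex : ∀ (S : Type) (_ : Fintype S) (a : S → K → ℝ),
      ∃ y, Tendsto (fun n => v n S a) 𝒰 (nhds y) := by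
    intro S _ a
    obtain ⟨y, -, hy⟩ := (isCompact_Icc (a := -fnorm a) (b := fnorm a)).ultrafilter_le_nhds
      (𝒰.map fun n => v n S a) (by
        rw [le_principal_iff]
        exact Filter.mem_map.2 (Filter.univ_mem' fun n => abs_le.1 ((hv n).abs_le a)))
    exact ⟨y, hy⟩
  choose f' hf' using hex
  let f : FamFun K := fun S i a => f' S i a
  have hf : ∀ (S : Type) [Fintype S] (a : S → K → ℝ),
      Tendsto (fun n => v n S a) 𝒰 (nhds (f S a)) := fun S i a => hf' S i a
  have hfn : Nice f := by
    refine ⟨?_, ?_, ?_⟩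
    · intro S _ a b
      exact le_of_tendsto ((hf S a).sub (hf S b)).abs
        (Eventually.of_forall fun n => (hv n).lip S a b)
    · intro S _ c a hc
      refine tendsto_nhds_unique (hf S (c • a)) (((hf S a).const_mul c).congr fun n => ?_)
      rw [(hv n).homog S c a hc]
    · intro S T _ _ φ m b hm
      refine tendsto_nhds_unique (hf S _) ((hf T _).congr fun n => ?_)
      rw [(hv n).merge S T φ m b hm]
  have hunif : ∀ η > (0 : ℝ), ∀ᶠ n in (𝒰 : Filter ℕ), ∀ (S : Type) [Fintype S] (a : S → K → ℝ),
      (∀ s k, 0 ≤ a s k) → |v n S a - f S a| ≤ η * fnorm a := by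
    intro η hη
    obtain ⟨T, _, X, hX, htest⟩ := exists_finite_test K (by positivity : 0 < η / 3)
    have hev : ∀ᶠ n in (𝒰 : Filter ℕ), ∀ x ∈ X, |v n T x - f T x| < η / 3 := by
      rw [eventually_all_finite hX]
      intro x _
      have := (hf T x).eventually (Metric.ball_mem_nhds _ (by positivity : 0 < η / 3))
      filter_upwards [this] with n hn
      simpa [Real.dist_eq] using hn
    filter_upwards [hev] with n hn S _ a ha
    by_cases hz : fnorm a = 0
    · have e1 := (hv n).abs_le a
      have e2 := hfn.abs_le a
      rw [hz] at e1 e2 ⊢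
      rw [abs_nonpos_iff.1 e1, abs_nonpos_iff.1 e2]
      simp
    · have hpos : 0 < fnorm a := lt_of_le_of_ne (fnorm_nonneg a) (Ne.symm hz)
      have hb : fnorm ((fnorm a)⁻¹ • a) = 1 := by
        rw [fnorm_smul (inv_nonneg.2 hpos.le), inv_mul_cancel₀ hz]
      obtain ⟨x, hx, hux⟩ := htest S ((fnorm a)⁻¹ • a)
        (fun s k => mul_nonneg (inv_nonneg.2 hpos.le) (ha s k)) hb
      have e : fnorm a • ((fnorm a)⁻¹ • a) = a := smul_inv_smul₀ hz a
      have ev := (hv n).homog S (fnorm a) ((fnorm a)⁻¹ • a) hpos.le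
      have ef := hfn.homog S (fnorm a) ((fnorm a)⁻¹ • a) hpos.le
      rw [e] at ev ef
      rw [ev, ef, ← mul_sub, abs_mul, abs_of_pos hpos, mul_comm]
      refine mul_le_mul_of_nonneg_right ?_ hpos.le
      have b1 := abs_le.1 (hux _ (hv n))
      have b2 := abs_le.1 (hux _ hfn)
      have b3 := abs_lt.1 (hn x hx)
      rw [abs_le]
      constructor <;> linarith [b1.1, b1.2, b2.1, b2.2, b3.1, b3.2]
  have hsel : ∀ η > (0 : ℝ), ∃ n, lam n ≤ η ∧ ∀ (S : Type) [Fintype S] (a : S → K → ℝ),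
      (∀ s k, 0 ≤ a s k) → |v n S a - f S a| ≤ η * fnorm a := by
    intro η hη
    have h1 : ∀ᶠ n in (𝒰 : Filter ℕ), lam n < η :=
      h𝒰 (hlim.eventually (gt_mem_nhds hη))
    obtain ⟨n, hn1, hn2⟩ := (h1.and (hunif η hη)).exists
    exact ⟨n, hn1.le, hn2⟩
  refine ⟨f, hfn, ?_, ?_⟩
  · intro S _ a ha
    have key : ∀ η > (0 : ℝ), |G.Phi f S a - f S a| ≤
        η * (4 * fnorm a) := by
      intro η hη
      obtain ⟨n, hn1, hn2⟩ := hsel η hη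
      have b1 := abs_le.1 (G.abs_Phi_sub_Phi_le (hv n) hfn hη.le a fun α hα j d =>
        hn2 _ _ (G.step_nonneg hα j d ha))
      have b2 := abs_le.1 (hn2 S a ha)
      have b3 := abs_le.1 (happ n S a)
      have b4 := abs_le.1 (G.abs_Phi_le (hv n) a)
      have hN := fnorm_nonneg a
      have c1 : lam n ^ 2 * fnorm a ≤ η * fnorm a :=
        mul_le_mul_of_nonneg_right (by nlinarith [hl0 n, hl1 n]) hN
      have c2 : lam n * G.Phi (v n) S a ≤ η * fnorm a := by
        nlinarith [hl0 n, b4.2, mul_le_mul_of_nonneg_right hn1 hN]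
      have c3 : -(η * fnorm a) ≤ lam n * G.Phi (v n) S a := by
        nlinarith [hl0 n, b4.1, mul_le_mul_of_nonneg_right hn1 hN]
      rw [abs_le]
      constructor <;> linarith [b1.1, b1.2, b2.1, b2.2, b3.1, b3.2]
    by_contra hne
    have hpos : 0 < |G.Phi f S a - f S a| :=
      abs_pos.2 (sub_ne_zero.2 hne)
    have hN : 0 ≤ 4 * fnorm a := by linarith [fnorm_nonneg a]
    have h := key (|G.Phi f S a - f S a| / (2 * (4 * fnorm a + 1)))
      (by positivity)
    rw [div_mul_eq_mul_div, le_div_iff₀ (by positivity)] at h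
    nlinarith
  · intro η hη
    obtain ⟨n, hn1, hn2⟩ := hsel η hη
    exact ⟨lam n, hl0 n, hl1 n, hn1, v n, hv n, fun S _ a => happ n S a, hn2⟩

end StepData

end SigGame

namespace SigGame

/-! ### Potentials with a positive drift -/

lemma potential_drift {η lam f v N R M Sf Sv SW SN : ℝ} (hη0 : 0 < η) (hη1 : η ≤ 1)
    (hl0 : 0 < lam) (hl : 6 * lam ≤ η ^ 2) (hN : 0 ≤ N) (hvN : v ≤ N)
    (hvf : |v - f| ≤ η ^ 2 / 2 * N) (hR : |R| ≤ M) (hmass : M + SN ≤ N) (hSf : Sf ≤ SW)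
    (hSv : (1 + η) * Sv - η ^ 2 * SN ≤ SW)
    (hA : (1 + η) * v - η ^ 2 * N ≤ f → f ≤ R + Sf)
    (hB : f < (1 + η) * v - η ^ 2 * N → v + lam * (v - 3 * lam * N) ≤ R + Sv) :
    max f ((1 + η) * v - η ^ 2 * N) ≤ R + η * M + SW ∧
    max f ((1 + η) * v - η ^ 2 * N) + lam * (max f ((1 + η) * v - η ^ 2 * N) - 6 * η * N) ≤
      R + η * M + SW := by
  obtain ⟨h1, h2⟩ := abs_le.1 hvf
  obtain ⟨h3, h4⟩ := abs_le.1 hR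
  have hM : 0 ≤ M := (abs_nonneg R).trans hR
  have hηM : 0 ≤ η * M := mul_nonneg hη0.le hM
  have hsq : η ^ 2 ≤ η := by nlinarith
  have hsqN : η ^ 2 * N ≤ η * N := mul_le_mul_of_nonneg_right hsq hN
  have hηN : 0 ≤ η * N := mul_nonneg hη0.le hN
  rcases le_or_gt ((1 + η) * v - η ^ 2 * N) f with h | h
  · rw [max_eq_left h]
    have hf := hA h
    have hv : η * v ≤ η * (2 * η * N) := by nlinarith
    have hv' : v ≤ 2 * η * N := le_of_mul_le_mul_left hv hη0
    have : lam * (f - 6 * η * N) ≤ 0 :=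
      mul_nonpos_of_nonneg_of_nonpos hl0.le (by linarith)
    constructor <;> linarith
  · rw [max_eq_right h.le]
    have hv := hB h
    have hv1 : η * (η / 2 * N) ≤ η * v := by nlinarith
    have hv2 : η / 2 * N ≤ v := le_of_mul_le_mul_left hv1 hη0
    have hlN : 3 * lam * N ≤ η ^ 2 / 2 * N :=
      mul_le_mul_of_nonneg_right (by linarith) hN
    have hd : 0 ≤ lam * (v - 3 * lam * N) := mul_nonneg hl0.le (by linarith)
    have hηd : 0 ≤ η * (lam * (v - 3 * lam * N)) := mul_nonneg hη0.le hd
    have hηR : η * R ≤ η * M := mul_le_mul_of_nonneg_left h4 hη0.le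
    have hmul : (1 + η) * (v + lam * (v - 3 * lam * N)) ≤ (1 + η) * (R + Sv) :=
      mul_le_mul_of_nonneg_left hv (by linarith)
    have hmass2 : η ^ 2 * (M + SN) ≤ η ^ 2 * N := mul_le_mul_of_nonneg_left hmass (sq_nonneg η)
    have hM2 : 0 ≤ η ^ 2 * M := mul_nonneg (sq_nonneg η) hM
    have hvN' : η * v ≤ η * N := mul_le_mul_of_nonneg_left hvN hη0.le
    have hW : lam * ((1 + η) * v - η ^ 2 * N - 6 * η * N) ≤ lam * (v - 3 * lam * N) :=
      mul_le_mul_of_nonneg_left (by nlinarith) hl0.le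
    constructor <;> nlinarith

/-- Backward induction step for the potential. -/
lemma potential_induction_step {η lam W N R M SW SN n : ℝ} (hη0 : 0 < η) (hη1 : η ≤ 1)
    (hl0 : 0 < lam) (hn : 0 ≤ n) (hR : |R| ≤ M) (hmass : M + SN ≤ N)
    (h1 : W ≤ R + η * M + SW) (h2 : W + lam * (W - 6 * η * N) ≤ R + η * M + SW) :
    (n + 1 + 1 / lam) * W - (3 / lam + 6 * η * (n + 1)) * N ≤
      n * R + ((n + 1 / lam) * SW - (3 / lam + 6 * η * n) * SN) := by
  obtain ⟨h3, h4⟩ := abs_le.1 hR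
  have hM : 0 ≤ M := (abs_nonneg R).trans hR
  have e : 3 / lam = 3 * (1 / lam) := by ring
  have hL : 0 < 1 / lam := by positivity
  have hLl : 1 / lam * lam = 1 := by field_simp
  rw [e]
  set L := 1 / lam
  have k1 := mul_le_mul_of_nonneg_left h1 hn
  have k2 := mul_le_mul_of_nonneg_left h2 hL.le
  have k2' : L * (W + lam * (W - 6 * η * N)) = L * W + (W - 6 * η * N) := by
    rw [mul_add, ← mul_assoc, hLl, one_mul]
  have k3 := mul_le_mul_of_nonneg_left hmass (by positivity : 0 ≤ 3 * L + 6 * η * n)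
  have k4 := mul_le_mul_of_nonneg_left h4 hL.le
  have k5 : 0 ≤ n * (η * M) := by positivity
  have k6 : L * (η * M) ≤ L * M :=
    mul_le_mul_of_nonneg_left (mul_le_of_le_one_left hM hη1) hL.le
  have k7 : 0 ≤ L * M := by positivity
  nlinarith

namespace StepData

variable {S K I J C D : Type} [Fintype S] [Fintype K] [Fintype I] [Fintype J] [Fintype C]
  [Fintype D] (G : StepData K I J C D)

lemma psi_bounds_of_approx [Nonempty I] [Nonempty J] {lam : ℝ} (hl0 : 0 < lam) (hl1 : lam < 1)
    {v : FamFun K} (hv : Nice v) {a : S → K → ℝ}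
    (happ : |v S a - (1 - lam) * G.Phi v S a| ≤ lam ^ 2 * fnorm a) :
    v S a + lam * (v S a - 3 * lam * fnorm a) ≤ G.Phi v S a ∧
      G.Phi v S a ≤ v S a + lam * (v S a + 3 * lam * fnorm a) := by
  obtain ⟨h1, h2⟩ := abs_le.1 happ
  obtain ⟨h3, h4⟩ := abs_le.1 (G.abs_Phi_le hv a)
  have hN := fnorm_nonneg a
  set P := G.Phi v S a
  set N := fnorm a
  have k1 := mul_le_mul_of_nonneg_left h1 hl0.le
  have k2 := mul_le_mul_of_nonneg_left h2 hl0.le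
  have k3 := mul_le_mul_of_nonneg_left h3 (sq_nonneg lam)
  have k4 := mul_le_mul_of_nonneg_left h4 (sq_nonneg lam)
  have k5 : lam ^ 3 * N ≤ lam ^ 2 * N :=
    mul_le_mul_of_nonneg_right (by nlinarith [sq_nonneg lam]) hN
  constructor <;> nlinarith

lemma exists_potentials [Nonempty I] [Nonempty J] {f : FamFun K} (hf : Nice f)
    (hfix : ∀ (S : Type) [Fintype S] (a : S → K → ℝ), (∀ s k, 0 ≤ a s k) → G.Phi f S a = f S a)
    (happ : ∀ η > (0 : ℝ), ∃ lam : ℝ, 0 < lam ∧ lam < 1 ∧ lam ≤ η ∧ ∃ v : FamFun K, Nice v ∧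
      (∀ (S : Type) [Fintype S] (a : S → K → ℝ),
        |v S a - (1 - lam) * G.Phi v S a| ≤ lam ^ 2 * fnorm a) ∧
      ∀ (S : Type) [Fintype S] (a : S → K → ℝ), (∀ s k, 0 ≤ a s k) →
        |v S a - f S a| ≤ η * fnorm a)
    {η : ℝ} (hη0 : 0 < η) (hη1 : η ≤ 1) :
    ∃ lam : ℝ, 0 < lam ∧ ∃ W W' : FamFun K,
      (∀ (S : Type) [Fintype S] (a : S → K → ℝ), f S a ≤ W S a ∧ W S a ≤ 3 * fnorm a ∧
        W' S a ≤ f S a ∧ -(3 * fnorm a) ≤ W' S a) ∧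
      (∀ (S : Type) [Fintype S] (a : S → K → ℝ), (∀ s k, 0 ≤ a s k) →
        ∃ α : S → I → ℝ, IsMixed α ∧ ∀ j, ∀ n : ℕ,
          ((n : ℝ) + 1 + 1 / lam) * W S a - (3 / lam + 6 * η * (n + 1)) * fnorm a ≤
            n * G.rew α j a + ∑ d, ((n + 1 / lam) * W (S × I × C) (G.step α j d a) -
              (3 / lam + 6 * η * n) * fnorm (G.step α j d a))) ∧
      (∀ (S : Type) [Fintype S] (a : S → K → ℝ), (∀ s k, 0 ≤ a s k) →
        ∀ α : S → I → ℝ, IsMixed α → ∃ j, ∀ n : ℕ,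
          n * G.rew α j a + ∑ d, ((n + 1 / lam) * W' (S × I × C) (G.step α j d a) +
              (3 / lam + 6 * η * n) * fnorm (G.step α j d a)) ≤
          ((n : ℝ) + 1 + 1 / lam) * W' S a + (3 / lam + 6 * η * (n + 1)) * fnorm a) := by
  obtain ⟨lam, hl0, hl1, hle, v, hv, hvapp, hvf⟩ := happ (η ^ 2 / 6) (by positivity)
  have hl : 6 * lam ≤ η ^ 2 := by linarith
  have hvf' : ∀ (S : Type) [Fintype S] (a : S → K → ℝ), (∀ s k, 0 ≤ a s k) →
      |v S a - f S a| ≤ η ^ 2 / 2 * fnorm a := fun S _ a ha =>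
    (hvf S a ha).trans (mul_le_mul_of_nonneg_right (by nlinarith [sq_nonneg η]) (fnorm_nonneg a))
  refine ⟨lam, hl0, fun S _ a => max (f S a) ((1 + η) * v S a - η ^ 2 * fnorm a),
    fun S _ a => -max (-f S a) ((1 + η) * (-v S a) - η ^ 2 * fnorm a), ?_, ?_, ?_⟩
  · intro S _ a
    have b1 := abs_le.1 (hf.abs_le a)
    have b2 := abs_le.1 (hv.abs_le a)
    have hN := fnorm_nonneg a
    have hsqN : 0 ≤ η ^ 2 * fnorm a := by positivity
    have hvN : η * v S a ≤ fnorm a := by nlinarith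
    have hvN' : η * (-v S a) ≤ fnorm a := by nlinarith
    refine ⟨le_max_left _ _, max_le (by linarith) (by linarith), ?_, ?_⟩
    · linarith [le_max_left (-f S a) ((1 + η) * (-v S a) - η ^ 2 * fnorm a)]
    · rw [neg_le_neg_iff]
      exact max_le (by linarith) (by linarith)
  · intro S _ a ha
    have hα : ∃ α : S → I → ℝ, IsMixed α ∧ ∀ j,
        ((1 + η) * v S a - η ^ 2 * fnorm a ≤ f S a → f S a ≤ G.psi f α j a) ∧
        (f S a < (1 + η) * v S a - η ^ 2 * fnorm a →
          v S a + lam * (v S a - 3 * lam * fnorm a) ≤ G.psi v α j a) := by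
      rcases le_or_gt ((1 + η) * v S a - η ^ 2 * fnorm a) (f S a) with h | h
      · obtain ⟨α, hα, h1⟩ := G.exists_Phi_le_psi hf a
        refine ⟨α, hα, fun j => ⟨fun _ => ?_, fun h' => absurd h' (not_lt.2 h)⟩⟩
        exact (hfix S a ha).ge.trans (h1 j)
      · obtain ⟨α, hα, h1⟩ := G.exists_Phi_le_psi hv a
        refine ⟨α, hα, fun j => ⟨fun h' => absurd h (not_lt.2 h'), fun _ => ?_⟩⟩
        exact (G.psi_bounds_of_approx hl0 hl1 hv (hvapp S a)).1.trans (h1 j)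
    obtain ⟨α, hα, hj⟩ := hα
    refine ⟨α, hα, fun j n => ?_⟩
    obtain ⟨hA, hB⟩ := hj j
    have hmass := G.abm_add_sum_fnorm_le hα j a
    have hd := potential_drift (SW := ∑ d, max (f _ (G.step α j d a))
        ((1 + η) * v _ (G.step α j d a) - η ^ 2 * fnorm (G.step α j d a)))
      hη0 hη1 hl0 hl (fnorm_nonneg a) (le_of_abs_le (hv.abs_le a)) (hvf' S a ha)
      (G.abs_rew_le hα j a) hmass (Finset.sum_le_sum fun d _ => le_max_left _ _)
      (by
        rw [Finset.mul_sum, Finset.mul_sum, ← Finset.sum_sub_distrib]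
        exact Finset.sum_le_sum fun d _ => le_max_right _ _) hA hB
    have := potential_induction_step hη0 hη1 hl0 (Nat.cast_nonneg n) (G.abs_rew_le hα j a) hmass
      hd.1 hd.2
    rwa [Finset.sum_sub_distrib, ← Finset.mul_sum, ← Finset.mul_sum]
  · intro S _ a ha α hα
    have hj : ∃ j,
        ((1 + η) * (-v S a) - η ^ 2 * fnorm a ≤ -f S a → G.psi f α j a ≤ f S a) ∧
        (-f S a < (1 + η) * (-v S a) - η ^ 2 * fnorm a →
          G.psi v α j a ≤ v S a + lam * (v S a + 3 * lam * fnorm a)) := by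
      rcases le_or_gt ((1 + η) * (-v S a) - η ^ 2 * fnorm a) (-f S a) with h | h
      · obtain ⟨j, h1⟩ := G.exists_psi_le_Phi hf hα a
        refine ⟨j, fun _ => ?_, fun h' => absurd h' (not_lt.2 h)⟩
        exact h1.trans (hfix S a ha).le
      · obtain ⟨j, h1⟩ := G.exists_psi_le_Phi hv hα a
        refine ⟨j, fun h' => absurd h (not_lt.2 h'), fun _ => ?_⟩
        exact h1.trans (G.psi_bounds_of_approx hl0 hl1 hv (hvapp S a)).2
    obtain ⟨j, hA, hB⟩ := hj
    refine ⟨j, fun n => ?_⟩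
    have hmass := G.abm_add_sum_fnorm_le hα j a
    have hR : |-G.rew α j a| ≤ G.abm α j a := by rw [abs_neg]; exact G.abs_rew_le hα j a
    have hd := potential_drift (R := -G.rew α j a) (Sf := -∑ d, f _ (G.step α j d a))
      (Sv := -∑ d, v _ (G.step α j d a)) (SW := ∑ d, max (-f _ (G.step α j d a))
        ((1 + η) * (-v _ (G.step α j d a)) - η ^ 2 * fnorm (G.step α j d a)))
      (f := -f S a) (v := -v S a)
      hη0 hη1 hl0 hl (fnorm_nonneg a) (by linarith [neg_le_of_abs_le (hv.abs_le a)])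
      (by
        have := hvf' S a ha
        rwa [← abs_neg, show -(-v S a - -f S a) = v S a - f S a by ring])
      hR hmass
      (by rw [← Finset.sum_neg_distrib]; exact Finset.sum_le_sum fun d _ => le_max_left _ _)
      (by
        rw [← Finset.sum_neg_distrib, Finset.mul_sum, Finset.mul_sum, ← Finset.sum_sub_distrib]
        exact Finset.sum_le_sum fun d _ => le_max_right _ _)
      (fun h => by have := hA h; unfold psi at this; linarith)
      (fun h => by have := hB h; unfold psi at this; linarith)
    have := potential_induction_step hη0 hη1 hl0 (Nat.cast_nonneg n) hR hmass hd.1 hd.2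
    rw [Finset.sum_add_distrib, ← Finset.mul_sum, ← Finset.mul_sum, Finset.sum_neg_distrib]
    linarith

end StepData

end SigGame

namespace SigGame

/-! ### Stage payoffs by backward recursion -/

/-- The continuation strategy of player 1 after a first stage. -/
def Strat1.shift {C I : Type} [Fintype I] (σ : Strat1 C I) (z : C × I) : Strat1 C I where
  play h c i := σ.play (z :: h) c i
  nonneg _ c i := σ.nonneg _ c i
  sum_one _ c := σ.sum_one _ c

/-- The continuation strategy of player 2 after a first stage. -/
def Strat2.shift {D J : Type} [Fintype J] (τ : Strat2 D J) (z : D × J) : Strat2 D J where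
  play h d j := τ.play (z :: h) d j
  nonneg _ d j := τ.nonneg _ d j
  sum_one _ d := τ.sum_one _ d

/-- The lists of a given length, as a finset. -/
def listsOf (Z : Type) [Fintype Z] : ℕ → Finset (List Z)
  | 0 => {[]}
  | t + 1 => (Finset.univ ×ˢ listsOf Z t).image fun x => x.1 :: x.2

lemma mem_listsOf {Z : Type} [Fintype Z] {t : ℕ} {l : List Z} :
    l ∈ listsOf Z t ↔ l.length = t := by
  induction t generalizing l with
  | zero => simp [listsOf]
  | succ t ih =>
    cases l with
    | nil => simp [listsOf]
    | cons z l => simp [listsOf, ih]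

lemma sum_listsOf_succ {Z : Type} [Fintype Z] (t : ℕ) (F : List Z → ℝ) :
    ∑ l ∈ listsOf Z (t + 1), F l = ∑ z, ∑ l ∈ listsOf Z t, F (z :: l) := by
  rw [listsOf, Finset.sum_image, Finset.sum_product]
  rintro ⟨z, l⟩ _ ⟨z', l'⟩ _ h
  simpa using h

section Backward

variable {K I J C D : Type} [Fintype K] [Fintype I] [Fintype J] [Fintype C] [Fintype D]
  (g : K → I → J → ℝ) (q : K → I → J → K × C × D → ℝ)

/-- The expected payoff of stage `t + 1` from a given state and given signals. -/
def stagePay : ℕ → Strat1 C I → Strat2 D J → K × C × D → ℝ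
  | 0, σ, τ, s => ∑ i, ∑ j, σ.play [] s.2.1 i * τ.play [] s.2.2 j * g s.1 i j
  | t + 1, σ, τ, s => ∑ i, ∑ j, σ.play [] s.2.1 i * τ.play [] s.2.2 j *
      ∑ s', q s.1 i j s' * stagePay t (σ.shift (s.2.1, i)) (τ.shift (s.2.2, j)) s'

/-- The expected total payoff of the first `n` stages. -/
def totalPay (n : ℕ) (σ : Strat1 C I) (τ : Strat2 D J) (s : K × C × D) : ℝ :=
  ∑ t ∈ Finset.range n, stagePay g q t σ τ s

lemma recProbAux_append (π : K × C × D → ℝ) (σ : Strat1 C I) (τ : Strat2 D J)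
    (l : List (K × C × D × I × J)) (z : K × C × D × I × J) (s : K × C × D) :
    recProbAux q π σ τ (l ++ [z]) s =
      π (z.1, z.2.1, z.2.2.1) * σ.play [] z.2.1 z.2.2.2.1 * τ.play [] z.2.2.1 z.2.2.2.2 *
        recProbAux q (q z.1 z.2.2.2.1 z.2.2.2.2) (σ.shift (z.2.1, z.2.2.2.1))
          (τ.shift (z.2.2.1, z.2.2.2.2)) l s := by
  induction l generalizing s with
  | nil => simp [recProbAux, p1hist, p2hist]
  | cons y l ih =>
    rw [List.cons_append, recProbAux, ih, recProbAux]
    simp only [List.reverse_append, List.reverse_singleton, List.singleton_append, p1hist, p2hist,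
      List.map_cons, Strat1.shift, Strat2.shift]
    ring

lemma sPayoff_succ (π : K × C × D → ℝ) (σ : Strat1 C I) (τ : Strat2 D J) (t : ℕ) :
    sPayoff g q π σ τ (t + 1) = ∑ l ∈ listsOf (K × C × D × I × J) t, ∑ s, recProb q π σ τ l s *
      ∑ i, ∑ j, σ.play (p1hist l) s.2.1 i * τ.play (p2hist l) s.2.2 j * g s.1 i j := by
  unfold sPayoff
  rw [tsum_eq_sum (s := listsOf (K × C × D × I × J) t ×ˢ Finset.univ)]
  · rw [Finset.sum_product]
    refine Finset.sum_congr rfl fun l hl => Finset.sum_congr rfl fun s _ => ?_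
    rw [if_pos (by rw [mem_listsOf.1 hl])]
  · intro rs h
    refine if_neg fun h' => h ?_
    simp only [Finset.mem_product, Finset.mem_univ, and_true]
    exact mem_listsOf.2 (by omega)

lemma sPayoff_eq_sum_stagePay (π : K × C × D → ℝ) (σ : Strat1 C I) (τ : Strat2 D J) (t : ℕ) :
    sPayoff g q π σ τ (t + 1) = ∑ s, π s * stagePay g q t σ τ s := by
  induction t generalizing π σ τ with
  | zero =>
    rw [sPayoff_succ]
    simp [listsOf, recProb, recProbAux, p1hist, p2hist, stagePay]
  | succ t ih =>
    have h : sPayoff g q π σ τ (t + 1 + 1) = ∑ z : K × C × D × I × J,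
        π (z.1, z.2.1, z.2.2.1) * σ.play [] z.2.1 z.2.2.2.1 * τ.play [] z.2.2.1 z.2.2.2.2 *
          sPayoff g q (q z.1 z.2.2.2.1 z.2.2.2.2) (σ.shift (z.2.1, z.2.2.2.1))
            (τ.shift (z.2.2.1, z.2.2.2.2)) (t + 1) := by
      rw [sPayoff_succ, sum_listsOf_succ]
      refine Finset.sum_congr rfl fun z _ => ?_
      rw [sPayoff_succ, Finset.mul_sum]
      refine Finset.sum_congr rfl fun l _ => ?_
      rw [Finset.mul_sum]
      refine Finset.sum_congr rfl fun s _ => ?_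
      rw [recProb, recProb, List.reverse_cons, recProbAux_append]
      simp only [p1hist, p2hist, List.map_cons, Strat1.shift, Strat2.shift]
      ring
    rw [h]
    simp only [ih, Fintype.sum_prod_type, stagePay, Finset.mul_sum, mul_assoc]

lemma sum_sPayoff (π : K × C × D → ℝ) (σ : Strat1 C I) (τ : Strat2 D J) (n : ℕ) :
    ∑ t ∈ Finset.range n, sPayoff g q π σ τ (t + 1) = ∑ s, π s * totalPay g q n σ τ s := by
  simp only [sPayoff_eq_sum_stagePay, totalPay, Finset.mul_sum]
  exact Finset.sum_comm

lemma avgPay_eq (π : K × C × D → ℝ) (σ : Strat1 C I) (τ : Strat2 D J) (n : ℕ) :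
    avgPay g q π σ τ n = (n : ℝ)⁻¹ * ∑ t ∈ Finset.range n, sPayoff g q π σ τ (t + 1) := by
  rw [avgPay, Finset.range_eq_Ico, Finset.sum_Ico_add' (fun t => sPayoff g q π σ τ t) 0 n 1]
  rfl

lemma totalPay_succ (n : ℕ) (σ : Strat1 C I) (τ : Strat2 D J) (s : K × C × D) :
    totalPay g q (n + 1) σ τ s = ∑ i, ∑ j, σ.play [] s.2.1 i * τ.play [] s.2.2 j *
      (g s.1 i j + ∑ s', q s.1 i j s' *
        totalPay g q n (σ.shift (s.2.1, i)) (τ.shift (s.2.2, j)) s') := by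
  rw [totalPay, Finset.sum_range_succ', add_comm]
  simp only [stagePay, totalPay]
  rw [Finset.sum_comm (s := Finset.range n), ← Finset.sum_add_distrib]
  refine Finset.sum_congr rfl fun i _ => ?_
  rw [Finset.sum_comm (s := Finset.range n), ← Finset.sum_add_distrib]
  refine Finset.sum_congr rfl fun j _ => ?_
  rw [← Finset.mul_sum, ← mul_add, Finset.sum_comm]
  simp only [Finset.mul_sum]

lemma totalPay_congr (n : ℕ) {σ σ' : Strat1 C I} {τ τ' : Strat2 D J} {s : K × C × D}
    (h1 : σ.play [] s.2.1 = σ'.play [] s.2.1)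
    (h2 : ∀ i, σ.shift (s.2.1, i) = σ'.shift (s.2.1, i))
    (h3 : τ.play [] s.2.2 = τ'.play [] s.2.2)
    (h4 : ∀ j, τ.shift (s.2.2, j) = τ'.shift (s.2.2, j)) :
    totalPay g q n σ τ s = totalPay g q n σ' τ' s := by
  cases n with
  | zero => simp [totalPay]
  | succ n => simp only [totalPay_succ, h1, h2, h3, h4]

variable {g q}

lemma sum_sum_mixed_mul_const (σ : Strat1 C I) (τ : Strat2 D J) (c : C) (d : D) (x : ℝ) :
    ∑ i, ∑ j, σ.play [] c i * τ.play [] d j * x = x := by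
  simp only [mul_assoc, ← Finset.mul_sum, ← Finset.sum_mul, τ.sum_one, σ.sum_one, one_mul]

lemma abs_sum_sum_mixed_le (σ : Strat1 C I) (τ : Strat2 D J) (c : C) (d : D) {F : I → J → ℝ}
    (hF : ∀ i j, |F i j| ≤ 1) : |∑ i, ∑ j, σ.play [] c i * τ.play [] d j * F i j| ≤ 1 := by
  rw [← sum_sum_mixed_mul_const σ τ c d 1]
  refine (Finset.abs_sum_le_sum_abs _ _).trans (Finset.sum_le_sum fun i _ => ?_)
  refine (Finset.abs_sum_le_sum_abs _ _).trans (Finset.sum_le_sum fun j _ => ?_)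
  have := mul_nonneg (σ.nonneg [] c i) (τ.nonneg [] d j)
  rw [abs_mul, abs_of_nonneg this]
  exact mul_le_mul_of_nonneg_left (hF i j) this

lemma abs_sum_mul_le {Z : Type} [Fintype Z] {w F : Z → ℝ} (hw : ∀ s, 0 ≤ w s)
    (hw1 : ∑ s, w s = 1) (hF : ∀ s, |F s| ≤ 1) : |∑ s, w s * F s| ≤ 1 := by
  rw [← hw1]
  refine (Finset.abs_sum_le_sum_abs _ _).trans (Finset.sum_le_sum fun s _ => ?_)
  rw [abs_mul, abs_of_nonneg (hw s)]
  exact mul_le_of_le_one_right (hw s) (hF s)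

lemma abs_stagePay_le (hg : ∀ k i j, |g k i j| ≤ 1) (hq0 : ∀ k i j s, 0 ≤ q k i j s)
    (hq1 : ∀ k i j, ∑ s, q k i j s = 1) (t : ℕ) (σ : Strat1 C I) (τ : Strat2 D J)
    (s : K × C × D) : |stagePay g q t σ τ s| ≤ 1 := by
  induction t generalizing σ τ s with
  | zero => exact abs_sum_sum_mixed_le σ τ _ _ (hg s.1)
  | succ t ih =>
    exact abs_sum_sum_mixed_le σ τ _ _ fun i j =>
      abs_sum_mul_le (hq0 _ _ _) (hq1 _ _ _) (ih _ _)

end Backward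

/-! ### The data of an informed recursive game -/

/-- A recursive game in which the signals of player 2 reveal his actions and player 1 knows the
signals of player 2; `gk` gives the absorbing payoffs. -/
structure InformedGame (K I J C D : Type) [Fintype K] [Fintype C] [Fintype D] where
  g : K → I → J → ℝ
  q : K → I → J → K × C × D → ℝ
  jhat : D → J
  dhat : C → D
  absorbing : K → Prop
  gk : K → ℝ
  q_nonneg : ∀ k i j s, 0 ≤ q k i j s
  q_sum : ∀ k i j, ∑ s, q k i j s = 1
  jhat_eq : ∀ k i j s, q k i j s ≠ 0 → jhat s.2.2 = j
  dhat_eq : ∀ k i j s, q k i j s ≠ 0 → dhat s.2.1 = s.2.2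
  g_active : ∀ k, ¬ absorbing k → ∀ i j, g k i j = 0
  g_absorbing : ∀ k, absorbing k → ∀ i j, g k i j = gk k
  q_absorbing : ∀ k, absorbing k → ∀ i j s, q k i j s ≠ 0 → s.1 = k
  abs_gk_le : ∀ k, |gk k| ≤ 1

namespace InformedGame

variable {K I J C D : Type} [Fintype K] [Fintype I] [Fintype J] [Fintype C] [Fintype D]
  (Γ : InformedGame K I J C D)

/-- The one-step data of the game. -/
def data : StepData K I J C D where
  p k i j k' c d := if Γ.absorbing k' then 0 else Γ.q k i j (k', c, d)
  r k i j := ∑ s, if Γ.absorbing s.1 then Γ.q k i j s * Γ.gk s.1 else 0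
  m k i j := ∑ s, if Γ.absorbing s.1 then Γ.q k i j s else 0
  p_nonneg k i j k' c d := by
    split_ifs
    · exact le_rfl
    · exact Γ.q_nonneg _ _ _ _
  abs_r_le k i j := by
    refine (Finset.abs_sum_le_sum_abs _ _).trans (Finset.sum_le_sum fun s _ => ?_)
    split_ifs
    · rw [abs_mul, abs_of_nonneg (Γ.q_nonneg _ _ _ _)]
      exact mul_le_of_le_one_right (Γ.q_nonneg _ _ _ _) (Γ.abs_gk_le _)
    · simp
  mass_le k i j := by
    rw [← Γ.q_sum k i j]
    simp only [Fintype.sum_prod_type, ← Finset.sum_add_distrib]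
    refine le_of_eq (Finset.sum_congr rfl fun k' _ => Finset.sum_congr rfl fun c _ =>
      Finset.sum_congr rfl fun d _ => ?_)
    split_ifs <;> simp

lemma stagePay_absorbing (t : ℕ) (σ : Strat1 C I) (τ : Strat2 D J) {s : K × C × D}
    (hs : Γ.absorbing s.1) : stagePay Γ.g Γ.q t σ τ s = Γ.gk s.1 := by
  induction t generalizing σ τ s with
  | zero =>
    rw [stagePay, ← sum_sum_mixed_mul_const σ τ s.2.1 s.2.2 (Γ.gk s.1)]
    simp only [Γ.g_absorbing _ hs]
  | succ t ih =>
    rw [stagePay, ← sum_sum_mixed_mul_const σ τ s.2.1 s.2.2 (Γ.gk s.1)]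
    refine Finset.sum_congr rfl fun i _ => Finset.sum_congr rfl fun j _ => congrArg _ ?_
    rw [← one_mul (Γ.gk s.1), ← Γ.q_sum s.1 i j, Finset.sum_mul]
    refine Finset.sum_congr rfl fun s' _ => ?_
    by_cases h : Γ.q s.1 i j s' = 0
    · simp [h]
    · have := Γ.q_absorbing _ hs i j s' h
      rw [ih _ _ (this ▸ hs), this]

lemma totalPay_absorbing (n : ℕ) (σ : Strat1 C I) (τ : Strat2 D J) {s : K × C × D}
    (hs : Γ.absorbing s.1) : totalPay Γ.g Γ.q n σ τ s = n * Γ.gk s.1 := by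
  simp [totalPay, Γ.stagePay_absorbing _ _ _ hs]

/-- The expected total payoff of `n` stages for a family of beliefs `a`, where in row `s` player 1
has received `cs s` and uses `σs s`, and player 2 has received `d` and uses `τ`. -/
def famPay (n : ℕ) {S : Type} [Fintype S] (a : S → K → ℝ) (cs : S → C) (σs : S → Strat1 C I)
    (τ : Strat2 D J) (d : D) : ℝ :=
  ∑ s, ∑ k, a s k * totalPay Γ.g Γ.q n (σs s) τ (k, cs s, d)

lemma sum_q_mul_totalPay (k : K) (i : I) (j : J) (n : ℕ) (σ : Strat1 C I) (τ : Strat2 D J) :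
    ∑ s', Γ.q k i j s' * totalPay Γ.g Γ.q n σ τ s' = n * Γ.data.r k i j +
      ∑ d', ∑ c', ∑ k', Γ.data.p k i j k' c' d' * totalPay Γ.g Γ.q n σ τ (k', c', d') := by
  have h : ∑ d', ∑ c', ∑ k', Γ.data.p k i j k' c' d' * totalPay Γ.g Γ.q n σ τ (k', c', d') =
      ∑ s' : K × C × D, Γ.data.p k i j s'.1 s'.2.1 s'.2.2 * totalPay Γ.g Γ.q n σ τ s' := by
    simp only [Fintype.sum_prod_type]
    rw [Finset.sum_comm, Finset.sum_congr rfl fun c' _ => Finset.sum_comm, Finset.sum_comm]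
  rw [h, data, Finset.mul_sum, ← Finset.sum_add_distrib]
  refine Finset.sum_congr rfl fun s' _ => ?_
  by_cases hs : Γ.absorbing s'.1
  · simp only [hs, if_true, Γ.totalPay_absorbing n σ τ hs]; ring
  · simp [hs]

lemma famPay_succ (n : ℕ) {S : Type} [Fintype S] {a : S → K → ℝ}
    (ha : ∀ s k, Γ.absorbing k → a s k = 0) (cs : S → C) (σs : S → Strat1 C I)
    (τ : Strat2 D J) (d : D) :
    Γ.famPay (n + 1) a cs σs τ d = ∑ j, τ.play [] d j *
      (n * Γ.data.rew (fun s => (σs s).play [] (cs s)) j a +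
        ∑ d', Γ.famPay n (Γ.data.step (fun s => (σs s).play [] (cs s)) j d' a) (fun x => x.2.2)
          (fun x => (σs x.1).shift (cs x.1, x.2.1)) (τ.shift (d, j)) d') := by
  have key : ∀ j, (n * Γ.data.rew (fun s => (σs s).play [] (cs s)) j a +
        ∑ d', Γ.famPay n (Γ.data.step (fun s => (σs s).play [] (cs s)) j d' a) (fun x => x.2.2)
          (fun x => (σs x.1).shift (cs x.1, x.2.1)) (τ.shift (d, j)) d') =
      ∑ s, ∑ i, ∑ k, (σs s).play [] (cs s) i * (a s k * ∑ s', Γ.q k i j s' *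
        totalPay Γ.g Γ.q n ((σs s).shift (cs s, i)) (τ.shift (d, j)) s') := by
    intro j
    simp only [sum_q_mul_totalPay, mul_add, Finset.sum_add_distrib]
    congr 1
    · rw [StepData.rew, Finset.mul_sum]
      refine Finset.sum_congr rfl fun s _ => ?_
      rw [Finset.mul_sum]
      refine Finset.sum_congr rfl fun i _ => ?_
      rw [Finset.mul_sum]
      exact Finset.sum_congr rfl fun k _ => by ring
    · simp only [famPay, Fintype.sum_prod_type, StepData.step]
      rw [Finset.sum_comm]
      refine Finset.sum_congr rfl fun s _ => ?_
      rw [Finset.sum_comm]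
      refine Finset.sum_congr rfl fun i _ => ?_
      have hcomm : ∀ F : D → C → K → K → ℝ, ∑ d', ∑ c', ∑ k', ∑ k, F d' c' k' k =
          ∑ k, ∑ d', ∑ c', ∑ k', F d' c' k' k := by
        intro F
        symm
        rw [Finset.sum_comm]
        refine Finset.sum_congr rfl fun d' _ => ?_
        rw [Finset.sum_comm]
        exact Finset.sum_congr rfl fun c' _ => Finset.sum_comm
      simp only [Finset.mul_sum, Finset.sum_mul, hcomm, mul_assoc]
  simp only [key]
  have hz : ∀ s k, a s k * totalPay Γ.g Γ.q (n + 1) (σs s) τ (k, cs s, d) =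
      ∑ i, ∑ j, τ.play [] d j * ((σs s).play [] (cs s) i * (a s k * ∑ s', Γ.q k i j s' *
        totalPay Γ.g Γ.q n ((σs s).shift (cs s, i)) (τ.shift (d, j)) s')) := by
    intro s k
    by_cases hk : Γ.absorbing k
    · simp [ha s k hk]
    · rw [totalPay_succ, Finset.mul_sum]
      refine Finset.sum_congr rfl fun i _ => ?_
      rw [Finset.mul_sum]
      refine Finset.sum_congr rfl fun j _ => ?_
      rw [Γ.g_active k hk]
      ring
  simp only [famPay, hz]
  symm
  rw [Finset.sum_congr rfl fun j _ => Finset.mul_sum _ _ _, Finset.sum_comm]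
  refine Finset.sum_congr rfl fun s _ => Eq.trans ?_ Finset.sum_comm
  rw [Finset.sum_congr rfl fun j _ => Finset.mul_sum _ _ _, Finset.sum_comm]
  refine Finset.sum_congr rfl fun i _ => Eq.trans ?_ Finset.sum_comm
  exact Finset.sum_congr rfl fun j _ => Finset.mul_sum _ _ _

end InformedGame

end SigGame

namespace SigGame

namespace InformedGame

variable {K I J C D : Type} [Fintype K] [Fintype I] [Fintype J] [Fintype C] [Fintype D]
  (Γ : InformedGame K I J C D)

/-- The first signal in a history followed by a current signal. -/
def firstSignal {C I : Type} : List (C × I) → C → C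
  | [], c => c
  | z :: _, _ => z.1

/-! ### A strategy of the informed player -/

section Informed

variable (sel : (S : Type) → [Fintype S] → (S → K → ℝ) → S → I → ℝ)

/-- The behavior of player 1 who tracks the family of beliefs `a` of player 2, in row `s`, and plays
`sel` at each stage. -/
def trackPlay : List (C × I) → (S : Type) → [Fintype S] → (S → K → ℝ) → S → C → I → ℝ
  | [], S, _, a, s, _ => sel S a s
  | z :: h, S, _, a, s, c => trackPlay h (S × I × C)
      (Γ.data.step (sel S a) (Γ.jhat (Γ.dhat (firstSignal h c))) (Γ.dhat (firstSignal h c)) a)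
      (s, z.2, firstSignal h c) c

variable {sel}

lemma trackPlay_mixed (hsel : ∀ (S : Type) [Fintype S] (a : S → K → ℝ), IsMixed (sel S a))
    (h : List (C × I)) : ∀ (S : Type) [Fintype S] (a : S → K → ℝ) (s : S) (c : C),
    (∀ i, 0 ≤ Γ.trackPlay sel h S a s c i) ∧ ∑ i, Γ.trackPlay sel h S a s c i = 1 := by
  induction h with
  | nil => exact fun S _ a s c => ⟨(hsel S a).1 s, (hsel S a).2 s⟩
  | cons z h ih => exact fun S _ a s c => ih _ _ _ _

end Informed

/-- The strategy of player 1 given by `trackPlay`. -/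
def track {sel : (S : Type) → [Fintype S] → (S → K → ℝ) → S → I → ℝ}
    (hsel : ∀ (S : Type) [Fintype S] (a : S → K → ℝ), IsMixed (sel S a))
    (S : Type) [Fintype S] (a : S → K → ℝ) (s : S) : Strat1 C I where
  play h c i := Γ.trackPlay sel h S a s c i
  nonneg h c := (Γ.trackPlay_mixed hsel h S a s c).1
  sum_one h c := (Γ.trackPlay_mixed hsel h S a s c).2

lemma step_absorbing {S : Type} (α : S → I → ℝ) (j : J) (d : D) (a : S → K → ℝ)
    (x : S × I × C) (k : K) (hk : Γ.absorbing k) : Γ.data.step α j d a x k = 0 := by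
  simp [StepData.step, data, hk]

lemma step_eq_zero {S : Type} (α : S → I → ℝ) (j : J) (d : D) (a : S → K → ℝ)
    (x : S × I × C) (k : K) (hx : ¬ (Γ.jhat d = j ∧ Γ.dhat x.2.2 = d)) :
    Γ.data.step α j d a x k = 0 := by
  have h : ∀ k', Γ.q k' x.2.1 j (k, x.2.2, d) = 0 := fun k' => by
    by_contra h
    exact hx ⟨Γ.jhat_eq _ _ _ _ h, Γ.dhat_eq _ _ _ _ h⟩
  simp [StepData.step, data, h]

/-- A lower bound for every action is a lower bound for the average over a mixed action. -/
lemma le_sum_mixed (τ : Strat2 D J) (d : D) {F : J → ℝ} {x : ℝ} (h : ∀ j, x ≤ F j) :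
    x ≤ ∑ j, τ.play [] d j * F j := by
  calc x = ∑ j, τ.play [] d j * x := by rw [← Finset.sum_mul, τ.sum_one, one_mul]
    _ ≤ _ := Finset.sum_le_sum fun j _ => mul_le_mul_of_nonneg_left (h j) (τ.nonneg _ _ _)

theorem le_famPay_track {sel : (S : Type) → [Fintype S] → (S → K → ℝ) → S → I → ℝ}
    (hsel : ∀ (S : Type) [Fintype S] (a : S → K → ℝ), IsMixed (sel S a))
    {W : FamFun K} {L e : ℝ} (hL : 0 ≤ L)
    (hW : ∀ (S : Type) [Fintype S] (a : S → K → ℝ), W S a ≤ 3 * fnorm a)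
    (hopt : ∀ (S : Type) [Fintype S] (a : S → K → ℝ), (∀ s k, 0 ≤ a s k) → ∀ j, ∀ n : ℕ,
      ((n : ℝ) + 1 + L) * W S a - (3 * L + e * (n + 1)) * fnorm a ≤
        n * Γ.data.rew (sel S a) j a + ∑ d, ((n + L) * W (S × I × C) (Γ.data.step (sel S a) j d a) -
          (3 * L + e * n) * fnorm (Γ.data.step (sel S a) j d a)))
    (n : ℕ) : ∀ (S : Type) [Fintype S] (a : S → K → ℝ), (∀ s k, 0 ≤ a s k) →
      (∀ s k, Γ.absorbing k → a s k = 0) → ∀ (cs : S → C) (τ : Strat2 D J) (d : D),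
      (n + L) * W S a - (3 * L + e * n) * fnorm a ≤
        Γ.famPay n a cs (fun s => Γ.track hsel S a s) τ d := by
  induction n with
  | zero =>
    intro S _ a ha _ cs τ d
    simp only [famPay, totalPay, Finset.range_zero, Finset.sum_empty, mul_zero,
      Finset.sum_const_zero]
    have := mul_le_mul_of_nonneg_left (hW S a) hL
    push_cast
    linarith
  | succ n ih =>
    intro S _ a ha ha0 cs τ d
    rw [Γ.famPay_succ n ha0]
    refine le_sum_mixed τ d fun j => ?_
    push_cast
    refine (hopt S a ha j n).trans (add_le_add le_rfl (Finset.sum_le_sum fun d' _ => ?_))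
    refine (ih (S × I × C) (Γ.data.step (sel S a) j d' a)
      (Γ.data.step_nonneg (hsel S a) j d' ha) (Γ.step_absorbing _ _ _ _) (fun x => x.2.2)
      (τ.shift (d, j)) d').trans (le_of_eq ?_)
    refine Finset.sum_congr rfl fun x _ => Finset.sum_congr rfl fun k _ => ?_
    change Γ.data.step (sel S a) j d' a x k * _ = Γ.data.step (sel S a) j d' a x k * _
    by_cases hx : Γ.jhat d' = j ∧ Γ.dhat x.2.2 = d'
    · obtain ⟨rfl, rfl⟩ := hx
      exact congrArg _ (totalPay_congr _ _ _ rfl (fun _ => rfl) rfl fun _ => rfl)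
    · rw [Γ.step_eq_zero _ _ _ _ _ _ hx, zero_mul, zero_mul]

/-! ### A reply of the less informed player -/

section Reply

variable (rep : (S : Type) → [Fintype S] → (S → K → ℝ) → (S → I → ℝ) → J)

/-- The behavior of player 2 who tracks his family of beliefs `a`, where in row `s` player 1 has
received `cs s` and uses `σs s`, and plays `rep` at each stage. -/
def replyPlay : List (D × J) → (S : Type) → [Fintype S] → (S → K → ℝ) → (S → C) →
    (S → Strat1 C I) → D → J
  | [], S, _, a, cs, σs, _ => rep S a fun s => (σs s).play [] (cs s)
  | z :: h, S, _, a, cs, σs, d => replyPlay h (S × I × C)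
      (Γ.data.step (fun s => (σs s).play [] (cs s)) z.2 (firstSignal h d) a) (fun x => x.2.2)
      (fun x => (σs x.1).shift (cs x.1, x.2.1)) d

/-- The strategy of player 2 given by `replyPlay`. -/
def reply (S : Type) [Fintype S] (a : S → K → ℝ) (cs : S → C) (σs : S → Strat1 C I) :
    Strat2 D J where
  play h d j := if j = Γ.replyPlay rep h S a cs σs d then 1 else 0
  nonneg h d j := by split_ifs <;> norm_num
  sum_one h d := by simp

theorem famPay_reply_le {W : FamFun K} {L e : ℝ} (hL : 0 ≤ L)
    (hW : ∀ (S : Type) [Fintype S] (a : S → K → ℝ), -(3 * fnorm a) ≤ W S a)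
    (hopt : ∀ (S : Type) [Fintype S] (a : S → K → ℝ), (∀ s k, 0 ≤ a s k) →
      ∀ α : S → I → ℝ, IsMixed α → ∀ n : ℕ,
      n * Γ.data.rew α (rep S a α) a + ∑ d, ((n + L) * W (S × I × C)
          (Γ.data.step α (rep S a α) d a) +
          (3 * L + e * n) * fnorm (Γ.data.step α (rep S a α) d a)) ≤
        ((n : ℝ) + 1 + L) * W S a + (3 * L + e * (n + 1)) * fnorm a)
    (n : ℕ) : ∀ (S : Type) [Fintype S] (a : S → K → ℝ), (∀ s k, 0 ≤ a s k) →
      (∀ s k, Γ.absorbing k → a s k = 0) → ∀ (cs : S → C) (σs : S → Strat1 C I) (d : D),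
      Γ.famPay n a cs σs (Γ.reply rep S a cs σs) d ≤
        (n + L) * W S a + (3 * L + e * n) * fnorm a := by
  induction n with
  | zero =>
    intro S _ a ha _ cs σs d
    simp only [famPay, totalPay, Finset.range_zero, Finset.sum_empty, mul_zero,
      Finset.sum_const_zero]
    have := mul_le_mul_of_nonneg_left (hW S a) hL
    push_cast
    linarith
  | succ n ih =>
    intro S _ a ha ha0 cs σs d
    have hα : IsMixed fun s => (σs s).play [] (cs s) :=
      ⟨fun s i => (σs s).nonneg _ _ _, fun s => (σs s).sum_one _ _⟩
    rw [Γ.famPay_succ n ha0]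
    have hplay : ∀ j, (Γ.reply rep S a cs σs).play [] d j =
      if j = rep S a (fun s => (σs s).play [] (cs s)) then 1 else 0 := fun j => rfl
    simp only [hplay, ite_mul, one_mul, zero_mul, Finset.sum_ite_eq', Finset.mem_univ, if_true]
    push_cast
    refine le_trans (add_le_add le_rfl (Finset.sum_le_sum fun d' _ => ?_)) (hopt S a ha _ hα n)
    refine le_trans (le_of_eq ?_) (ih (S × I × C) _
      (Γ.data.step_nonneg hα _ d' ha) (Γ.step_absorbing _ _ _ _) (fun x => x.2.2)
      (fun x => (σs x.1).shift (cs x.1, x.2.1)) d')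
    refine Finset.sum_congr rfl fun x _ => Finset.sum_congr rfl fun k _ => congrArg _ ?_
    exact totalPay_congr _ _ _ rfl (fun _ => rfl) rfl fun _ => rfl

end Reply

end InformedGame

end SigGame

namespace SigGame

namespace InformedGame

variable {K I J C D : Type} [Fintype K] [Fintype I] [Fintype J] [Fintype C] [Fintype D]
  (Γ : InformedGame K I J C D) (π : K × C × D → ℝ)

/-- The initial family of beliefs of player 2 when he receives the signal `d`. -/
def initFam (d : D) (c : C) (k : K) : ℝ := if Γ.absorbing k then 0 else π (k, c, d)

/-- The initially absorbed expected payoff. -/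
def initPay : ℝ := ∑ s, if Γ.absorbing s.1 then π s * Γ.gk s.1 else 0

lemma sum_mul_totalPay (n : ℕ) (σ : Strat1 C I) (τ : Strat2 D J) :
    ∑ s, π s * totalPay Γ.g Γ.q n σ τ s =
      n * Γ.initPay π + ∑ d, Γ.famPay n (Γ.initFam π d) id (fun _ => σ) τ d := by
  have h : ∑ d, Γ.famPay n (Γ.initFam π d) id (fun _ => σ) τ d =
      ∑ s : K × C × D, Γ.initFam π s.2.2 s.2.1 s.1 * totalPay Γ.g Γ.q n σ τ s := by
    simp only [Fintype.sum_prod_type, famPay, id]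
    rw [Finset.sum_comm, Finset.sum_congr rfl fun c' _ => Finset.sum_comm, Finset.sum_comm]
  rw [h, initPay, Finset.mul_sum, ← Finset.sum_add_distrib]
  refine Finset.sum_congr rfl fun s _ => ?_
  by_cases hs : Γ.absorbing s.1
  · simp only [hs, if_true, Γ.totalPay_absorbing n σ τ hs, initFam]; ring
  · simp [hs, initFam]

variable {π}

lemma initFam_nonneg (hπ0 : ∀ s, 0 ≤ π s) (d : D) (c : C) (k : K) : 0 ≤ Γ.initFam π d c k := by
  unfold initFam
  split_ifs
  · exact le_rfl
  · exact hπ0 _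

lemma initFam_absorbing (d : D) (c : C) (k : K) (hk : Γ.absorbing k) : Γ.initFam π d c k = 0 :=
  if_pos hk

lemma sum_fnorm_initFam_le (hπ0 : ∀ s, 0 ≤ π s) (hπ1 : ∑ s, π s = 1) :
    ∑ d, fnorm (Γ.initFam π d) ≤ 1 := by
  rw [← hπ1]
  simp only [fnorm_of_nonneg (Γ.initFam_nonneg hπ0 _), Fintype.sum_prod_type]
  rw [Finset.sum_comm, Finset.sum_congr rfl fun c' _ => Finset.sum_comm, Finset.sum_comm]
  refine Finset.sum_le_sum fun k _ => Finset.sum_le_sum fun c _ => Finset.sum_le_sum fun d _ => ?_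
  unfold initFam
  split_ifs
  · exact hπ0 _
  · exact le_rfl

/-- The number `w` such that player 1 uniformly guarantees `w` and player 2 uniformly defends it,
in terms of total payoffs. -/
theorem exists_uniform_bounds [Nonempty K] [Nonempty I] [Nonempty J]
    (hπ0 : ∀ s, 0 ≤ π s) (hπ1 : ∑ s, π s = 1)
    (hπd : ∀ s, π s ≠ 0 → Γ.dhat s.2.1 = s.2.2) :
    ∃ w : ℝ, ∀ ε > (0 : ℝ), ∃ M ≥ (0 : ℝ),
      (∃ σ : Strat1 C I, ∀ (τ : Strat2 D J) (n : ℕ),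
        n * (w - ε) - M ≤ ∑ t ∈ Finset.range n, sPayoff Γ.g Γ.q π σ τ (t + 1)) ∧
      ∀ σ : Strat1 C I, ∃ τ : Strat2 D J, ∀ n : ℕ,
        ∑ t ∈ Finset.range n, sPayoff Γ.g Γ.q π σ τ (t + 1) ≤ n * (w + ε) + M := by
  obtain ⟨f, hf, hfix, happ⟩ := Γ.data.exists_limit_value
  refine ⟨Γ.initPay π + ∑ d, f C (Γ.initFam π d), fun ε hε => ?_⟩
  set η : ℝ := min (ε / 6) 1 with hη
  have hη0 : 0 < η := lt_min (by positivity) one_pos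
  have hηε : 6 * η ≤ ε := by
    have := min_le_left (ε / 6) 1
    rw [← hη] at this
    linarith
  obtain ⟨lam, hlam, W, W', hW, h1, h2⟩ :=
    Γ.data.exists_potentials hf hfix happ hη0 (min_le_right _ _)
  have hN := Γ.sum_fnorm_initFam_le hπ0 hπ1
  have hN0 : 0 ≤ ∑ d, fnorm (Γ.initFam π d) := Finset.sum_nonneg fun _ _ => fnorm_nonneg _
  have hf1 : |∑ d, f C (Γ.initFam π d)| ≤ 1 :=
    ((Finset.abs_sum_le_sum_abs _ _).trans
      (Finset.sum_le_sum fun d _ => hf.abs_le _)).trans hN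
  rw [abs_le] at hf1
  set L : ℝ := 1 / lam with hL
  have hL0 : 0 < L := by positivity
  have hL3 : 3 / lam = 3 * L := by rw [hL]; ring
  rw [hL3] at h1 h2
  refine ⟨4 * L, by positivity, ?_, fun σ => ?_⟩
  · have hsel : ∀ (S : Type) [Fintype S] (a : S → K → ℝ), ∃ α : S → I → ℝ, IsMixed α ∧
        ((∀ s k, 0 ≤ a s k) → ∀ j, ∀ n : ℕ,
          ((n : ℝ) + 1 + L) * W S a - (3 * L + 6 * η * (n + 1)) * fnorm a ≤
          n * Γ.data.rew α j a + ∑ d, ((n + L) * W (S × I × C) (Γ.data.step α j d a) -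
            (3 * L + 6 * η * n) * fnorm (Γ.data.step α j d a))) := by
      intro S _ a
      by_cases ha : ∀ s k, 0 ≤ a s k
      · obtain ⟨α, hα, h⟩ := h1 S a ha
        exact ⟨α, hα, fun _ => h⟩
      · obtain ⟨α, hα, -⟩ := h1 S 0 fun _ _ => le_rfl
        exact ⟨α, hα, fun h => absurd h ha⟩
    choose sel hmix hsel using hsel
    let σ : Strat1 C I :=
      { play := fun h c => (Γ.track hmix C (Γ.initFam π (Γ.dhat (firstSignal h c)))
          (firstSignal h c)).play h c
        nonneg := fun h c => (Γ.track hmix C _ _).nonneg h c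
        sum_one := fun h c => (Γ.track hmix C _ _).sum_one h c }
    refine ⟨σ, fun τ n => ?_⟩
    rw [sum_sPayoff, sum_mul_totalPay]
    have h3 : ∀ d, Γ.famPay n (Γ.initFam π d) id (fun _ => σ) τ d =
        Γ.famPay n (Γ.initFam π d) id (fun c => Γ.track hmix C (Γ.initFam π d) c) τ d := by
      intro d
      refine Finset.sum_congr rfl fun c _ => Finset.sum_congr rfl fun k _ => ?_
      by_cases hz : π (k, c, d) = 0
      · simp [initFam, hz]
      · have hd : Γ.dhat c = d := hπd _ hz
        subst hd
        exact congrArg _ (totalPay_congr _ _ _ rfl (fun _ => rfl) rfl fun _ => rfl)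
    have h4 := Finset.sum_le_sum fun d (_ : d ∈ Finset.univ) =>
      Γ.le_famPay_track hmix hL0.le (fun S _ a => (hW S a).2.1) hsel n C (Γ.initFam π d)
        (Γ.initFam_nonneg hπ0 d) (Γ.initFam_absorbing d) id τ d
    rw [Finset.sum_sub_distrib, ← Finset.mul_sum, ← Finset.mul_sum] at h4
    simp only [h3]
    have h5 : ∑ d, f C (Γ.initFam π d) ≤ ∑ d, W C (Γ.initFam π d) :=
      Finset.sum_le_sum fun d _ => (hW _ _).1
    have hn : (0 : ℝ) ≤ n := Nat.cast_nonneg n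
    have h6 := mul_le_mul_of_nonneg_left h5 (add_nonneg hn hL0.le)
    have h7 := mul_le_mul_of_nonneg_left hN (show 0 ≤ 3 * L + 6 * η * n by positivity)
    have h8 := mul_le_mul_of_nonneg_left hf1.1 hL0.le
    have h9 := mul_le_mul_of_nonneg_left hηε hn
    nlinarith
  · have hrep : ∀ (S : Type) [Fintype S] (a : S → K → ℝ) (α : S → I → ℝ), ∃ j : J,
        (∀ s k, 0 ≤ a s k) → IsMixed α → ∀ n : ℕ,
          n * Γ.data.rew α j a + ∑ d, ((n + L) * W' (S × I × C) (Γ.data.step α j d a) +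
            (3 * L + 6 * η * n) * fnorm (Γ.data.step α j d a)) ≤
          ((n : ℝ) + 1 + L) * W' S a + (3 * L + 6 * η * (n + 1)) * fnorm a := by
      intro S _ a α
      by_cases ha : (∀ s k, 0 ≤ a s k) ∧ IsMixed α
      · obtain ⟨j, h⟩ := h2 S a ha.1 α ha.2
        exact ⟨j, fun _ _ => h⟩
      · exact ⟨Classical.arbitrary J, fun h h' => absurd ⟨h, h'⟩ ha⟩
    choose rep hrep using hrep
    let τ : Strat2 D J :=
      { play := fun h d => (Γ.reply rep C (Γ.initFam π (firstSignal h d)) id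
          (fun _ => σ)).play h d
        nonneg := fun h d => (Γ.reply rep C _ _ _).nonneg h d
        sum_one := fun h d => (Γ.reply rep C _ _ _).sum_one h d }
    refine ⟨τ, fun n => ?_⟩
    rw [sum_sPayoff, sum_mul_totalPay]
    have h3 : ∀ d, Γ.famPay n (Γ.initFam π d) id (fun _ => σ) τ d =
        Γ.famPay n (Γ.initFam π d) id (fun _ => σ)
          (Γ.reply rep C (Γ.initFam π d) id (fun _ => σ)) d := by
      intro d
      refine Finset.sum_congr rfl fun c _ => Finset.sum_congr rfl fun k _ => ?_
      exact congrArg _ (totalPay_congr _ _ _ rfl (fun _ => rfl) rfl fun _ => rfl)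
    have h4 := Finset.sum_le_sum fun d (_ : d ∈ Finset.univ) =>
      Γ.famPay_reply_le rep hL0.le (fun S _ a => (hW S a).2.2.2)
        (fun S _ a ha α hα => hrep S a α ha hα) n C (Γ.initFam π d)
        (Γ.initFam_nonneg hπ0 d) (Γ.initFam_absorbing d) id (fun _ => σ) d
    rw [Finset.sum_add_distrib, ← Finset.mul_sum, ← Finset.mul_sum] at h4
    simp only [h3]
    have h5 : ∑ d, W' C (Γ.initFam π d) ≤ ∑ d, f C (Γ.initFam π d) :=
      Finset.sum_le_sum fun d _ => (hW _ _).2.2.1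
    have hn : (0 : ℝ) ≤ n := Nat.cast_nonneg n
    have h6 := mul_le_mul_of_nonneg_left h5 (add_nonneg hn hL0.le)
    have h7 := mul_le_mul_of_nonneg_left hN (show 0 ≤ 3 * L + 6 * η * n by positivity)
    have h8 := mul_le_mul_of_nonneg_left hf1.2 hL0.le
    have h9 := mul_le_mul_of_nonneg_left hηε hn
    nlinarith

end InformedGame

/-! ### From total payoffs to average and discounted payoffs -/

lemma neg_le_sum_pow_mul {c : ℕ → ℝ} {M y : ℝ} (hy0 : 0 ≤ y) (hy1 : y ≤ 1)
    (hc : ∀ n, -M ≤ ∑ t ∈ Finset.range n, c t) (N : ℕ) :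
    -M ≤ ∑ t ∈ Finset.range N, y ^ t * c t := by
  have h : ∀ N, ∑ t ∈ Finset.range N, y ^ t * c t =
      (1 - y) * ∑ t ∈ Finset.range N, y ^ t * (∑ u ∈ Finset.range (t + 1), c u) +
        y ^ N * ∑ t ∈ Finset.range N, c t := by
    intro N
    induction N with
    | zero => simp
    | succ N ih =>
      rw [Finset.sum_range_succ, ih, Finset.sum_range_succ _ N, Finset.sum_range_succ c N]
      ring
  have h1 : ∑ t ∈ Finset.range N, y ^ t * (-M) ≤
      ∑ t ∈ Finset.range N, y ^ t * (∑ u ∈ Finset.range (t + 1), c u) :=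
    Finset.sum_le_sum fun t _ => mul_le_mul_of_nonneg_left (hc _) (pow_nonneg hy0 _)
  rw [← Finset.sum_mul] at h1
  have h2 := mul_le_mul_of_nonneg_left h1 (sub_nonneg.2 hy1)
  have h3 := mul_le_mul_of_nonneg_left (hc N) (pow_nonneg hy0 N)
  rw [h N]
  calc -M = (1 - y) * ((∑ t ∈ Finset.range N, y ^ t) * (-M)) + y ^ N * (-M) := by
        rw [← mul_assoc, mul_neg_geom_sum]; ring
    _ ≤ _ := add_le_add h2 h3

lemma hasSum_discount {lam : ℝ} (h0 : 0 < lam) (h1 : lam ≤ 1) :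
    HasSum (fun t : ℕ => lam * (1 - lam) ^ t) 1 := by
  have := (hasSum_geometric_of_lt_one (sub_nonneg.2 h1) (by linarith)).mul_left lam
  rwa [sub_sub_cancel, mul_inv_cancel₀ h0.ne'] at this

lemma summable_discount_mul {b : ℕ → ℝ} (hb : ∀ t, |b t| ≤ 1) {lam : ℝ} (h0 : 0 < lam)
    (h1 : lam ≤ 1) : Summable fun t : ℕ => lam * (1 - lam) ^ t * b t := by
  refine Summable.of_norm_bounded (hasSum_discount h0 h1).summable fun t => ?_
  have h : 0 ≤ lam * (1 - lam) ^ t := mul_nonneg h0.le (pow_nonneg (sub_nonneg.2 h1) t)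
  rw [Real.norm_eq_abs, abs_mul, abs_of_nonneg h]
  exact mul_le_of_le_one_right h (hb t)

lemma le_tsum_discount {b : ℕ → ℝ} (hb : ∀ t, |b t| ≤ 1) {x M : ℝ}
    (hbx : ∀ n : ℕ, n * x - M ≤ ∑ t ∈ Finset.range n, b t) {lam : ℝ} (h0 : 0 < lam)
    (h1 : lam ≤ 1) : x - lam * M ≤ ∑' t : ℕ, lam * (1 - lam) ^ t * b t := by
  have hs := ((summable_discount_mul hb h0 h1).hasSum.sub
    ((hasSum_discount h0 h1).mul_right x)).tendsto_sum_nat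
  have h2 : -(lam * M) ≤ ∑' t : ℕ, lam * (1 - lam) ^ t * b t - 1 * x := by
    refine ge_of_tendsto' hs fun N => ?_
    have h3 := neg_le_sum_pow_mul (c := fun t => b t - x) (M := M) (sub_nonneg.2 h1)
      (by linarith) (fun n => by
        have := hbx n
        simp only [Finset.sum_sub_distrib, Finset.sum_const, Finset.card_range, nsmul_eq_mul]
        linarith) N
    have h4 := mul_le_mul_of_nonneg_left h3 h0.le
    rw [Finset.mul_sum] at h4
    calc -(lam * M) = lam * -M := by ring
      _ ≤ _ := h4
      _ = _ := Finset.sum_congr rfl fun t _ => by ring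
  linarith

lemma tsum_discount_le {b : ℕ → ℝ} (hb : ∀ t, |b t| ≤ 1) {x M : ℝ}
    (hbx : ∀ n : ℕ, ∑ t ∈ Finset.range n, b t ≤ n * x + M) {lam : ℝ} (h0 : 0 < lam)
    (h1 : lam ≤ 1) : ∑' t : ℕ, lam * (1 - lam) ^ t * b t ≤ x + lam * M := by
  have h := le_tsum_discount (b := fun t => -b t) (x := -x) (M := M)
    (fun t => by rw [abs_neg]; exact hb t) (fun n => by
      have := hbx n
      rw [Finset.sum_neg_distrib]
      linarith) h0 h1
  simp only [mul_neg, tsum_neg] at h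
  linarith

lemma abs_tsum_discount_le {b : ℕ → ℝ} (hb : ∀ t, |b t| ≤ 1) {lam : ℝ} (h0 : 0 < lam)
    (h1 : lam ≤ 1) : |∑' t : ℕ, lam * (1 - lam) ^ t * b t| ≤ 1 := by
  have hsum : ∀ n : ℕ, |∑ t ∈ Finset.range n, b t| ≤ n := fun n =>
    (Finset.abs_sum_le_sum_abs _ _).trans
      ((Finset.sum_le_sum fun t _ => hb t).trans (by simp))
  have h2 := le_tsum_discount hb (x := -1) (M := 0)
    (fun n => by linarith [(abs_le.1 (hsum n)).1]) h0 h1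
  have h3 := tsum_discount_le hb (x := 1) (M := 0)
    (fun n => by linarith [(abs_le.1 (hsum n)).2]) h0 h1
  rw [abs_le]
  constructor <;> linarith

lemma abs_maxmin_sub_le {A B : Type} [Nonempty A] [Nonempty B] {F : A → B → ℝ}
    (hF : ∀ x y, |F x y| ≤ 1) {w δ : ℝ} (h1 : ∃ x, ∀ y, w - δ ≤ F x y)
    (h2 : ∀ x, ∃ y, F x y ≤ w + δ) : |(⨆ x, ⨅ y, F x y) - w| ≤ δ := by
  have hbdd : ∀ x, BddBelow (Set.range (F x)) := fun x =>
    ⟨-1, by rintro _ ⟨y, rfl⟩; exact (abs_le.1 (hF x y)).1⟩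
  have hle : ∀ x, ⨅ y, F x y ≤ w + δ := fun x => by
    obtain ⟨y, hy⟩ := h2 x
    exact (ciInf_le (hbdd x) y).trans hy
  have hsup : BddAbove (Set.range fun x => ⨅ y, F x y) :=
    ⟨w + δ, by rintro _ ⟨x, rfl⟩; exact hle x⟩
  obtain ⟨x, hx⟩ := h1
  have h3 : w - δ ≤ ⨆ x, ⨅ y, F x y := (le_ciInf hx).trans (le_ciSup hsup x)
  have h4 : ⨆ x, ⨅ y, F x y ≤ w + δ := ciSup_le hle
  rw [abs_le]
  constructor <;> linarith

instance {C I : Type} [Fintype I] [Nonempty I] : Nonempty (Strat1 C I) :=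
  ⟨{ play := fun _ _ i => if i = Classical.arbitrary I then 1 else 0
     nonneg := fun _ _ i => by split_ifs <;> norm_num
     sum_one := fun _ _ => by simp }⟩

instance {D J : Type} [Fintype J] [Nonempty J] : Nonempty (Strat2 D J) :=
  ⟨{ play := fun _ _ j => if j = Classical.arbitrary J then 1 else 0
     nonneg := fun _ _ j => by split_ifs <;> norm_num
     sum_one := fun _ _ => by simp }⟩

lemma eq_zero_of_sum_ite_eq {Z : Type} [Fintype Z] {w : Z → ℝ} {P : Z → Prop} [DecidablePred P] {x : ℝ}
    (hw : ∀ s, 0 ≤ w s) (h1 : ∑ s, w s = x) (h2 : ∑ s, (if P s then w s else 0) = x) (s : Z)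
    (hs : w s ≠ 0) : P s := by
  by_contra hP
  have h : ∑ s, (w s - if P s then w s else 0) = 0 := by
    rw [Finset.sum_sub_distrib, h1, h2, sub_self]
  rw [Finset.sum_eq_zero_iff_of_nonneg fun s _ => by split_ifs <;> simp [hw s]] at h
  have := h s (Finset.mem_univ s)
  rw [if_neg hP, sub_zero] at this
  exact hs this

end SigGame

open SigGame in
/-- Mertens conjecture for recursive games with signals, more
informed player 1. Let `Γ = (K,I,J,C,D,g,q)` be a finite recursive game with
signals in which each player's signal contains his own action and player 1 is more
informed than player 2. Then for every initial distribution `π ∈ Δ¹(K×C×D)` the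
limits `lim_n v_n(π)` and `lim_{λ→0} v_λ(π)` exist, the uniform maxmin exists, and
all three are equal. -/
theorem recursive_game_with_signals_maxmin
    {K I J C D : Type} [Fintype K] [Fintype I] [Fintype J] [Fintype C] [Fintype D]
    [Nonempty I] [Nonempty J]
    (g : K → I → J → ℝ) (hg : ∀ k i j, |g k i j| ≤ 1)
    (q : K → I → J → K × C × D → ℝ)
    (hq0 : ∀ k i j s, 0 ≤ q k i j s)
    (hq1 : ∀ k i j, ∑ s : K × C × D, q k i j s = 1)
    (ihat : C → I) (jhat : D → J)
    (hsig : ∀ k : K, ∀ i : I, ∀ j : J,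
      ∑ s : K × C × D, (if ihat s.2.1 = i ∧ jhat s.2.2 = j then q k i j s else 0) = 1)
    (absorbK : K → Prop)
    (hact : ∀ k, ¬ absorbK k → ∀ i j, g k i j = 0)
    (habs : ∀ k, absorbK k → ∀ i j,
      ∑ s : K × C × D, (if s.1 = k then q k i j s else 0) = 1)
    (habsg : ∀ k, absorbK k → ∀ i j i' j', g k i j = g k i' j')
    (dhat : C → D)
    (hinf : ∀ k i j,
      ∑ s : K × C × D, (if dhat s.2.1 = s.2.2 then q k i j s else 0) = 1)
    (π : K × C × D → ℝ) (hπ0 : ∀ s, 0 ≤ π s) (hπ1 : ∑ s : K × C × D, π s = 1)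
    (hπ1inf : ∑ s : K × C × D, (if dhat s.2.1 = s.2.2 then π s else 0) = 1) :
    ∃ w : ℝ,
      Filter.Tendsto (fun n => vn g q π n) Filter.atTop (nhds w) ∧
      Filter.Tendsto (fun lam => vlam g q π lam)
        (nhdsWithin 0 (Set.Ioc (0 : ℝ) 1)) (nhds w) ∧
      P1Guarantees g q π w ∧ P2Defends g q π w := by
  have hK : Nonempty K := by
    by_contra h
    rw [not_nonempty_iff] at h
    simp at hπ1
  obtain ⟨i₀⟩ := ‹Nonempty I›
  obtain ⟨j₀⟩ := ‹Nonempty J›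
  have hI : Nonempty I := ⟨i₀⟩
  have hJ : Nonempty J := ⟨j₀⟩
  let Γ : InformedGame K I J C D :=
    { g := g
      q := q
      jhat := jhat
      dhat := dhat
      absorbing := absorbK
      gk := fun k => g k i₀ j₀
      q_nonneg := hq0
      q_sum := hq1
      jhat_eq := fun k i j s hs =>
        (eq_zero_of_sum_ite_eq (hq0 k i j) (hq1 k i j) (hsig k i j) s hs).2
      dhat_eq := fun k i j => eq_zero_of_sum_ite_eq (hq0 k i j) (hq1 k i j) (hinf k i j)
      g_active := hact
      g_absorbing := fun k hk i j => habsg k hk i j i₀ j₀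
      q_absorbing := fun k hk i j =>
        eq_zero_of_sum_ite_eq (hq0 k i j) (hq1 k i j) (habs k hk i j)
      abs_gk_le := fun k => hg k i₀ j₀ }
  obtain ⟨w, hw⟩ := Γ.exists_uniform_bounds hπ0 hπ1 (eq_zero_of_sum_ite_eq hπ0 hπ1 hπ1inf)
  change ∀ ε > (0 : ℝ), ∃ M ≥ (0 : ℝ),
      (∃ σ : Strat1 C I, ∀ (τ : Strat2 D J) (n : ℕ),
        n * (w - ε) - M ≤ ∑ t ∈ Finset.range n, sPayoff g q π σ τ (t + 1)) ∧
      ∀ σ : Strat1 C I, ∃ τ : Strat2 D J, ∀ n : ℕ,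
        ∑ t ∈ Finset.range n, sPayoff g q π σ τ (t + 1) ≤ n * (w + ε) + M at hw
  have hb : ∀ (σ : Strat1 C I) (τ : Strat2 D J) (t : ℕ), |sPayoff g q π σ τ (t + 1)| ≤ 1 := by
    intro σ τ t
    rw [sPayoff_eq_sum_stagePay]
    exact abs_sum_mul_le hπ0 hπ1 (abs_stagePay_le hg hq0 hq1 t σ τ)
  have havg : ∀ ε > (0 : ℝ), ∃ n₀ : ℕ, 1 ≤ n₀ ∧
      (∃ σ : Strat1 C I, ∀ n ≥ n₀, ∀ τ : Strat2 D J, w - ε ≤ avgPay g q π σ τ n) ∧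
      ∀ σ : Strat1 C I, ∃ τ : Strat2 D J, ∀ n ≥ n₀, avgPay g q π σ τ n ≤ w + ε := by
    intro ε hε
    obtain ⟨M, hM, ⟨σ, hσ⟩, hτ⟩ := hw (ε / 2) (by positivity)
    have hn₀ : ∀ n ≥ ⌈M / (ε / 2)⌉₊ + 1, (0 : ℝ) < n ∧ M ≤ n * (ε / 2) := by
      intro n hn
      have h1 : (1 : ℝ) ≤ n := by exact_mod_cast (by omega : 1 ≤ n)
      have h2 : M / (ε / 2) ≤ n :=
        (Nat.le_ceil _).trans (by exact_mod_cast (by omega : ⌈M / (ε / 2)⌉₊ ≤ n))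
      exact ⟨by linarith, (div_le_iff₀ (by positivity)).1 h2⟩
    refine ⟨⌈M / (ε / 2)⌉₊ + 1, by omega, ⟨σ, fun n hn τ => ?_⟩, fun σ => ?_⟩
    · obtain ⟨h1, h2⟩ := hn₀ n hn
      rw [avgPay_eq, inv_mul_eq_div, le_div_iff₀ h1]
      have := hσ τ n
      linarith
    · obtain ⟨τ, hτ⟩ := hτ σ
      refine ⟨τ, fun n hn => ?_⟩
      obtain ⟨h1, h2⟩ := hn₀ n hn
      rw [avgPay_eq, inv_mul_eq_div, div_le_iff₀ h1]
      have := hτ n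
      linarith
  refine ⟨w, ?_, ?_, fun ε hε => ?_, fun ε hε σ => ?_⟩
  · rw [Metric.tendsto_nhds]
    intro ε hε
    obtain ⟨n₀, hn₀, ⟨σ, hσ⟩, hτ⟩ := havg (ε / 2) (by positivity)
    filter_upwards [eventually_ge_atTop n₀] with n hn
    rw [Real.dist_eq]
    refine lt_of_le_of_lt (abs_maxmin_sub_le (fun σ τ => ?_) ⟨σ, hσ n hn⟩ fun σ => ?_)
      (half_lt_self hε)
    · have h1 : (0 : ℝ) < n := by exact_mod_cast (by omega : 0 < n)
      rw [avgPay_eq, inv_mul_eq_div, abs_div, abs_of_pos h1, div_le_one h1]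
      exact (Finset.abs_sum_le_sum_abs _ _).trans
        ((Finset.sum_le_sum fun t _ => hb σ τ t).trans (by simp))
    · obtain ⟨τ, hτ⟩ := hτ σ
      exact ⟨τ, hτ n hn⟩
  · rw [Metric.tendsto_nhds]
    intro ε hε
    obtain ⟨M, hM, ⟨σ, hσ⟩, hτ⟩ := hw (ε / 4) (by positivity)
    have hsmall : ∀ᶠ lam : ℝ in nhdsWithin 0 (Set.Ioc (0 : ℝ) 1), lam * M < ε / 4 := by
      have h : Tendsto (fun lam : ℝ => lam * M) (nhds 0) (nhds 0) := by
        simpa using (tendsto_id (x := nhds (0 : ℝ))).mul_const M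
      exact nhdsWithin_le_nhds (h.eventually (gt_mem_nhds (by positivity)))
    filter_upwards [hsmall, self_mem_nhdsWithin] with lam hlam hmem
    rw [Real.dist_eq]
    refine lt_of_le_of_lt (abs_maxmin_sub_le (δ := ε / 2) (fun σ τ =>
      abs_tsum_discount_le (hb σ τ) hmem.1 hmem.2) ⟨σ, fun τ => ?_⟩ fun σ => ?_)
      (half_lt_self hε)
    · have := le_tsum_discount (hb σ τ) (hσ τ) hmem.1 hmem.2
      linarith
    · obtain ⟨τ, hτ⟩ := hτ σ
      refine ⟨τ, ?_⟩
      have := tsum_discount_le (hb σ τ) hτ hmem.1 hmem.2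
      linarith
  · obtain ⟨n₀, hn₀, ⟨σ, hσ⟩, -⟩ := havg ε hε
    exact ⟨σ, n₀, hn₀, hσ⟩
  · obtain ⟨n₀, hn₀, -, hτ⟩ := havg ε hε
    obtain ⟨τ, hτ⟩ := hτ σ
    exact ⟨τ, n₀, hn₀, hτ⟩
end
end

section
/- Let Γ = (K, I, J, C, D, g, q) be a finite recursive game with symmetric signals (player 1 is more informed than player 2 and player 2 is more informed than player 1). Then for every initial distribution π ∈ Δ*(K×C×D), the game Γ(π) has a uniform value: the uniform maxmin and the uniform minmax both exist and are equal. -/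
open scoped Classical
open Filter

noncomputable section

namespace PublicGame

section MatrixGame

variable {I J : Type} [Fintype I] [Fintype J]

theorem le_of_guarantees {A : I → J → ℝ} {u v : ℝ} {p : I → ℝ} {y : J → ℝ}
    (hp : p ∈ stdSimplex ℝ I) (hy : y ∈ stdSimplex ℝ J)
    (hu : ∀ j, u ≤ ∑ i, p i * A i j) (hv : ∀ i, ∑ j, y j * A i j ≤ v) : u ≤ v := by
  calc u = ∑ j, y j * u := by rw [← Finset.sum_mul, hy.2, one_mul]
    _ ≤ ∑ j, y j * ∑ i, p i * A i j :=
        Finset.sum_le_sum fun j _ => mul_le_mul_of_nonneg_left (hu j) (hy.1 j)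
    _ = ∑ i, p i * ∑ j, y j * A i j := by
        simp only [Finset.mul_sum]
        rw [Finset.sum_comm]
        exact Finset.sum_congr rfl fun i _ => Finset.sum_congr rfl fun j _ => by ring
    _ ≤ ∑ i, p i * v := Finset.sum_le_sum fun i _ => mul_le_mul_of_nonneg_left (hv i) (hp.1 i)
    _ = v := by rw [← Finset.sum_mul, hp.2, one_mul]

variable [Nonempty I] [Nonempty J]

/-- The minimax theorem for matrix games. -/
theorem exists_matrix_value (A : I → J → ℝ) :
    ∃ v : ℝ, (∃ p ∈ stdSimplex ℝ I, ∀ j, v ≤ ∑ i, p i * A i j) ∧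
      ∃ y ∈ stdSimplex ℝ J, ∀ i, ∑ j, y j * A i j ≤ v := by
  have hne : ∀ (L : Type) [Fintype L] [Nonempty L], (stdSimplex ℝ L).Nonempty := fun L _ _ =>
    ⟨_, single_mem_stdSimplex ℝ (Classical.arbitrary L)⟩
  let f : (J → ℝ) → (I → ℝ) → ℝ := fun y p => ∑ i, ∑ j, p i * y j * A i j
  have hleft : ∀ p, IsLinearMap ℝ fun y => f y p := fun p =>
    ⟨fun y z => by simp only [f, Pi.add_apply, mul_add, add_mul, Finset.sum_add_distrib],
      fun t y => by
        simp only [f, Pi.smul_apply, smul_eq_mul, Finset.mul_sum]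
        exact Finset.sum_congr rfl fun i _ => Finset.sum_congr rfl fun j _ => by ring⟩
  have hright : ∀ y, IsLinearMap ℝ fun p => f y p := fun y =>
    ⟨fun p z => by simp only [f, Pi.add_apply, add_mul, Finset.sum_add_distrib],
      fun t p => by
        simp only [f, Pi.smul_apply, smul_eq_mul, Finset.mul_sum]
        exact Finset.sum_congr rfl fun i _ => Finset.sum_congr rfl fun j _ => by ring⟩
  obtain ⟨y, hy, p, hp, h⟩ := Sion.exists_isSaddlePointOn (f := f)
    (X := stdSimplex ℝ J) (Y := stdSimplex ℝ I) (hne J) (convex_stdSimplex ℝ J)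
    (isCompact_stdSimplex ℝ J)
    (fun p _ => Continuous.lowerSemicontinuous (by fun_prop) |>.lowerSemicontinuousOn _)
    (fun p _ => ((IsLinearMap.mk' _ (hleft p)).convexOn (convex_stdSimplex ℝ J)).quasiconvexOn)
    (convex_stdSimplex ℝ I) (hne I) (isCompact_stdSimplex ℝ I)
    (fun y _ => Continuous.upperSemicontinuous (by fun_prop) |>.upperSemicontinuousOn _)
    (fun y _ => ((IsLinearMap.mk' _ (hright y)).concaveOn (convex_stdSimplex ℝ I)).quasiconcaveOn)
  refine ⟨f y p, ⟨p, hp, fun j => ?_⟩, y, hy, fun i => ?_⟩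
  · refine (h _ (single_mem_stdSimplex ℝ j) p hp).trans (le_of_eq ?_)
    simp [f, Pi.single_apply]
  · refine le_trans (le_of_eq ?_) (h y hy _ (single_mem_stdSimplex ℝ i))
    simp [f, Pi.single_apply]

/-- The value of a matrix game. -/
def matVal (A : I → J → ℝ) : ℝ := (exists_matrix_value A).choose

theorem matVal_spec (A : I → J → ℝ) :
    (∃ p ∈ stdSimplex ℝ I, ∀ j, matVal A ≤ ∑ i, p i * A i j) ∧
      ∃ y ∈ stdSimplex ℝ J, ∀ i, ∑ j, y j * A i j ≤ matVal A :=
  (exists_matrix_value A).choose_spec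

theorem matVal_le_add {A B : I → J → ℝ} {e : ℝ} (h : ∀ i j, A i j ≤ B i j + e) :
    matVal A ≤ matVal B + e := by
  obtain ⟨⟨p, hp, hpA⟩, -⟩ := matVal_spec A
  obtain ⟨-, y, hy, hyB⟩ := matVal_spec B
  have : matVal A - e ≤ matVal B := by
    refine le_of_guarantees hp hy (fun j => ?_) hyB
    have h1 : ∑ i, p i * A i j ≤ ∑ i, p i * (B i j + e) :=
      Finset.sum_le_sum fun i _ => mul_le_mul_of_nonneg_left (h i j) (hp.1 i)
    simp only [mul_add, Finset.sum_add_distrib, ← Finset.sum_mul, hp.2, one_mul] at h1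
    linarith [hpA j]
  linarith

theorem abs_matVal_sub_le {A B : I → J → ℝ} {e : ℝ} (h : ∀ i j, |A i j - B i j| ≤ e) :
    |matVal A - matVal B| ≤ e := by
  rw [abs_sub_le_iff]
  constructor
  · linarith [matVal_le_add (A := A) (B := B) (e := e) fun i j => by
      linarith [(abs_sub_le_iff.1 (h i j)).1]]
  · linarith [matVal_le_add (A := B) (B := A) (e := e) fun i j => by
      linarith [(abs_sub_le_iff.1 (h i j)).2]]

theorem matVal_smul (A : I → J → ℝ) {t : ℝ} (ht : 0 ≤ t) :
    matVal (fun i j => t * A i j) = t * matVal A := by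
  obtain ⟨⟨p, hp, hpA⟩, y, hy, hyA⟩ := matVal_spec A
  obtain ⟨⟨p', hp', hpB⟩, y', hy', hyB⟩ := matVal_spec fun i j => t * A i j
  apply le_antisymm
  · refine le_of_guarantees hp' hy hpB fun i => ?_
    calc ∑ j, y j * (t * A i j) = t * ∑ j, y j * A i j := by
          rw [Finset.mul_sum]; exact Finset.sum_congr rfl fun j _ => by ring
      _ ≤ _ := mul_le_mul_of_nonneg_left (hyA i) ht
  · refine le_of_guarantees hp hy' (fun j => ?_) hyB
    calc t * matVal A ≤ t * ∑ i, p i * A i j := mul_le_mul_of_nonneg_left (hpA j) ht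
      _ = ∑ i, p i * (t * A i j) := by
          rw [Finset.mul_sum]; exact Finset.sum_congr rfl fun j _ => by ring

end MatrixGame

/-- The `ℓ¹` norm of a vector. -/
def l1 {K : Type} [Fintype K] (x : K → ℝ) : ℝ := ∑ k, |x k|

section L1

variable {K : Type} [Fintype K]

theorem l1_nonneg (x : K → ℝ) : 0 ≤ l1 x := Finset.sum_nonneg fun _ _ => abs_nonneg _

theorem l1_smul (t : ℝ) (x : K → ℝ) : l1 (t • x) = |t| * l1 x := by
  simp [l1, abs_mul, Finset.mul_sum]

theorem continuous_l1 : Continuous (l1 : (K → ℝ) → ℝ) := by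
  unfold l1; fun_prop

end L1

/-- A recursive game with public signals, restricted to its non-absorbed part.
`Q c k k'` is the probability of moving from `k` to `k'` with public signal `c`, when the
actions `a c`, `b c` recorded by the signal are played; `r k i j` is the expected payoff
collected through absorption. -/
structure Game (K I J P : Type) [Fintype K] [Fintype P] where
  Q : P → K → K → ℝ
  r : K → I → J → ℝ
  a : P → I
  b : P → J
  Q_nonneg : ∀ c k k', 0 ≤ Q c k k'
  mass : ∀ k i j, |r k i j| + ∑ c, (if a c = i ∧ b c = j then ∑ k', Q c k k' else 0) ≤ 1

namespace Game

variable {K I J P : Type} [Fintype K] [Fintype P]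

/-- The game with the roles of the players exchanged. -/
def swap (G : Game K I J P) : Game K J I P where
  Q := G.Q
  r k j i := - G.r k i j
  a := G.b
  b := G.a
  Q_nonneg := G.Q_nonneg
  mass k j i := by simpa [and_comm] using G.mass k i j

/-- The unnormalized belief after the public signal `c`. -/
def step (G : Game K I J P) (x : K → ℝ) (c : P) : K → ℝ := fun k' => ∑ k, x k * G.Q c k k'

/-- Expected payoff collected through absorption in one stage. -/
def rew (G : Game K I J P) (x : K → ℝ) (i : I) (j : J) : ℝ := ∑ k, x k * G.r k i j

/-- One-stage matrix game with continuation payoff `F`. -/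
def aux (G : Game K I J P) (F : (K → ℝ) → ℝ) (x : K → ℝ) (i : I) (j : J) : ℝ :=
  G.rew x i j + ∑ c, if G.a c = i ∧ G.b c = j then F (G.step x c) else 0

variable (G : Game K I J P)

theorem aux_swap (F : (K → ℝ) → ℝ) (x : K → ℝ) (i : I) (j : J) :
    G.swap.aux (fun x => - F x) x j i = - G.aux F x i j := by
  simp only [aux, rew, swap, neg_add, ← Finset.sum_neg_distrib, mul_neg, and_comm]
  congr 1
  refine Finset.sum_congr rfl fun c _ => ?_
  split_ifs
  · rfl
  · simp

theorem step_sub (x y : K → ℝ) (c : P) : G.step (x - y) c = G.step x c - G.step y c := by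
  ext k'; simp [step, sub_mul]

theorem step_smul (t : ℝ) (x : K → ℝ) (c : P) : G.step (t • x) c = t • G.step x c := by
  ext k'; simp [step, Finset.mul_sum, mul_assoc]

theorem rew_sub (x y : K → ℝ) (i : I) (j : J) :
    G.rew (x - y) i j = G.rew x i j - G.rew y i j := by
  simp [rew, sub_mul]

theorem rew_smul (t : ℝ) (x : K → ℝ) (i : I) (j : J) :
    G.rew (t • x) i j = t * G.rew x i j := by
  simp [rew, Finset.mul_sum, mul_assoc]

theorem abs_rew_add_le (x : K → ℝ) (i : I) (j : J) :
    |G.rew x i j| + ∑ c, (if G.a c = i ∧ G.b c = j then l1 (G.step x c) else 0) ≤ l1 x := by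
  have h1 : |G.rew x i j| ≤ ∑ k, |x k| * |G.r k i j| :=
    (Finset.abs_sum_le_sum_abs _ _).trans (le_of_eq (by simp [abs_mul]))
  have h2 : ∀ c, l1 (G.step x c) ≤ ∑ k, |x k| * ∑ k', G.Q c k k' := fun c => by
    simp only [l1, step, Finset.mul_sum]
    rw [Finset.sum_comm]
    refine Finset.sum_le_sum fun k _ => (Finset.abs_sum_le_sum_abs _ _).trans (le_of_eq ?_)
    exact Finset.sum_congr rfl fun k' _ => by rw [abs_mul, abs_of_nonneg (G.Q_nonneg _ _ _)]
  have h3 : ∑ c, (if G.a c = i ∧ G.b c = j then l1 (G.step x c) else 0) ≤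
      ∑ k, |x k| * ∑ c, (if G.a c = i ∧ G.b c = j then ∑ k', G.Q c k k' else 0) := by
    simp_rw [Finset.mul_sum Finset.univ (fun c => ite _ _ _)]
    rw [Finset.sum_comm]
    refine Finset.sum_le_sum fun c _ => ?_
    split_ifs
    · exact h2 c
    · simp
  calc _ ≤ ∑ k, |x k| * (|G.r k i j| +
        ∑ c, (if G.a c = i ∧ G.b c = j then ∑ k', G.Q c k k' else 0)) := by
        simp only [mul_add, Finset.sum_add_distrib]; exact add_le_add h1 h3
    _ ≤ ∑ k, |x k| * 1 :=
        Finset.sum_le_sum fun k _ => mul_le_mul_of_nonneg_left (G.mass k i j) (abs_nonneg _)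
    _ = l1 x := by simp [l1]

theorem sum_l1_step_le (x : K → ℝ) (i : I) (j : J) :
    ∑ c, (if G.a c = i ∧ G.b c = j then l1 (G.step x c) else 0) ≤ l1 x := by
  linarith [G.abs_rew_add_le x i j, abs_nonneg (G.rew x i j)]

theorem abs_aux_sub_le {F F' : (K → ℝ) → ℝ} {e : ℝ} (he : 0 ≤ e)
    (h : ∀ x, |F x - F' x| ≤ e * l1 x) (x : K → ℝ) (i : I) (j : J) :
    |G.aux F x i j - G.aux F' x i j| ≤ e * l1 x := by
  simp only [aux, add_sub_add_left_eq_sub, ← Finset.sum_sub_distrib]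
  refine (Finset.abs_sum_le_sum_abs _ _).trans
    (le_trans ?_ (mul_le_mul_of_nonneg_left (G.sum_l1_step_le x i j) he))
  rw [Finset.mul_sum]
  refine Finset.sum_le_sum fun c _ => ?_
  split_ifs
  · exact h _
  · simp

theorem abs_aux_sub_le_l1_sub {F : (K → ℝ) → ℝ} (h : ∀ x y, |F x - F y| ≤ l1 (x - y))
    (x y : K → ℝ) (i : I) (j : J) :
    |G.aux F x i j - G.aux F y i j| ≤ l1 (x - y) := by
  refine le_trans ?_ (G.abs_rew_add_le (x - y) i j)
  have : G.aux F x i j - G.aux F y i j = G.rew (x - y) i j +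
      ∑ c, if G.a c = i ∧ G.b c = j then F (G.step x c) - F (G.step y c) else 0 := by
    simp only [aux, add_sub_add_comm, ← Finset.sum_sub_distrib, rew_sub]
    congr 1
    exact Finset.sum_congr rfl fun c _ => by split_ifs <;> simp
  rw [this]
  refine (abs_add_le _ _).trans (add_le_add le_rfl ((Finset.abs_sum_le_sum_abs _ _).trans ?_))
  refine Finset.sum_le_sum fun c _ => ?_
  split_ifs
  · rw [step_sub]; exact h _ _
  · simp

theorem aux_smul {F : (K → ℝ) → ℝ} (h : ∀ (t : ℝ) x, 0 ≤ t → F (t • x) = t * F x)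
    {t : ℝ} (ht : 0 ≤ t) (x : K → ℝ) (i : I) (j : J) :
    G.aux F (t • x) i j = t * G.aux F x i j := by
  simp only [aux, rew_smul, step_smul, mul_add, Finset.mul_sum, mul_ite, mul_zero, h _ _ ht]

end Game

section UniformLimit

variable {K : Type} [Fintype K]

theorem isCompact_l1_sphere : IsCompact {x : K → ℝ | l1 x = 1} := by
  refine (isCompact_Icc (a := fun _ : K => (-1 : ℝ)) (b := fun _ => 1)).of_isClosed_subset
    (isClosed_eq continuous_l1 continuous_const) fun x hx => ?_
  have h : ∀ k, |x k| ≤ 1 := fun k =>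
    (Finset.single_le_sum (f := fun k => |x k|) (fun _ _ => abs_nonneg _)
      (Finset.mem_univ k)).trans (le_of_eq hx)
  exact ⟨fun k => (abs_le.1 (h k)).1, fun k => (abs_le.1 (h k)).2⟩

/-- A sequence of equi-Lipschitz positively homogeneous functions has a limit point for
uniform convergence on the unit sphere. -/
theorem exists_uniform_limit (W : ℕ → (K → ℝ) → ℝ)
    (hL : ∀ m x y, |W m x - W m y| ≤ l1 (x - y))
    (hS : ∀ m (t : ℝ) x, 0 ≤ t → W m (t • x) = t * W m x) :
    ∃ V : (K → ℝ) → ℝ, (∀ x, |V x| ≤ l1 x) ∧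
      ∀ η > 0, ∀ N : ℕ, ∃ m ≥ N, ∀ x, |W m x - V x| ≤ η * l1 x := by
  have h0 : ∀ m, W m 0 = 0 := fun m => by simpa using hS m 0 0 le_rfl
  have hb : ∀ m x, |W m x| ≤ l1 x := fun m x => by simpa [h0] using hL m x 0
  let U : Ultrafilter ℕ := hyperfilter ℕ
  have hlim : ∀ x, ∃ v, Tendsto (fun m => W m x) U (nhds v) := fun x => by
    obtain ⟨v, -, hv⟩ := (isCompact_Icc (a := -l1 x) (b := l1 x)).ultrafilter_le_nhds
      (U.map fun m => W m x)
      (le_principal_iff.2 (mem_map.2 (Eventually.of_forall fun m => abs_le.1 (hb m x))))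
    exact ⟨v, hv⟩
  choose V hV using hlim
  have hVL : ∀ x y, |V x - V y| ≤ l1 (x - y) := fun x y =>
    le_of_tendsto ((hV x).sub (hV y)).abs (Eventually.of_forall fun m => hL m x y)
  have hVS : ∀ (t : ℝ) x, 0 ≤ t → V (t • x) = t * V x := fun t x ht =>
    tendsto_nhds_unique (hV (t • x)) (by simpa only [hS _ _ _ ht] using (hV x).const_mul t)
  have hV0 : V 0 = 0 := by simpa using hVS 0 0 le_rfl
  refine ⟨V, fun x => by simpa [hV0] using hVL x 0, fun η hη N => ?_⟩
  have hη3 : 0 < η / 3 := by positivity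
  obtain ⟨t, -, ht⟩ := (isCompact_l1_sphere (K := K)).elim_nhds_subcover
    (fun x => {y | l1 (y - x) < η / 3}) fun x _ =>
      (isOpen_lt (continuous_l1.comp (continuous_id.sub continuous_const))
        continuous_const).mem_nhds (by simpa [l1] using hη3)
  have hev : ∀ᶠ m in (U : Filter ℕ), ∀ x ∈ t, |W m x - V x| < η / 3 :=
    (Finset.eventually_all t).2 fun x _ => by
      simpa [Real.dist_eq] using (Metric.tendsto_nhds.1 (hV x)) (η / 3) hη3
  have hN : ∀ᶠ m in (U : Filter ℕ), N ≤ m :=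
    Nat.hyperfilter_le_atTop (eventually_ge_atTop N)
  obtain ⟨m, hm, hmN⟩ := (hev.and hN).exists
  refine ⟨m, hmN, fun x => ?_⟩
  have hsph : ∀ y, l1 y = 1 → |W m y - V y| ≤ η := fun y hy => by
    obtain ⟨z, hz, hyz⟩ := Set.mem_iUnion₂.1 (ht hy)
    have hyz' : l1 (y - z) < η / 3 := hyz
    have h1 := abs_le.1 (hL m y z)
    have h2 := abs_le.1 (hVL y z)
    have h3 := abs_lt.1 (hm z hz)
    rw [abs_le]
    constructor <;> linarith
  rcases (l1_nonneg x).eq_or_lt with hx | hx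
  · have h1 := abs_le.1 (hb m x)
    have h2 : |V x| ≤ l1 x := by simpa [hV0] using hVL x 0
    have h2 := abs_le.1 h2
    rw [abs_le]
    constructor <;> nlinarith
  · have key := hsph ((l1 x)⁻¹ • x) (by
      rw [l1_smul, abs_of_pos (inv_pos.2 hx), inv_mul_cancel₀ hx.ne'])
    rw [hS _ _ _ (inv_pos.2 hx).le, hVS _ _ (inv_pos.2 hx).le, ← mul_sub, abs_mul,
      abs_of_pos (inv_pos.2 hx), inv_mul_le_iff₀ hx] at key
    linarith

end UniformLimit

namespace Game

section Values

variable {K I J P : Type} [Fintype K] [Fintype P] [Fintype I] (G : Game K I J P)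

/-- `V` can be preserved by player 1, and is a limit of functions which player 1 can
increase where they are positive. -/
def Secured (V : (K → ℝ) → ℝ) : Prop :=
  (∀ x, |V x| ≤ l1 x) ∧
  (∀ x, ∃ p ∈ stdSimplex ℝ I, ∀ j, V x ≤ ∑ i, p i * G.aux V x i j) ∧
  ∀ η > 0, ∃ W : (K → ℝ) → ℝ, ∃ lam > 0, (∀ x, |W x - V x| ≤ η * l1 x) ∧
    ∀ x, η * l1 x ≤ W x →
      ∃ p ∈ stdSimplex ℝ I, ∀ j, W x + lam * l1 x ≤ ∑ i, p i * G.aux W x i j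

variable {G} in
theorem secured_of_approx {V : (K → ℝ) → ℝ} (hV : ∀ x, |V x| ≤ l1 x)
    (hfix : ∀ x, ∃ p ∈ stdSimplex ℝ I, ∀ j, V x ≤ ∑ i, p i * G.aux V x i j)
    (happ : ∀ η > 0, ∃ (W : (K → ℝ) → ℝ) (lam : ℝ), 0 < lam ∧ lam ≤ η ∧ lam ≤ 1 / 2 ∧
      (∀ x, |W x - V x| ≤ η * l1 x) ∧ ∀ x, ∃ p ∈ stdSimplex ℝ I, ∀ j,
        W x - lam ^ 2 * l1 x ≤ (1 - lam) * ∑ i, p i * G.aux W x i j) :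
    G.Secured V := by
  refine ⟨hV, hfix, fun η hη => ?_⟩
  obtain ⟨W, lam, h0, h1, h2, hWV, hW⟩ := happ (min (η / 4) 1) (by positivity)
  have h3 : lam ≤ η / 4 := h1.trans (min_le_left _ _)
  refine ⟨W, lam * (η / 2), by positivity, fun x => (hWV x).trans
    (mul_le_mul_of_nonneg_right ((min_le_left _ _).trans (by linarith)) (l1_nonneg x)),
    fun x hx => ?_⟩
  obtain ⟨p, hp, hpW⟩ := hW x
  refine ⟨p, hp, fun j => ?_⟩
  have h := hpW j
  set S := ∑ i, p i * G.aux W x i j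
  have hx0 := l1_nonneg x
  set L := l1 x
  have hlL : lam * L ≤ η / 4 * L := mul_le_mul_of_nonneg_right h3 hx0
  have hl2 : lam ^ 2 * L ≤ lam * (η / 4 * L) := by nlinarith
  have hA : (1 + lam) * (W x - lam ^ 2 * L) ≤ (1 + lam) * ((1 - lam) * S) :=
    mul_le_mul_of_nonneg_left h (by linarith)
  have hS : 0 ≤ S := by
    have hF : lam * (η * L) ≤ 1 / 2 * (η * L) := mul_le_mul_of_nonneg_right h2 (by positivity)
    have hG : 0 ≤ η * L := by positivity
    have : 0 ≤ (1 - lam) * S := by linarith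
    exact nonneg_of_mul_nonneg_right this (by linarith)
  have hB : (1 + lam) * ((1 - lam) * S) ≤ S := by nlinarith [mul_nonneg (sq_nonneg lam) hS]
  have hC : lam * (η * L) ≤ lam * W x := mul_le_mul_of_nonneg_left hx h0.le
  have hD : lam * (lam ^ 2 * L) ≤ 1 / 2 * (lam ^ 2 * L) :=
    mul_le_mul_of_nonneg_right h2 (by positivity)
  have hE : 0 ≤ lam * (η * L) := by positivity
  nlinarith

variable [Fintype J] [Nonempty I] [Nonempty J]

/-- Iterates of the discounted Shapley operator. -/
def iter (lam : ℝ) : ℕ → (K → ℝ) → ℝ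
  | 0 => fun _ => 0
  | n + 1 => fun x => (1 - lam) * matVal (G.aux (iter lam n) x)

theorem abs_iter_sub_le {lam : ℝ} (h0 : 0 ≤ lam) (h1 : lam ≤ 1) (n : ℕ) (x y : K → ℝ) :
    |G.iter lam n x - G.iter lam n y| ≤ l1 (x - y) := by
  induction n generalizing x y with
  | zero => simpa [iter] using l1_nonneg (x - y)
  | succ n ih =>
    simp only [iter, ← mul_sub, abs_mul, abs_of_nonneg (sub_nonneg.2 h1)]
    have := abs_matVal_sub_le fun i j => G.abs_aux_sub_le_l1_sub ih x y i j
    nlinarith [abs_nonneg (matVal (G.aux (G.iter lam n) x) - matVal (G.aux (G.iter lam n) y))]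

theorem iter_smul (lam : ℝ) (n : ℕ) (t : ℝ) (x : K → ℝ) (ht : 0 ≤ t) :
    G.iter lam n (t • x) = t * G.iter lam n x := by
  induction n generalizing t x with
  | zero => simp [iter]
  | succ n ih =>
    have : G.aux (G.iter lam n) (t • x) = fun i j => t * G.aux (G.iter lam n) x i j := by
      ext i j
      exact G.aux_smul (fun t x ht => ih t x ht) ht x i j
    simp only [iter, this, matVal_smul _ ht]
    ring

theorem abs_iter_le {lam : ℝ} (h0 : 0 ≤ lam) (h1 : lam ≤ 1) (n : ℕ) (x : K → ℝ) :
    |G.iter lam n x| ≤ l1 x := by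
  have h : G.iter lam n 0 = 0 := by simpa using G.iter_smul lam n 0 0 le_rfl
  simpa [h] using G.abs_iter_sub_le h0 h1 n x 0

theorem abs_iter_succ_sub_le {lam : ℝ} (h0 : 0 ≤ lam) (h1 : lam ≤ 1) (n : ℕ) (x : K → ℝ) :
    |G.iter lam (n + 1) x - G.iter lam n x| ≤ (1 - lam) ^ n * l1 x := by
  induction n generalizing x with
  | zero => simpa [iter] using G.abs_iter_le h0 h1 1 x
  | succ n ih =>
    have hl : 0 ≤ 1 - lam := sub_nonneg.2 h1
    have := abs_matVal_sub_le fun i j => G.abs_aux_sub_le (pow_nonneg hl n) ih x i j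
    rw [iter, iter, ← mul_sub, abs_mul, abs_of_nonneg hl, pow_succ', mul_assoc]
    exact mul_le_mul_of_nonneg_left this hl

/-- A limit of approximate discounted values for vanishing discount factors. -/
theorem exists_limit_value : ∃ V : (K → ℝ) → ℝ, (∀ x, |V x| ≤ l1 x) ∧
    ∀ η > 0, ∃ (W : (K → ℝ) → ℝ) (lam : ℝ), 0 < lam ∧ lam ≤ η ∧ lam ≤ 1 / 2 ∧
      (∀ x, |W x| ≤ l1 x) ∧ (∀ x, |W x - V x| ≤ η * l1 x) ∧
      ∀ x, |(1 - lam) * matVal (G.aux W x) - W x| ≤ lam ^ 2 * l1 x := by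
  let lam : ℕ → ℝ := fun m => 1 / ((m : ℝ) + 2)
  have hpos : ∀ m, 0 < lam m := fun m => by positivity
  have hhalf : ∀ m, lam m ≤ 1 / 2 := fun m =>
    one_div_le_one_div_of_le (by norm_num) (by linarith [(Nat.cast_nonneg m : (0 : ℝ) ≤ m)])
  have hone : ∀ m, lam m ≤ 1 := fun m => (hhalf m).trans (by norm_num)
  have hn : ∀ m, ∃ n : ℕ, (1 - lam m) ^ n < lam m ^ 2 := fun m =>
    exists_pow_lt_of_lt_one (by have := hpos m; positivity) (by linarith [hpos m])
  choose n hn using hn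
  obtain ⟨V, hV, hlim⟩ := exists_uniform_limit (fun m => G.iter (lam m) (n m))
    (fun m => G.abs_iter_sub_le (hpos m).le (hone m) (n m))
    (fun m t x ht => G.iter_smul (lam m) (n m) t x ht)
  refine ⟨V, hV, fun η hη => ?_⟩
  obtain ⟨N, hN⟩ := exists_nat_gt (1 / η)
  obtain ⟨m, hm, hmV⟩ := hlim η hη N
  refine ⟨_, lam m, hpos m, ?_, hhalf m, G.abs_iter_le (hpos m).le (hone m) (n m), hmV,
    fun x => ?_⟩
  · have hmN : (N : ℝ) ≤ m := by exact_mod_cast hm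
    rw [div_le_iff₀ (by positivity)]
    rw [div_lt_iff₀ hη] at hN
    nlinarith
  · exact (G.abs_iter_succ_sub_le (hpos m).le (hone m) (n m) x).trans
      (mul_le_mul_of_nonneg_right (hn m).le (l1_nonneg x))

/-- A function which is secured by both players. -/
theorem exists_secured : ∃ V : (K → ℝ) → ℝ, G.Secured V ∧ G.swap.Secured fun x => - V x := by
  obtain ⟨V, hV, happ⟩ := G.exists_limit_value
  have hfix : ∀ x, V x = matVal (G.aux V x) := fun x => by
    refine eq_of_abs_sub_le_all fun e he => ?_
    have hx := l1_nonneg x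
    obtain ⟨W, lam, h0, h1, h2, hW, hWV, hWB⟩ := happ (e / (8 * (l1 x + 1))) (by positivity)
    set η := e / (8 * (l1 x + 1)) with hη
    have hηx : η * (8 * (l1 x + 1)) = e := by rw [hη]; field_simp
    have hη0 : 0 < η := h0.trans_le h1
    have e1 := abs_le.1 (hWV x)
    have e2 := abs_le.1 (abs_matVal_sub_le fun i j => G.abs_aux_sub_le hη0.le hWV x i j)
    have e3 := abs_le.1 (hWB x)
    have hl2 : lam ^ 2 * l1 x ≤ 1 / 2 * (lam * l1 x) := by
      rw [sq, mul_assoc]; exact mul_le_mul_of_nonneg_right h2 (by positivity)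
    have hl1 : lam * l1 x ≤ 1 / 2 * l1 x := mul_le_mul_of_nonneg_right h2 hx
    set M := matVal (G.aux W x)
    have e4 : |M| ≤ 3 * l1 x := by
      have h5 : |(1 - lam) * M| ≤ 5 / 4 * l1 x := by
        have := abs_le.1 (hW x)
        rw [abs_le]
        constructor <;> linarith
      rw [abs_mul, abs_of_nonneg (by linarith)] at h5
      have := mul_le_mul_of_nonneg_right (show 1 / 2 ≤ 1 - lam by linarith) (abs_nonneg M)
      linarith
    have e5 : |lam * M| ≤ 3 * (lam * l1 x) := by
      rw [abs_mul, abs_of_pos h0]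
      linarith [mul_le_mul_of_nonneg_left e4 h0.le]
    have e5 := abs_le.1 e5
    have hlL : lam * l1 x ≤ η * l1 x := mul_le_mul_of_nonneg_right h1 hx
    rw [abs_le]
    constructor <;> linarith
  refine ⟨V, secured_of_approx hV (fun x => ?_) fun η hη => ?_,
    secured_of_approx (by simpa using hV) (fun x => ?_) fun η hη => ?_⟩
  · obtain ⟨p, hp, h⟩ := (matVal_spec (G.aux V x)).1
    exact ⟨p, hp, fun j => (hfix x).le.trans (h j)⟩
  · obtain ⟨W, lam, h0, h1, h2, hW, hWV, hWB⟩ := happ η hη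
    refine ⟨W, lam, h0, h1, h2, hWV, fun x => ?_⟩
    obtain ⟨p, hp, h⟩ := (matVal_spec (G.aux W x)).1
    refine ⟨p, hp, fun j => ?_⟩
    have := mul_le_mul_of_nonneg_left (h j) (by linarith : 0 ≤ 1 - lam)
    linarith [(abs_le.1 (hWB x)).1]
  · obtain ⟨p, hp, h⟩ := (matVal_spec (G.aux V x)).2
    refine ⟨p, hp, fun i => ?_⟩
    simp only [aux_swap, mul_neg, Finset.sum_neg_distrib]
    exact neg_le_neg ((h i).trans (hfix x).ge)
  · obtain ⟨W, lam, h0, h1, h2, hW, hWV, hWB⟩ := happ η hη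
    refine ⟨fun x => - W x, lam, h0, h1, h2, fun x => ?_, fun x => ?_⟩
    · rw [neg_sub_neg, abs_sub_comm]; exact hWV x
    obtain ⟨p, hp, h⟩ := (matVal_spec (G.aux W x)).2
    refine ⟨p, hp, fun i => ?_⟩
    simp only [aux_swap, mul_neg, Finset.sum_neg_distrib]
    have := mul_le_mul_of_nonneg_left (h i) (by linarith : 0 ≤ 1 - lam)
    linarith [(abs_le.1 (hWB x)).2]

end Values

end Game

namespace Game

variable {K I J P : Type} [Fintype K] [Fintype P]

theorem le_aux_affine (G : Game K I J P) {α β : ℝ} (hα : 1 ≤ α) (hβ : α - 1 ≤ β)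
    (F : (K → ℝ) → ℝ) (x : K → ℝ) (i : I) (j : J) :
    α * G.aux F x i j - β * l1 x ≤ G.aux (fun y => α * F y - β * l1 y) x i j := by
  have h := G.abs_rew_add_le x i j
  have hr := le_abs_self (G.rew x i j)
  have hS : 0 ≤ ∑ c, (if G.a c = i ∧ G.b c = j then l1 (G.step x c) else 0) :=
    Finset.sum_nonneg fun c _ => by split_ifs <;> simp [l1_nonneg]
  have heq : G.aux (fun y => α * F y - β * l1 y) x i j = α * G.aux F x i j -
      (α - 1) * G.rew x i j -
      β * ∑ c, (if G.a c = i ∧ G.b c = j then l1 (G.step x c) else 0) := by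
    have : ∑ c, (if G.a c = i ∧ G.b c = j then
        α * F (G.step x c) - β * l1 (G.step x c) else 0) =
        α * ∑ c, (if G.a c = i ∧ G.b c = j then F (G.step x c) else 0) -
        β * ∑ c, (if G.a c = i ∧ G.b c = j then l1 (G.step x c) else 0) := by
      rw [Finset.mul_sum, Finset.mul_sum, ← Finset.sum_sub_distrib]
      exact Finset.sum_congr rfl fun c _ => by split_ifs <;> simp
    simp only [aux, this]
    ring
  rw [heq]
  set S := ∑ c, (if G.a c = i ∧ G.b c = j then l1 (G.step x c) else 0)
  have h1 : (α - 1) * G.rew x i j ≤ (α - 1) * (l1 x - S) :=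
    mul_le_mul_of_nonneg_left (by linarith) (by linarith)
  have h2 : 0 ≤ l1 x - S := by linarith [abs_nonneg (G.rew x i j)]
  have h3 : (α - 1) * (l1 x - S) ≤ β * (l1 x - S) := mul_le_mul_of_nonneg_right hβ h2
  linarith

variable [Fintype I]

theorem le_sum_aux_affine (G : Game K I J P) {α β e : ℝ} (hα : 1 ≤ α) (hβ : α - 1 ≤ β)
    {F : (K → ℝ) → ℝ} {x : K → ℝ} {p : I → ℝ} {j : J} (hp : p ∈ stdSimplex ℝ I)
    (h : e ≤ ∑ i, p i * G.aux F x i j) :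
    α * e - β * l1 x ≤ ∑ i, p i * G.aux (fun y => α * F y - β * l1 y) x i j := by
  calc α * e - β * l1 x ≤ α * (∑ i, p i * G.aux F x i j) - β * l1 x := by
        gcongr
    _ = ∑ i, p i * (α * G.aux F x i j - β * l1 x) := by
        simp only [mul_sub, Finset.sum_sub_distrib, ← Finset.sum_mul, hp.2, one_mul]
        rw [Finset.mul_sum]
        congr 1
        exact Finset.sum_congr rfl fun i _ => by ring
    _ ≤ _ := Finset.sum_le_sum fun i _ =>
        mul_le_mul_of_nonneg_left (G.le_aux_affine hα hβ F x i j) (hp.1 i)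

/-- A two-mode potential: in mode `true` player 1 increases a discounted value, in mode
`false` he preserves the limit value. -/
theorem Secured.exists_potential {G : Game K I J P} {V : (K → ℝ) → ℝ} (hV : G.Secured V)
    {ε : ℝ} (hε : 0 < ε) (hε1 : ε ≤ 1) :
    ∃ (Φ : Bool → (K → ℝ) → ℝ) (upd : Bool → (K → ℝ) → Bool) (p : Bool → (K → ℝ) → I → ℝ)
      (δ : ℝ), 0 < δ ∧ (∀ μ x, p μ x ∈ stdSimplex ℝ I) ∧
      (∀ μ x, Φ μ x ≤ Φ (upd μ x) x) ∧
      (∀ μ x j, Φ (upd μ x) x ≤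
        ∑ i, p (upd μ x) x i * G.aux (Φ (upd μ x)) x i j) ∧
      (∀ μ x j, Φ (upd μ x) x + δ * (Φ (upd μ x) x - ε * l1 x) ≤
        ∑ i, p (upd μ x) x i * G.aux (Φ (upd μ x)) x i j) ∧
      (∀ x, V x - ε * l1 x ≤ Φ false x) ∧ ∀ μ x, Φ μ x ≤ 4 * l1 x := by
  obtain ⟨hVb, hfix, happ⟩ := hV
  obtain ⟨W, lam, hlam, hWV, hW⟩ := happ (ε ^ 2 / 6) (by positivity)
  choose pB hpB hB using hfix
  have hA' : ∀ x, ∃ p ∈ stdSimplex ℝ I, ε ^ 2 / 6 * l1 x ≤ W x →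
      ∀ j, W x + lam * l1 x ≤ ∑ i, p i * G.aux W x i j := fun x => by
    by_cases hx : ε ^ 2 / 6 * l1 x ≤ W x
    · obtain ⟨p, hp, h⟩ := hW x hx
      exact ⟨p, hp, fun _ => h⟩
    · exact ⟨pB x, hpB x, fun h => absurd h hx⟩
  choose pA hpA hA using hA'
  have hη : ε ^ 2 / 6 ≤ ε / 6 := by nlinarith
  have hη1 : ε ^ 2 / 6 ≤ 1 := by nlinarith
  set η := ε ^ 2 / 6 with hηd
  have hη0 : 0 < η := by positivity
  have hηx : ∀ x : K → ℝ, η * l1 x ≤ ε / 6 * l1 x := fun x =>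
    mul_le_mul_of_nonneg_right hη (l1_nonneg x)
  have hWV' := fun x => abs_le.1 (hWV x)
  let β : ℝ := ε ^ 2 / 2 + η + ε
  have hβ : 0 ≤ β := by positivity
  let Φ : Bool → (K → ℝ) → ℝ := fun μ x =>
    bif μ then (1 + ε) * W x - β * l1 x else 1 * V x - ε * l1 x
  let upd : Bool → (K → ℝ) → Bool := fun μ x =>
    bif μ then decide (ε / 2 * l1 x ≤ W x) else decide (ε * l1 x < V x)
  have htrue : ∀ μ x, upd μ x = true → ε / 2 * l1 x ≤ W x := fun μ x h => by
    have hx := l1_nonneg x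
    cases μ
    · have h : ε * l1 x < V x := by simpa [upd] using h
      nlinarith [hWV' x, hηx x]
    · simpa [upd] using h
  have hfalse : ∀ μ x, upd μ x = false → V x ≤ ε * l1 x := fun μ x h => by
    have hx := l1_nonneg x
    cases μ
    · simpa [upd] using h
    · have h : W x < ε / 2 * l1 x := by simpa [upd] using h
      nlinarith [hWV' x, hηx x]
  have hstepA : ∀ x j, ε / 2 * l1 x ≤ W x →
      Φ true x + lam * l1 x ≤ ∑ i, pA x i * G.aux (Φ true) x i j := fun x j hx => by
    have hx0 := l1_nonneg x
    have h := G.le_sum_aux_affine (α := 1 + ε) (β := β) (by linarith)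
      (by simp only [β]; nlinarith) (hpA x) (hA x (by nlinarith [hηx x]) j)
    refine le_trans ?_ h
    simp only [Φ, cond_true]
    nlinarith [mul_nonneg hε.le (mul_nonneg hlam.le hx0)]
  have hstepB : ∀ x j, Φ false x ≤ ∑ i, pB x i * G.aux (Φ false) x i j := fun x j =>
    G.le_sum_aux_affine le_rfl (by linarith) (hpB x) (hB x j)
  have hWb : ∀ x, W x ≤ 2 * l1 x := fun x => by
    have := (abs_le.1 (hVb x)).2
    nlinarith [hWV' x, l1_nonneg x]
  have hΦA : ∀ x, Φ true x ≤ 4 * l1 x := fun x => by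
    have hx0 := l1_nonneg x
    simp only [Φ, cond_true]
    nlinarith [hWb x, mul_nonneg hβ hx0, mul_nonneg hε.le hx0,
      mul_le_mul_of_nonneg_left (hWb x) hε.le]
  refine ⟨Φ, upd, fun μ x => bif μ then pA x else pB x, lam / 4, by positivity, fun μ x => ?_,
    fun μ x => ?_, fun μ x j => ?_, fun μ x j => ?_, fun x => ?_, fun μ x => ?_⟩
  · cases μ
    · exact hpB x
    · exact hpA x
  · have hx0 := l1_nonneg x
    cases μ <;> cases hu : upd _ x
    · exact le_rfl
    · have h : ε * l1 x < V x := by simpa [upd] using hu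
      simp only [Φ, cond_true, cond_false, β]
      have h1 := mul_le_mul_of_nonneg_left (hWV' x).1 (by linarith : 0 ≤ 1 + ε)
      have h2 := mul_lt_mul_of_pos_left h hε
      have h3 : ε * (η * l1 x) ≤ 1 * (η * l1 x) :=
        mul_le_mul_of_nonneg_right hε1 (by positivity)
      have h4 : η * l1 x = ε ^ 2 * l1 x / 6 := by rw [hηd]; ring
      nlinarith
    · have h : W x < ε / 2 * l1 x := by simpa [upd] using hu
      simp only [Φ, cond_true, cond_false, β]
      have h2 := mul_lt_mul_of_pos_left h hε
      nlinarith [hWV' x]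
    · exact le_rfl
  · cases hu : upd μ x
    · exact hstepB x j
    · have := mul_nonneg hlam.le (l1_nonneg x)
      exact le_trans (by linarith) (hstepA x j (htrue μ x hu))
  · cases hu : upd μ x
    · refine le_trans ?_ (hstepB x j)
      have h := hfalse μ x hu
      have : Φ false x - ε * l1 x ≤ 0 := by
        simp only [Φ, cond_false]
        linarith [mul_nonneg hε.le (l1_nonneg x)]
      nlinarith
    · refine le_trans ?_ (hstepA x j (htrue μ x hu))
      have : lam / 4 * (Φ true x - ε * l1 x) ≤ lam / 4 * (4 * l1 x) :=
        mul_le_mul_of_nonneg_left (by linarith [hΦA x, mul_nonneg hε.le (l1_nonneg x)])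
          (by positivity)
      linarith
  · simp [Φ]
  · cases μ
    · have := (abs_le.1 (hVb x)).2
      simp only [Φ, cond_false]
      linarith [mul_nonneg hε.le (l1_nonneg x), l1_nonneg x]
    · exact hΦA x

end Game

namespace Game

variable {K I J P : Type} [Fintype K] [Fintype P]

/-- Unnormalized belief after a public history (in reverse order) and the current signal. -/
def bel (G : Game K I J P) (x₀ : P → K → ℝ) : List P → P → K → ℝ
  | [], c => x₀ c
  | c₀ :: h, c => G.step (G.bel x₀ h c₀) c

/-- Sum of `f` over public histories of a given length, weighted by the probabilities with
which the players choose the recorded actions. -/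
def pubE (G : Game K I J P) (ρ : List P → P → I → ℝ) (θ : List P → P → J → ℝ) :
    ℕ → (List P → P → ℝ) → ℝ
  | 0, f => ∑ c, f [] c
  | t + 1, f => G.pubE ρ θ t fun h c =>
      ∑ c', ρ h c (G.a c') * θ h c (G.b c') * f (c :: h) c'

theorem pubE_swap (G : Game K I J P) (ρ : List P → P → I → ℝ) (θ : List P → P → J → ℝ) (t : ℕ)
    (f : List P → P → ℝ) : G.swap.pubE θ ρ t f = G.pubE ρ θ t f := by
  induction t generalizing f with
  | zero => rfl
  | succ t ih =>
    rw [pubE, ih, pubE]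
    congr 1
    ext h c
    exact Finset.sum_congr rfl fun c' _ => by rw [mul_comm (θ _ _ _)]; rfl

theorem bel_swap {G : Game K I J P} (x₀ : P → K → ℝ) (h : List P) (c : P) :
    G.swap.bel x₀ h c = G.bel x₀ h c := by
  induction h generalizing c with
  | nil => rfl
  | cons c₀ h ih => rw [bel, ih, bel]; rfl

section

variable (G : Game K I J P) (ρ : List P → P → I → ℝ) (θ : List P → P → J → ℝ)

theorem pubE_add (t : ℕ) (f f' : List P → P → ℝ) :
    G.pubE ρ θ t (fun h c => f h c + f' h c) = G.pubE ρ θ t f + G.pubE ρ θ t f' := by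
  induction t generalizing f f' with
  | zero => simp [pubE, Finset.sum_add_distrib]
  | succ t ih => simp only [pubE, mul_add, Finset.sum_add_distrib, ih]

theorem pubE_mul (t : ℕ) (e : ℝ) (f : List P → P → ℝ) :
    G.pubE ρ θ t (fun h c => e * f h c) = e * G.pubE ρ θ t f := by
  induction t generalizing f with
  | zero => simp [pubE, Finset.mul_sum]
  | succ t ih =>
    simp only [pubE, ← ih, Finset.mul_sum]
    congr 1
    ext h c
    exact Finset.sum_congr rfl fun c' _ => by ring

theorem pubE_mono [Fintype I] [Fintype J] (hρ : ∀ h c, ρ h c ∈ stdSimplex ℝ I)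
    (hθ : ∀ h c, θ h c ∈ stdSimplex ℝ J) (t : ℕ) {f f' : List P → P → ℝ}
    (hf : ∀ h c, f h c ≤ f' h c) : G.pubE ρ θ t f ≤ G.pubE ρ θ t f' := by
  induction t generalizing f f' with
  | zero => exact Finset.sum_le_sum fun c _ => hf [] c
  | succ t ih =>
    exact ih fun h c => Finset.sum_le_sum fun c' _ =>
      mul_le_mul_of_nonneg_left (hf _ _) (mul_nonneg ((hρ h c).1 _) ((hθ h c).1 _))

variable [Fintype I] [Fintype J]

/-- Expected payoff collected through absorption after a public history. -/
def pubRew (x₀ : P → K → ℝ) (h : List P) (c : P) : ℝ :=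
  ∑ i, ∑ j, ρ h c i * θ h c j * G.rew (G.bel x₀ h c) i j

theorem one_stage (p : I → ℝ) (y : J → ℝ) (x : K → ℝ) (F : (K → ℝ) → ℝ) :
    ∑ j, y j * ∑ i, p i * G.aux F x i j =
      (∑ c, p (G.a c) * y (G.b c) * F (G.step x c)) + ∑ i, ∑ j, p i * y j * G.rew x i j := by
  have h1 : ∑ c, p (G.a c) * y (G.b c) * F (G.step x c) =
      ∑ i, ∑ j, ∑ c, if G.a c = i ∧ G.b c = j then p i * y j * F (G.step x c) else 0 := by
    rw [Finset.sum_congr rfl fun i _ => Finset.sum_comm, Finset.sum_comm]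
    refine Finset.sum_congr rfl fun c _ => ?_
    simp [ite_and]
  rw [h1, ← Finset.sum_add_distrib]
  simp only [Finset.mul_sum]
  rw [Finset.sum_comm]
  refine Finset.sum_congr rfl fun i _ => ?_
  rw [← Finset.sum_add_distrib]
  refine Finset.sum_congr rfl fun j _ => ?_
  rw [aux, mul_add, mul_add, Finset.mul_sum, Finset.mul_sum, add_comm]
  congr 1
  · exact Finset.sum_congr rfl fun c _ => by split_ifs <;> ring
  · ring

end

section

variable [Fintype I] [Fintype J] {G : Game K I J P}

theorem pubRew_swap (ρ : List P → P → I → ℝ) (θ : List P → P → J → ℝ) (x₀ : P → K → ℝ)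
    (h : List P) (c : P) : G.swap.pubRew θ ρ x₀ h c = -1 * G.pubRew ρ θ x₀ h c := by
  simp only [pubRew, bel_swap, Finset.mul_sum]
  rw [Finset.sum_comm]
  refine Finset.sum_congr rfl fun i _ => Finset.sum_congr rfl fun j _ => ?_
  simp only [rew, swap, mul_neg, Finset.sum_neg_distrib]
  ring

theorem pubE_l1_le (ρ : List P → P → I → ℝ) (θ : List P → P → J → ℝ)
    (hρ : ∀ h c, ρ h c ∈ stdSimplex ℝ I) (hθ : ∀ h c, θ h c ∈ stdSimplex ℝ J)
    (x₀ : P → K → ℝ) (t : ℕ) :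
    G.pubE ρ θ (t + 1) (fun h c => l1 (G.bel x₀ h c)) +
      |G.pubE ρ θ t (G.pubRew ρ θ x₀)| ≤ G.pubE ρ θ t (fun h c => l1 (G.bel x₀ h c)) := by
  have key : ∀ s : ℝ, |s| = 1 → G.pubE ρ θ (t + 1) (fun h c => l1 (G.bel x₀ h c)) +
      s * G.pubE ρ θ t (G.pubRew ρ θ x₀) ≤ G.pubE ρ θ t (fun h c => l1 (G.bel x₀ h c)) := by
    intro s hs
    rw [pubE, ← pubE_mul, ← pubE_add]
    refine G.pubE_mono ρ θ hρ hθ t fun h c => ?_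
    have h0 := G.one_stage (ρ h c) (θ h c) (G.bel x₀ h c) fun _ => 0
    have h1 := G.one_stage (ρ h c) (θ h c) (G.bel x₀ h c) l1
    have h2 : ∑ j, θ h c j * ∑ i, ρ h c i * (G.aux l1 (G.bel x₀ h c) i j +
        (s - 1) * G.aux (fun _ => 0) (G.bel x₀ h c) i j) ≤
        ∑ j, θ h c j * ∑ i, ρ h c i * l1 (G.bel x₀ h c) := by
      refine Finset.sum_le_sum fun j _ => mul_le_mul_of_nonneg_left
        (Finset.sum_le_sum fun i _ => mul_le_mul_of_nonneg_left ?_ ((hρ h c).1 i))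
        ((hθ h c).1 j)
      refine le_trans ?_ (G.abs_rew_add_le (G.bel x₀ h c) i j)
      have h3 : s * G.rew (G.bel x₀ h c) i j ≤ |G.rew (G.bel x₀ h c) i j| := by
        refine (le_abs_self _).trans ?_
        rw [abs_mul, hs, one_mul]
      simp only [aux, ite_self, Finset.sum_const_zero, add_zero]
      linarith
    simp only [mul_add, Finset.sum_add_distrib, ← Finset.sum_mul, (hρ h c).2, (hθ h c).2,
      one_mul] at h2
    have h4 : ∑ j, θ h c j * ∑ i, ρ h c i * ((s - 1) * G.aux (fun _ => 0) (G.bel x₀ h c) i j) =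
        (s - 1) * ∑ j, θ h c j * ∑ i, ρ h c i * G.aux (fun _ => 0) (G.bel x₀ h c) i j := by
      simp only [Finset.mul_sum]
      exact Finset.sum_congr rfl fun j _ => Finset.sum_congr rfl fun i _ => by ring
    rw [h4, h0, h1] at h2
    simp only [mul_zero, Finset.sum_const_zero, zero_add] at h2
    simp only [bel, pubRew]
    linarith
  rcases abs_cases (G.pubE ρ θ t (G.pubRew ρ θ x₀)) with h | h
  · linarith [key 1 (by simp)]
  · linarith [key (-1) (by simp)]

theorem Secured.exists_strategy {V : (K → ℝ) → ℝ} (hV : G.Secured V) {x₀ : P → K → ℝ}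
    (hx₀ : ∑ c, l1 (x₀ c) ≤ 1) {ε : ℝ} (hε : 0 < ε) (hε1 : ε ≤ 1) :
    ∃ ρ : List P → P → I → ℝ, (∀ h c, ρ h c ∈ stdSimplex ℝ I) ∧ ∃ M : ℝ,
      ∀ θ : List P → P → J → ℝ, (∀ h c, θ h c ∈ stdSimplex ℝ J) → ∀ n : ℕ,
        n * (∑ c, V (x₀ c) - 2 * ε) - M ≤
          ∑ t ∈ Finset.range n, ∑ s ∈ Finset.range t, G.pubE ρ θ s (G.pubRew ρ θ x₀) := by
  obtain ⟨Φ, upd, p, δ, hδ, hp, hsw, hΦ, hΦδ, hΦV, hΦb⟩ := hV.exists_potential hε hε1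
  let mode : List P → P → Bool := fun h => List.rec (motive := fun _ => P → Bool)
    (fun c => upd false (x₀ c))
    (fun c₀ h ih c => upd (ih c₀) (G.bel x₀ (c₀ :: h) c)) h
  have hmode : ∀ h c, ∃ μ, mode h c = upd μ (G.bel x₀ h c) := fun h c => by
    cases h
    · exact ⟨_, rfl⟩
    · exact ⟨_, rfl⟩
  have hnext : ∀ h c c', Φ (mode h c) (G.step (G.bel x₀ h c) c') ≤
      Φ (mode (c :: h) c') (G.bel x₀ (c :: h) c') := fun h c c' => hsw _ _
  let ρ : List P → P → I → ℝ := fun h c => p (mode h c) (G.bel x₀ h c)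
  have hρ : ∀ h c, ρ h c ∈ stdSimplex ℝ I := fun h c => hp _ _
  let Y₀ : ℝ := ∑ c, Φ (mode [] c) (x₀ c)
  refine ⟨ρ, hρ, (5 - Y₀) / δ, fun θ hθ n => ?_⟩
  let Y : ℕ → ℝ := fun t => G.pubE ρ θ t fun h c => Φ (mode h c) (G.bel x₀ h c)
  let m : ℕ → ℝ := fun t => G.pubE ρ θ t fun h c => l1 (G.bel x₀ h c)
  let r : ℕ → ℝ := fun t => G.pubE ρ θ t (G.pubRew ρ θ x₀)
  let R : ℕ → ℝ := fun t => ∑ s ∈ Finset.range t, r s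
  have hRs : ∀ t, R (t + 1) = R t + r t := fun t => Finset.sum_range_succ _ _
  have hm : ∀ t, m (t + 1) + |r t| ≤ m t := G.pubE_l1_le ρ θ hρ hθ x₀
  have hm0 : m 0 ≤ 1 := hx₀
  have hm1 : ∀ t, m t ≤ 1 := fun t => by
    induction t with
    | zero => exact hm0
    | succ t ih => linarith [hm t, abs_nonneg (r t)]
  have hRm : ∀ t, R t + m t ≤ 1 := fun t => by
    induction t with
    | zero => simpa [R] using hm0
    | succ t ih => linarith [hm t, le_abs_self (r t), hRs t]
  have hm_nonneg : ∀ t, 0 ≤ m t := fun t => by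
    have h := G.pubE_mono ρ θ hρ hθ t fun h c => l1_nonneg (G.bel x₀ h c)
    have h0 := G.pubE_mul ρ θ t 0 fun _ _ => 0
    simp only [zero_mul] at h0
    linarith
  have hYm : ∀ t, Y t ≤ 4 * m t := fun t => by
    simp only [Y, m, ← pubE_mul]
    exact G.pubE_mono ρ θ hρ hθ t fun h c => hΦb _ _
  have hstage : ∀ (e : List P → P → ℝ), (∀ h c j, e h c ≤
      ∑ i, ρ h c i * G.aux (Φ (mode h c)) (G.bel x₀ h c) i j) → ∀ t,
      G.pubE ρ θ t e ≤ Y (t + 1) + r t := fun e he t => by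
    simp only [Y, r]
    rw [pubE, ← pubE_add]
    refine G.pubE_mono ρ θ hρ hθ t fun h c => ?_
    calc e h c = ∑ j, θ h c j * e h c := by rw [← Finset.sum_mul, (hθ h c).2, one_mul]
      _ ≤ ∑ j, θ h c j * ∑ i, ρ h c i * G.aux (Φ (mode h c)) (G.bel x₀ h c) i j :=
          Finset.sum_le_sum fun j _ => mul_le_mul_of_nonneg_left (he h c j) ((hθ h c).1 j)
      _ = _ := G.one_stage _ _ _ _
      _ ≤ _ := by
          refine add_le_add (Finset.sum_le_sum fun c' _ => ?_) le_rfl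
          exact mul_le_mul_of_nonneg_left (hnext h c c')
            (mul_nonneg ((hρ h c).1 _) ((hθ h c).1 _))
  have hY1 : ∀ t, Y t ≤ Y (t + 1) + r t := hstage _ fun h c j => by
    obtain ⟨μ, hμ⟩ := hmode h c
    simp only [ρ, hμ]
    exact hΦ _ _ _
  have hY2 : ∀ t, Y t + δ * (Y t - ε) ≤ Y (t + 1) + r t := fun t => by
    have h := hstage (fun h c => (1 + δ) * Φ (mode h c) (G.bel x₀ h c) +
      (-(δ * ε)) * l1 (G.bel x₀ h c)) (fun h c j => by
        obtain ⟨μ, hμ⟩ := hmode h c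
        simp only [ρ, hμ]
        linarith [hΦδ μ (G.bel x₀ h c) j]) t
    rw [pubE_add, pubE_mul, pubE_mul] at h
    have h1 : δ * ε * m t ≤ δ * ε * 1 := mul_le_mul_of_nonneg_left (hm1 t) (by positivity)
    simp only [Y, m] at h h1 ⊢
    linarith
  have hmono : ∀ t, Y₀ ≤ R t + Y t := fun t => by
    induction t with
    | zero => simp [R, Y, Y₀, pubE, bel]
    | succ t ih => linarith [hRs t, hY1 t]
  have hmain : n * (Y₀ - ε) - (R n + Y n - Y₀) / δ ≤ ∑ t ∈ Finset.range n, R t := by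
    induction n with
    | zero => simp [R, Y, Y₀, pubE, bel]
    | succ n ih =>
      rw [Finset.sum_range_succ]
      have h1 : Y n - ε ≤ (R (n + 1) + Y (n + 1) - Y₀) / δ - (R n + Y n - Y₀) / δ := by
        rw [← sub_div, le_div_iff₀ hδ]
        linarith [hRs n, hY2 n]
      have h2 := hmono n
      push_cast
      linarith
  have hfin : (R n + Y n - Y₀) / δ ≤ (5 - Y₀) / δ := by
    have : R n + Y n ≤ 5 := by linarith [hRm n, hYm n, hm1 n, hm_nonneg n]
    gcongr
  have hY₀ : ∑ c, V (x₀ c) - ε ≤ Y₀ := by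
    have h1 : ∑ c, (V (x₀ c) - ε * l1 (x₀ c)) ≤ Y₀ :=
      Finset.sum_le_sum fun c _ => (hΦV _).trans (hsw _ _)
    rw [Finset.sum_sub_distrib, ← Finset.mul_sum] at h1
    have := mul_le_mul_of_nonneg_left hx₀ hε.le
    linarith
  have hn : (n : ℝ) * (∑ c, V (x₀ c) - 2 * ε) ≤ n * (Y₀ - ε) :=
    mul_le_mul_of_nonneg_left (by linarith) (Nat.cast_nonneg n)
  calc _ ≤ _ := sub_le_sub hn hfin
    _ ≤ _ := hmain

end

end Game

open SigGame

section Records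

variable {K I J C D : Type} [Fintype K] [Fintype I] [Fintype J] [Fintype C] [Fintype D]

/-- The finite set of lists of length `t`. -/
def listsOf (Z : Type) [Fintype Z] : ℕ → Finset (List Z)
  | 0 => {[]}
  | t + 1 => (Finset.univ ×ˢ listsOf Z t).map
      ⟨fun p => p.1 :: p.2, fun _ _ h => Prod.ext (List.cons.inj h).1 (List.cons.inj h).2⟩

theorem mem_listsOf {Z : Type} [Fintype Z] {t : ℕ} {r : List Z} :
    r ∈ listsOf Z t ↔ r.length = t := by
  induction t generalizing r with
  | zero => simp [listsOf]
  | succ t ih =>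
    cases r with
    | nil => simp [listsOf]
    | cons z r =>
      simp only [listsOf, Finset.mem_map, Finset.mem_product, Finset.mem_univ, true_and, ih,
        List.length_cons, Nat.add_right_cancel_iff, Prod.exists]
      constructor
      · rintro ⟨a, b, hb, h⟩
        rw [← (List.cons.inj h).2, hb]
      · exact fun h => ⟨z, r, h, rfl⟩

variable (q : K → I → J → K × C × D → ℝ) (π : K × C × D → ℝ)
  (σ : Strat1 C I) (τ : Strat2 D J)

/-- Expectation of a function of the record of the first `t` stages (in reverse order). -/
def recE : ℕ → (List (K × C × D × I × J) → K × C × D → ℝ) → ℝ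
  | 0, f => ∑ s, π s * f [] s
  | t + 1, f => recE t fun r s => ∑ i, ∑ j, ∑ s',
      σ.play (p1hist r.reverse) s.2.1 i * τ.play (p2hist r.reverse) s.2.2 j *
        q s.1 i j s' * f ((s.1, s.2.1, s.2.2, i, j) :: r) s'

theorem recE_eq_sum (t : ℕ) (f : List (K × C × D × I × J) → K × C × D → ℝ) :
    recE q π σ τ t f =
      ∑ r ∈ listsOf (K × C × D × I × J) t, ∑ s, recProbAux q π σ τ r s * f r s := by
  induction t generalizing f with
  | zero => simp [recE, listsOf, recProbAux]
  | succ t ih =>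
    rw [recE, ih, listsOf, Finset.sum_map, Finset.sum_product,
      Finset.sum_comm (s := Finset.univ) (t := listsOf (K × C × D × I × J) t)]
    refine Finset.sum_congr rfl fun r _ => ?_
    simp only [Fintype.sum_prod_type, Finset.mul_sum]
    iterate 8 refine Finset.sum_congr rfl fun _ _ => ?_
    simp only [DFunLike.coe, recProbAux]
    ring

theorem sPayoff_succ (g : K → I → J → ℝ) (t : ℕ) :
    sPayoff g q π σ τ (t + 1) = recE q π σ τ t fun r s => ∑ i, ∑ j,
      σ.play (p1hist r.reverse) s.2.1 i * τ.play (p2hist r.reverse) s.2.2 j * g s.1 i j := by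
  let e : List (K × C × D × I × J) × (K × C × D) ≃ List (K × C × D × I × J) × (K × C × D) :=
    (Function.Involutive.toPerm List.reverse List.reverse_involutive).prodCongr (Equiv.refl _)
  rw [sPayoff, ← Equiv.tsum_eq (α := ℝ) e, recE_eq_sum,
    tsum_eq_sum (s := listsOf (K × C × D × I × J) t ×ˢ Finset.univ), Finset.sum_product]
  · refine Finset.sum_congr rfl fun r hr => Finset.sum_congr rfl fun s _ => ?_
    simp [e, mem_listsOf.1 hr, recProb]
  · rintro ⟨r, s⟩ hrs
    have : r.length ≠ t := fun h => hrs (by simp [mem_listsOf, h])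
    simp [e, this]

theorem recE_add (t : ℕ) (f f' : List (K × C × D × I × J) → K × C × D → ℝ) :
    recE q π σ τ t (fun r s => f r s + f' r s) = recE q π σ τ t f + recE q π σ τ t f' := by
  simp only [recE_eq_sum, mul_add, Finset.sum_add_distrib]

end Records

theorem of_sum_ite_eq_one {S : Type} [Fintype S] {w : S → ℝ} (h0 : ∀ s, 0 ≤ w s)
    (h1 : ∑ s, w s = 1) (p : S → Prop) [DecidablePred p]
    (hp : ∑ s, (if p s then w s else 0) = 1) (s : S) (hs : w s ≠ 0) : p s := by
  by_contra hn
  have h : ∑ s, (if p s then w s else 0) < ∑ s, w s :=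
    Finset.sum_lt_sum (fun s _ => by split_ifs <;> simp [h0])
      ⟨s, Finset.mem_univ s, by simpa [hn] using (h0 s).lt_of_ne' hs⟩
  linarith

/-- A recursive game with symmetric signals. -/
structure Model (K I J C D : Type) [Fintype K] [Fintype C] [Fintype D] where
  q : K → I → J → K × C × D → ℝ
  π : K × C × D → ℝ
  ihat : C → I
  jhat : D → J
  absorbK : K → Prop
  dhat : C → D
  chat : D → C
  pay : K → ℝ
  q_nonneg : ∀ k i j s, 0 ≤ q k i j s
  q_sum : ∀ k i j, ∑ s, q k i j s = 1
  q_supp : ∀ k i j s, q k i j s ≠ 0 →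
    (dhat s.2.1 = s.2.2 ∧ chat s.2.2 = s.2.1) ∧ ihat s.2.1 = i ∧ jhat s.2.2 = j
  q_absorb : ∀ k i j s, absorbK k → q k i j s ≠ 0 → s.1 = k
  π_nonneg : ∀ s, 0 ≤ π s
  π_sum : ∑ s, π s = 1
  π_supp : ∀ s, π s ≠ 0 → dhat s.2.1 = s.2.2 ∧ chat s.2.2 = s.2.1
  abs_pay_le : ∀ k, |pay k| ≤ 1
  pay_eq_zero : ∀ k, ¬ absorbK k → pay k = 0

namespace Model

variable {K I J C D : Type} [Fintype K] [Fintype C] [Fintype D] (M : Model K I J C D)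

/-- Public signals: the signals of player 1 that determine and are determined by those of
player 2. -/
abbrev Pub : Type := {c : C // M.chat (M.dhat c) = c}

instance : Nonempty M.Pub := by
  have : ∃ s, M.π s ≠ 0 := by
    by_contra! h
    simpa [h] using M.π_sum
  obtain ⟨s, hs⟩ := this
  exact ⟨⟨s.2.1, by rw [(M.π_supp s hs).1, (M.π_supp s hs).2]⟩⟩

/-- The public signal attached to a signal of player 1. -/
def toPub (c : C) : M.Pub :=
  if h : M.chat (M.dhat c) = c then ⟨c, h⟩ else Classical.arbitrary _

@[simp] theorem toPub_val (c : M.Pub) : M.toPub c.1 = c := by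
  rw [toPub, dif_pos c.2]

theorem val_toPub {s : K × C × D} (h : M.dhat s.2.1 = s.2.2 ∧ M.chat s.2.2 = s.2.1) :
    (M.toPub s.2.1).1 = s.2.1 := by
  rw [toPub, dif_pos (by rw [h.1, h.2])]

theorem sum_eq_sum_pub {w : K × C × D → ℝ}
    (hw : ∀ s, w s ≠ 0 → M.dhat s.2.1 = s.2.2 ∧ M.chat s.2.2 = s.2.1) :
    ∑ s, w s = ∑ c : M.Pub, ∑ k, w (k, c.1, M.dhat c.1) := by
  rw [← Fintype.sum_prod_type' fun (c : M.Pub) k => w (k, c.1, M.dhat c.1)]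
  symm
  refine Finset.sum_of_injOn (fun p => (p.2, p.1.1, M.dhat p.1.1)) ?_ ?_ ?_ ?_
  · rintro ⟨c, k⟩ - ⟨c', k'⟩ - h
    simp only [Prod.mk.injEq] at h
    exact Prod.ext (Subtype.ext h.2.1) h.1
  · exact fun _ _ => Finset.mem_coe.2 (Finset.mem_univ _)
  · intro s _ hs
    by_contra hn
    refine hs ⟨(M.toPub s.2.1, s.1), Finset.mem_coe.2 (Finset.mem_univ _), ?_⟩
    have h := hw s hn
    ext1
    · rfl
    · simp only [M.val_toPub h]
      rw [h.1]
  · exact fun _ _ => rfl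

/-- The underlying game with public signals. -/
def game : Game K I J M.Pub where
  Q c k k' := if M.absorbK k ∨ M.absorbK k' then 0 else
    M.q k (M.ihat c.1) (M.jhat (M.dhat c.1)) (k', c.1, M.dhat c.1)
  r k i j := if M.absorbK k then 0 else ∑ s, M.q k i j s * M.pay s.1
  a c := M.ihat c.1
  b c := M.jhat (M.dhat c.1)
  Q_nonneg c k k' := by split_ifs <;> simp [M.q_nonneg]
  mass k i j := by
    by_cases hk : M.absorbK k
    · simp [hk]
    simp only [hk, false_or, if_false]
    have h1 : |∑ s, M.q k i j s * M.pay s.1| ≤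
        ∑ s, if M.absorbK s.1 then M.q k i j s else 0 := by
      refine (Finset.abs_sum_le_sum_abs _ _).trans (Finset.sum_le_sum fun s _ => ?_)
      rw [abs_mul, abs_of_nonneg (M.q_nonneg _ _ _ _)]
      split_ifs with h
      · exact mul_le_of_le_one_right (M.q_nonneg _ _ _ _) (M.abs_pay_le _)
      · simp [M.pay_eq_zero _ h]
    have h2 : ∑ c : M.Pub, (if M.ihat c.1 = i ∧ M.jhat (M.dhat c.1) = j then
        ∑ k', (if M.absorbK k' then 0 else
          M.q k (M.ihat c.1) (M.jhat (M.dhat c.1)) (k', c.1, M.dhat c.1)) else 0) =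
        ∑ s, if M.absorbK s.1 then 0 else M.q k i j s := by
      rw [M.sum_eq_sum_pub (w := fun s => if M.absorbK s.1 then 0 else M.q k i j s)
        fun s hs => (M.q_supp k i j s fun h => hs (by simp [h])).1]
      refine Finset.sum_congr rfl fun c _ => ?_
      split_ifs with h
      · rw [h.1, h.2]
      · refine (Finset.sum_eq_zero fun k' _ => ?_).symm
        split_ifs
        · rfl
        · by_contra hn
          exact h (M.q_supp _ _ _ _ hn).2
    rw [h2]
    refine (add_le_add h1 le_rfl).trans (le_of_eq ?_)
    rw [← Finset.sum_add_distrib, ← M.q_sum k i j]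
    exact Finset.sum_congr rfl fun s _ => by split_ifs <;> simp

/-- The initial unnormalized beliefs. -/
def initBel (c : M.Pub) (k : K) : ℝ := if M.absorbK k then 0 else M.π (k, c.1, M.dhat c.1)

theorem sum_l1_initBel_le : ∑ c, l1 (M.initBel c) ≤ 1 := by
  rw [← M.π_sum, M.sum_eq_sum_pub M.π_supp]
  refine Finset.sum_le_sum fun c _ => Finset.sum_le_sum fun k _ => ?_
  unfold initBel
  split_ifs
  · simpa using M.π_nonneg _
  · rw [abs_of_nonneg (M.π_nonneg _)]

/-- Records compatible with the signalling structure (in reverse order). -/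
def Consistent : List (K × C × D × I × J) → K × C × D → Prop
  | [], s => M.dhat s.2.1 = s.2.2 ∧ M.chat s.2.2 = s.2.1
  | z :: r, s => Consistent r (z.1, z.2.1, z.2.2.1) ∧
      (M.dhat s.2.1 = s.2.2 ∧ M.chat s.2.2 = s.2.1) ∧
        M.ihat s.2.1 = z.2.2.2.1 ∧ M.jhat s.2.2 = z.2.2.2.2

theorem Consistent.symm {M : Model K I J C D} {r : List (K × C × D × I × J)} {s : K × C × D}
    (h : M.Consistent r s) : M.dhat s.2.1 = s.2.2 ∧ M.chat s.2.2 = s.2.1 := by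
  cases r
  · exact h
  · exact h.2.1

/-- The public history along a record. -/
def pubHist : List (K × C × D × I × J) → List M.Pub := List.map fun z => M.toPub z.2.1

/-- Private history of player 1 recovered from the public history (in reverse order). -/
def hist1 : List M.Pub → M.Pub → List (C × I)
  | [], _ => []
  | c₀ :: h, c => (c₀.1, M.ihat c.1) :: hist1 h c₀

/-- Private history of player 2 recovered from the public history (in reverse order). -/
def hist2 : List M.Pub → M.Pub → List (D × J)
  | [], _ => []
  | c₀ :: h, c => (M.dhat c₀.1, M.jhat (M.dhat c.1)) :: hist2 h c₀

theorem map_hist1 (h : List M.Pub) (c : M.Pub) :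
    (M.hist1 h c).map (fun z => M.toPub z.1) = h := by
  induction h generalizing c with
  | nil => rfl
  | cons c₀ h ih => simp [hist1, ih]

theorem map_hist2 (h : List M.Pub) (c : M.Pub) :
    (M.hist2 h c).map (fun z => M.toPub (M.chat z.1)) = h := by
  induction h generalizing c with
  | nil => rfl
  | cons c₀ h ih => simp [hist2, ih, c₀.2]

theorem Consistent.p1hist_eq {M : Model K I J C D} {r : List (K × C × D × I × J)}
    {s : K × C × D} (h : M.Consistent r s) :
    p1hist r = M.hist1 (M.pubHist r) (M.toPub s.2.1) := by
  induction r generalizing s with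
  | nil => rfl
  | cons z r ih =>
    have h1 := ih h.1
    simp only [p1hist, pubHist, List.map_cons, hist1] at h1 ⊢
    rw [h1, M.val_toPub h.symm, h.2.2.1, M.val_toPub (s := (z.1, z.2.1, z.2.2.1)) h.1.symm]

theorem Consistent.p2hist_eq {M : Model K I J C D} {r : List (K × C × D × I × J)}
    {s : K × C × D} (h : M.Consistent r s) :
    p2hist r = M.hist2 (M.pubHist r) (M.toPub s.2.1) := by
  induction r generalizing s with
  | nil => rfl
  | cons z r ih =>
    have h1 := ih h.1
    simp only [p2hist, pubHist, List.map_cons, hist2] at h1 ⊢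
    rw [h1, M.val_toPub h.symm, h.symm.1, h.2.2.2,
      M.val_toPub (s := (z.1, z.2.1, z.2.2.1)) h.1.symm, h.1.symm.1]

/-- Public version of a strategy of player 1. -/
def pub1 [Fintype I] (σ : Strat1 C I) (h : List M.Pub) (c : M.Pub) : I → ℝ :=
  σ.play (M.hist1 h c).reverse c.1

/-- Public version of a strategy of player 2. -/
def pub2 [Fintype J] (τ : Strat2 D J) (h : List M.Pub) (c : M.Pub) : J → ℝ :=
  τ.play (M.hist2 h c).reverse (M.dhat c.1)

theorem pub1_mem [Fintype I] (σ : Strat1 C I) (h : List M.Pub) (c : M.Pub) :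
    M.pub1 σ h c ∈ stdSimplex ℝ I :=
  ⟨σ.nonneg _ _, σ.sum_one _ _⟩

theorem pub2_mem [Fintype J] (τ : Strat2 D J) (h : List M.Pub) (c : M.Pub) :
    M.pub2 τ h c ∈ stdSimplex ℝ J :=
  ⟨τ.nonneg _ _, τ.sum_one _ _⟩

theorem Consistent.play1_eq {M : Model K I J C D} [Fintype I] (σ : Strat1 C I)
    {r : List (K × C × D × I × J)} {s : K × C × D} (h : M.Consistent r s) :
    σ.play (p1hist r.reverse) s.2.1 = M.pub1 σ (M.pubHist r) (M.toPub s.2.1) := by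
  rw [pub1, ← h.p1hist_eq, M.val_toPub h.symm]
  exact congrArg (σ.play · _) List.map_reverse

theorem Consistent.play2_eq {M : Model K I J C D} [Fintype J] (τ : Strat2 D J)
    {r : List (K × C × D × I × J)} {s : K × C × D} (h : M.Consistent r s) :
    τ.play (p2hist r.reverse) s.2.2 = M.pub2 τ (M.pubHist r) (M.toPub s.2.1) := by
  rw [pub2, ← h.p2hist_eq, M.val_toPub h.symm, h.symm.1]
  exact congrArg (τ.play · _) List.map_reverse

section Strategies

variable [Fintype I] [Fintype J] (σ : Strat1 C I) (τ : Strat2 D J)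

theorem recE_congr {t : ℕ} {f f' : List (K × C × D × I × J) → K × C × D → ℝ}
    (h : ∀ r s, M.Consistent r s → f r s = f' r s) :
    recE M.q M.π σ τ t f = recE M.q M.π σ τ t f' := by
  induction t generalizing f f' with
  | zero =>
    refine Finset.sum_congr rfl fun s _ => ?_
    by_cases hs : M.π s = 0
    · simp [hs]
    · rw [h [] s (M.π_supp s hs)]
  | succ t ih =>
    refine ih fun r s hrs => ?_
    refine Finset.sum_congr rfl fun i _ => Finset.sum_congr rfl fun j _ =>
      Finset.sum_congr rfl fun s' _ => ?_
    by_cases hs : M.q s.1 i j s' = 0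
    · simp [hs]
    · rw [h (_ :: r) s' ⟨hrs, M.q_supp _ _ _ _ hs⟩]

/-- The conditional distribution of the non-absorbed state given the public history is
proportional to the unnormalized belief. -/
theorem recE_eq_pubE (t : ℕ) (f : List M.Pub → M.Pub → K → ℝ) :
    recE M.q M.π σ τ t (fun r s => if M.absorbK s.1 then 0 else
      f (M.pubHist r) (M.toPub s.2.1) s.1) =
    M.game.pubE (M.pub1 σ) (M.pub2 τ) t fun h c =>
      ∑ k, M.game.bel M.initBel h c k * f h c k := by
  induction t generalizing f with
  | zero =>
    rw [recE, M.sum_eq_sum_pub fun s hs => M.π_supp s (left_ne_zero_of_mul hs)]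
    refine Finset.sum_congr rfl fun c _ => Finset.sum_congr rfl fun k _ => ?_
    simp only [toPub_val, Game.bel, initBel, pubHist, List.map_nil]
    split_ifs <;> simp
  | succ t ih =>
    rw [recE, Game.pubE]
    have h1 : ∀ (h : List M.Pub) (c : M.Pub), ∑ c', M.pub1 σ h c (M.game.a c') *
        M.pub2 τ h c (M.game.b c') * ∑ k, M.game.bel M.initBel (c :: h) c' k * f (c :: h) c' k =
        ∑ k, M.game.bel M.initBel h c k * ∑ c', M.pub1 σ h c (M.game.a c') *
          M.pub2 τ h c (M.game.b c') * ∑ k', M.game.Q c' k k' * f (c :: h) c' k' := by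
      intro h c
      simp only [Game.bel, Game.step, Finset.mul_sum, Finset.sum_mul]
      rw [Finset.sum_comm (s := (Finset.univ : Finset K))]
      refine Finset.sum_congr rfl fun c' _ => ?_
      rw [Finset.sum_comm]
      exact Finset.sum_congr rfl fun k _ => Finset.sum_congr rfl fun k' _ => by ring
    simp only [h1]
    rw [← ih]
    refine M.recE_congr σ τ fun r s hrs => ?_
    simp only [hrs.play1_eq, hrs.play2_eq]
    split_ifs with hs
    · refine Finset.sum_eq_zero fun i _ => Finset.sum_eq_zero fun j _ =>
        Finset.sum_eq_zero fun s' _ => ?_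
      by_cases hq : M.q s.1 i j s' = 0
      · simp [hq]
      · simp [M.q_absorb _ _ _ _ hs hq, hs]
    · set h := M.pubHist r
      set c := M.toPub s.2.1
      have h2 : ∀ i j, ∑ s', M.pub1 σ h c i * M.pub2 τ h c j * M.q s.1 i j s' *
          (if M.absorbK s'.1 then 0 else
            f (M.pubHist ((s.1, s.2.1, s.2.2, i, j) :: r)) (M.toPub s'.2.1) s'.1) =
          ∑ c' : M.Pub, ∑ k', M.pub1 σ h c i * M.pub2 τ h c j *
            M.q s.1 i j (k', c'.1, M.dhat c'.1) *
            (if M.absorbK k' then 0 else f (c :: h) c' k') := fun i j => by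
        rw [M.sum_eq_sum_pub fun s' hs' => (M.q_supp _ _ _ s'
          (right_ne_zero_of_mul (left_ne_zero_of_mul hs'))).1]
        simp only [toPub_val]
        rfl
      simp only [h2]
      rw [Finset.sum_congr rfl fun i _ => Finset.sum_comm, Finset.sum_comm]
      refine Finset.sum_congr rfl fun c' _ => ?_
      have hzero : ∀ i j k', ¬ (M.ihat c'.1 = i ∧ M.jhat (M.dhat c'.1) = j) →
          M.q s.1 i j (k', c'.1, M.dhat c'.1) = 0 := fun i j k' hn => by
        by_contra hq
        exact hn (M.q_supp _ _ _ _ hq).2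
      rw [Finset.sum_eq_single (M.ihat c'.1), Finset.sum_eq_single (M.jhat (M.dhat c'.1))]
      · rw [Finset.mul_sum]
        refine Finset.sum_congr rfl fun k' _ => ?_
        simp only [game, hs, false_or]
        split_ifs <;> ring
      · intro j _ hj
        exact Finset.sum_eq_zero fun k' _ => by
          rw [hzero _ j k' fun hh => hj hh.2.symm]; ring
      · simp
      · intro i _ hi
        exact Finset.sum_eq_zero fun j _ => Finset.sum_eq_zero fun k' _ => by
          rw [hzero i j k' fun hh => hi hh.1.symm]; ring
      · simp

theorem recE_pay_succ (t : ℕ) :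
    recE M.q M.π σ τ (t + 1) (fun _ s => M.pay s.1) =
      recE M.q M.π σ τ t (fun _ s => M.pay s.1) +
        M.game.pubE (M.pub1 σ) (M.pub2 τ) t
          (M.game.pubRew (M.pub1 σ) (M.pub2 τ) M.initBel) := by
  have h1 : M.game.pubRew (M.pub1 σ) (M.pub2 τ) M.initBel = fun h c =>
      ∑ k, M.game.bel M.initBel h c k *
        ∑ i, ∑ j, M.pub1 σ h c i * M.pub2 τ h c j * M.game.r k i j := by
    ext h c
    simp only [Game.pubRew, Game.rew, Finset.mul_sum]
    rw [Finset.sum_congr rfl fun i _ => Finset.sum_comm, Finset.sum_comm]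
    exact Finset.sum_congr rfl fun k _ => Finset.sum_congr rfl fun i _ =>
      Finset.sum_congr rfl fun j _ => by ring
  rw [h1, ← recE_eq_pubE, ← recE_add, recE]
  refine M.recE_congr σ τ fun r s hrs => ?_
  simp only [hrs.play1_eq, hrs.play2_eq]
  set h := M.pubHist r
  set c := M.toPub s.2.1
  simp only [mul_assoc, ← Finset.mul_sum]
  split_ifs with hs
  · have h2 : ∀ i j, ∑ s', M.q s.1 i j s' * M.pay s'.1 = M.pay s.1 := fun i j => by
      rw [← one_mul (M.pay s.1), ← M.q_sum s.1 i j, Finset.sum_mul]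
      refine Finset.sum_congr rfl fun s' _ => ?_
      by_cases hq : M.q s.1 i j s' = 0
      · simp [hq]
      · rw [M.q_absorb _ _ _ _ hs hq]
    simp only [h2, ← Finset.sum_mul, (M.pub1_mem σ h c).2, (M.pub2_mem τ h c).2]
    ring
  · simp [game, hs, M.pay_eq_zero _ hs]

/-- Average payoffs in terms of the game with public signals. -/
theorem avgPay_eq {g : K → I → J → ℝ} (hg : ∀ k i j, g k i j = M.pay k) (n : ℕ) :
    avgPay g M.q M.π σ τ n = (n : ℝ)⁻¹ * ∑ t ∈ Finset.range n,
      (∑ s, M.π s * M.pay s.1 + ∑ u ∈ Finset.range t, M.game.pubE (M.pub1 σ) (M.pub2 τ) u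
        (M.game.pubRew (M.pub1 σ) (M.pub2 τ) M.initBel)) := by
  have h1 : ∀ t, recE M.q M.π σ τ t (fun _ s => M.pay s.1) =
      ∑ s, M.π s * M.pay s.1 + ∑ u ∈ Finset.range t, M.game.pubE (M.pub1 σ) (M.pub2 τ) u
        (M.game.pubRew (M.pub1 σ) (M.pub2 τ) M.initBel) := fun t => by
    induction t with
    | zero => simp [recE]
    | succ t ih => rw [recE_pay_succ, ih, Finset.sum_range_succ, add_assoc]
  have h2 : ∀ t, sPayoff g M.q M.π σ τ (t + 1) =
      recE M.q M.π σ τ t (fun _ s => M.pay s.1) := fun t => by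
    rw [sPayoff_succ]
    congr 1
    ext r s
    simp only [hg, mul_assoc, ← Finset.mul_sum, ← Finset.sum_mul, σ.sum_one, τ.sum_one, one_mul]
  have h3 : ∑ t ∈ Finset.Icc 1 n, sPayoff g M.q M.π σ τ t =
      ∑ t ∈ Finset.range n, sPayoff g M.q M.π σ τ (t + 1) := by
    rw [Finset.range_eq_Ico, Finset.sum_Ico_add' (fun t => sPayoff g M.q M.π σ τ t)]
    rfl
  simp only [avgPay, h3, h2, h1]

end Strategies

end Model

theorem le_inv_mul_of_mul_sub_le {w e M S : ℝ} {n : ℕ} (he : 0 < e) (hn : ⌈|M| / e⌉₊ + 1 ≤ n)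
    (h : n * (w - 2 * e) - M ≤ S) : w - 3 * e ≤ (n : ℝ)⁻¹ * S := by
  have h1 : |M| / e ≤ n := (Nat.le_ceil _).trans (by exact_mod_cast (Nat.le_succ _).trans hn)
  have h2 : (0 : ℝ) < n := by exact_mod_cast (Nat.succ_pos _).trans_le hn
  rw [div_le_iff₀ he] at h1
  rw [inv_mul_eq_div, le_div_iff₀ h2]
  linarith [le_abs_self M]

namespace Model

variable {K I J C D : Type} [Fintype K] [Fintype I] [Fintype J] [Fintype C] [Fintype D]
  (M : Model K I J C D) {g : K → I → J → ℝ}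

/-- The payoff accruing from a function of the unnormalized beliefs. -/
def total (V : (K → ℝ) → ℝ) : ℝ := ∑ s, M.π s * M.pay s.1 + ∑ c, V (M.initBel c)

theorem p1Guarantees (hg : ∀ k i j, g k i j = M.pay k) {V : (K → ℝ) → ℝ}
    (hV : M.game.Secured V) : P1Guarantees g M.q M.π (M.total V) := by
  intro ε hε
  obtain ⟨ρ, hρ, B, hB⟩ := hV.exists_strategy M.sum_l1_initBel_le
    (ε := min (ε / 3) 1) (by positivity) (min_le_right _ _)
  have hε3 := min_le_left (ε / 3) 1
  have he : 0 < min (ε / 3) 1 := by positivity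
  set e := min (ε / 3) 1
  let σ : Strat1 C I :=
    { play := fun h c => ρ (h.reverse.map fun z => M.toPub z.1) (M.toPub c)
      nonneg := fun _ _ => (hρ _ _).1
      sum_one := fun _ _ => (hρ _ _).2 }
  have hσ : M.pub1 σ = ρ := by
    ext1 h
    ext1 c
    simp only [pub1, σ, List.reverse_reverse, map_hist1, toPub_val]
  refine ⟨σ, ⌈|B| / e⌉₊ + 1, Nat.le_add_left _ _, fun n hn τ => ?_⟩
  have h := hB (M.pub2 τ) (M.pub2_mem τ) n
  rw [M.avgPay_eq σ τ hg, hσ]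
  refine le_trans (by linarith) (le_inv_mul_of_mul_sub_le (w := M.total V) he hn ?_)
  rw [Finset.sum_add_distrib, Finset.sum_const, Finset.card_range, nsmul_eq_mul, total]
  linarith

theorem p2Guarantees (hg : ∀ k i j, g k i j = M.pay k) {V : (K → ℝ) → ℝ}
    (hV : M.game.swap.Secured fun x => - V x) : P2Guarantees g M.q M.π (M.total V) := by
  intro ε hε
  obtain ⟨θ, hθ, B, hB⟩ := hV.exists_strategy M.sum_l1_initBel_le
    (ε := min (ε / 3) 1) (by positivity) (min_le_right _ _)
  have hε3 := min_le_left (ε / 3) 1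
  have he : 0 < min (ε / 3) 1 := by positivity
  set e := min (ε / 3) 1
  let τ : Strat2 D J :=
    { play := fun h d => θ (h.reverse.map fun z => M.toPub (M.chat z.1)) (M.toPub (M.chat d))
      nonneg := fun _ _ => (hθ _ _).1
      sum_one := fun _ _ => (hθ _ _).2 }
  have hτ : M.pub2 τ = θ := by
    ext1 h
    ext1 c
    simp only [pub2, τ, List.reverse_reverse, map_hist2, c.2, toPub_val]
  refine ⟨τ, ⌈|B| / e⌉₊ + 1, Nat.le_add_left _ _, fun n hn σ => ?_⟩
  have h := hB (M.pub1 σ) (M.pub1_mem σ) n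
  have hswap : ∀ t, M.game.swap.pubE θ (M.pub1 σ) t (M.game.swap.pubRew θ (M.pub1 σ) M.initBel) =
      - M.game.pubE (M.pub1 σ) θ t (M.game.pubRew (M.pub1 σ) θ M.initBel) := fun t => by
    rw [Game.pubE_swap, neg_eq_neg_one_mul, ← Game.pubE_mul]
    congr 1
    ext h c
    exact Game.pubRew_swap ..
  simp only [hswap, Finset.sum_neg_distrib] at h
  rw [M.avgPay_eq σ τ hg, hτ]
  have := le_inv_mul_of_mul_sub_le (w := - M.total V) (S := - ∑ t ∈ Finset.range n,
    (∑ s, M.π s * M.pay s.1 + ∑ u ∈ Finset.range t, M.game.pubE (M.pub1 σ) θ u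
      (M.game.pubRew (M.pub1 σ) θ M.initBel))) he hn (by
    rw [Finset.sum_add_distrib, Finset.sum_const, Finset.card_range, nsmul_eq_mul, total]
    linarith)
  rw [mul_neg] at this
  linarith

end Model

end PublicGame

open SigGame in
/-- Let `Γ` be a finite recursive game with symmetric signals
(each player is more informed than the other). Then for every initial distribution
`π ∈ Δ*(K×C×D)` the game `Γ(π)` has a uniform value: the uniform maxmin and the
uniform minmax both exist and are equal. -/
theorem recursive_game_symmetric_signals_uniform_value
    {K I J C D : Type} [Fintype K] [Fintype I] [Fintype J] [Fintype C] [Fintype D]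
    [Nonempty I] [Nonempty J]
    (g : K → I → J → ℝ) (hg : ∀ k i j, |g k i j| ≤ 1)
    (q : K → I → J → K × C × D → ℝ)
    (hq0 : ∀ k i j s, 0 ≤ q k i j s)
    (hq1 : ∀ k i j, ∑ s : K × C × D, q k i j s = 1)
    (ihat : C → I) (jhat : D → J)
    (hsig : ∀ k : K, ∀ i : I, ∀ j : J,
      ∑ s : K × C × D, (if ihat s.2.1 = i ∧ jhat s.2.2 = j then q k i j s else 0) = 1)
    (absorbK : K → Prop)
    (hact : ∀ k, ¬ absorbK k → ∀ i j, g k i j = 0)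
    (habs : ∀ k, absorbK k → ∀ i j,
      ∑ s : K × C × D, (if s.1 = k then q k i j s else 0) = 1)
    (habsg : ∀ k, absorbK k → ∀ i j i' j', g k i j = g k i' j')
    (dhat : C → D) (chat : D → C)
    (hinf1 : ∀ k i j,
      ∑ s : K × C × D, (if dhat s.2.1 = s.2.2 then q k i j s else 0) = 1)
    (hinf2 : ∀ k i j,
      ∑ s : K × C × D, (if chat s.2.2 = s.2.1 then q k i j s else 0) = 1)
    (π : K × C × D → ℝ) (hπ0 : ∀ s, 0 ≤ π s) (hπ1 : ∑ s : K × C × D, π s = 1)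
    (hπsym : ∑ s : K × C × D,
      (if dhat s.2.1 = s.2.2 ∧ chat s.2.2 = s.2.1 then π s else 0) = 1) :
    ∃ w : ℝ,
      (P1Guarantees g q π w ∧ P2Defends g q π w) ∧
      (P2Guarantees g q π w ∧ P1Defends g q π w) := by
  have hpay : ∀ k i j, g k i j = g k (Classical.arbitrary I) (Classical.arbitrary J) :=
    fun k i j => by
      by_cases hk : absorbK k
      · exact habsg k hk _ _ _ _
      · rw [hact k hk, hact k hk]
  let M : PublicGame.Model K I J C D :=
    { q := q
      π := π
      ihat := ihat
      jhat := jhat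
      absorbK := absorbK
      dhat := dhat
      chat := chat
      pay := fun k => g k (Classical.arbitrary I) (Classical.arbitrary J)
      q_nonneg := hq0
      q_sum := hq1
      q_supp := fun k i j s hs =>
        ⟨⟨PublicGame.of_sum_ite_eq_one (hq0 k i j) (hq1 k i j) _ (hinf1 k i j) s hs,
          PublicGame.of_sum_ite_eq_one (hq0 k i j) (hq1 k i j) _ (hinf2 k i j) s hs⟩,
          PublicGame.of_sum_ite_eq_one (hq0 k i j) (hq1 k i j) _ (hsig k i j) s hs⟩
      q_absorb := fun k i j s hk hs =>
        PublicGame.of_sum_ite_eq_one (hq0 k i j) (hq1 k i j) _ (habs k hk i j) s hs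
      π_nonneg := hπ0
      π_sum := hπ1
      π_supp := fun s hs => PublicGame.of_sum_ite_eq_one hπ0 hπ1 _ hπsym s hs
      abs_pay_le := fun k => hg k _ _
      pay_eq_zero := fun k hk => hact k hk _ _ }
  obtain ⟨V, hV1, hV2⟩ := M.game.exists_secured
  have h1 : P1Guarantees g q π (M.total V) := M.p1Guarantees hpay hV1
  have h2 : P2Guarantees g q π (M.total V) := M.p2Guarantees hpay hV2
  refine ⟨M.total V, ⟨h1, fun ε hε σ => ?_⟩, h2, fun ε hε τ => ?_⟩
  · obtain ⟨τ, n₀, hn₀, h⟩ := h2 ε hε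
    exact ⟨τ, n₀, hn₀, fun n hn => h n hn σ⟩
  · obtain ⟨σ, n₀, hn₀, h⟩ := h1 ε hε
    exact ⟨σ, n₀, hn₀, fun n hn => h n hn τ⟩
end
end
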